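/- Fix an integer d ≥ 2 and a real 0 < c < c_d^*. Then there exist constants a, b > 0 (depending only on d and c) such that asymptotically almost surely a·n ≤ |SH_ℝ(Y_d(n, c/n))| ≤ b·n; that is, the ℝ-shadow of Y_d(n,c/n) a.a.s. has size Θ(n). -/

import Mathlib

open Finset Filter
open scoped Classical

noncomputable section

/-- The set of all possible `d`-faces: `(d+1)`-element subsets of `[n]`. -/
def allFaces (n d : ℕ) : Finset (Finset (Fin n)) :=
  Finset.univ.filter (fun σ => σ.card = d + 1)

/-- Probability of the event `E` under `Y_d(n,p)`. -/
def probY (n d : ℕ) (p : ℝ) (E : Finset (Finset (Fin n)) → Prop) : ℝ :=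
  ∑ F ∈ (allFaces n d).powerset,
    if E F then p ^ F.card * (1 - p) ^ ((allFaces n d).card - F.card) else 0

/-- Expectation of `X` under `Y_d(n,p)`. -/
def expectY (n d : ℕ) (p : ℝ) (X : Finset (Finset (Fin n)) → ℝ) : ℝ :=
  ∑ F ∈ (allFaces n d).powerset,
    p ^ F.card * (1 - p) ^ ((allFaces n d).card - F.card) * X F

/-- Coefficient of the `d`-face `τ` in the boundary of `σ`. -/
def bdCoeff {n : ℕ} (τ σ : Finset (Fin n)) : ℝ :=
  if τ ⊆ σ ∧ τ.card + 1 = σ.card then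
    ∑ v ∈ σ \ τ, (-1 : ℝ) ^ (σ.filter (fun w => w < v)).card
  else 0

/-- The boundary operator `∂_d(F) : ℝ^F → ℝ^{(d-1)-faces}`. -/
def boundaryMap (n : ℕ) (F : Finset (Finset (Fin n))) :
    (↥F → ℝ) →ₗ[ℝ] (Finset (Fin n) → ℝ) where
  toFun x := fun τ => ∑ σ ∈ F.attach, x σ * bdCoeff τ σ.1
  map_add' x y := by
    funext τ
    simp [add_mul, Finset.sum_add_distrib]
  map_smul' c x := by
    funext τ
    simp [Finset.mul_sum, mul_assoc]

/-- Dimension of the kernel of `∂_d(F)`, i.e. `dim H_d`. -/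
def dimKer (n : ℕ) (F : Finset (Finset (Fin n))) : ℕ :=
  Module.finrank ℝ (LinearMap.ker (boundaryMap n F))

/-- The real shadow of `F`. -/
def shadowR (n d : ℕ) (F : Finset (Finset (Fin n))) : Finset (Finset (Fin n)) :=
  (allFaces n d).filter (fun σ => σ ∉ F ∧ dimKer n F < dimKer n (insert σ F))

/-- The `(d+2)`-subsets all of whose `(d+1)`-subsets are faces of `F`. -/
def simplexBoundaries (n d : ℕ) (F : Finset (Finset (Fin n))) : Finset (Finset (Fin n)) :=
  Finset.univ.filter (fun τ => τ.card = d + 2 ∧ ∀ s ∈ τ.powerset, s.card = d + 1 → s ∈ F)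

/-- The boundary cycle of the `(d+2)`-subset `τ`, as a vector in `ℝ^F`. -/
def simplexCycle (n : ℕ) (F : Finset (Finset (Fin n))) (τ : Finset (Fin n)) : ↥F → ℝ :=
  fun σ => bdCoeff σ.1 τ


section Part1
/-! ## Part A: finite product probability -/

def Ew {α : Type*} (A : Finset α) (p : ℝ) (g : Finset α → ℝ) : ℝ :=
  ∑ F ∈ A.powerset, p ^ F.card * (1 - p) ^ (A.card - F.card) * g F

lemma Ew_empty {α : Type*} (p : ℝ) (g : Finset α → ℝ) : Ew ∅ p g = g ∅ := by
  simp [Ew]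

lemma Ew_insert {α : Type*} {A : Finset α} {a : α} (ha : a ∉ A) (p : ℝ) (g : Finset α → ℝ) :
    Ew (insert a A) p g = (1 - p) * Ew A p g + p * Ew A p (fun F => g (insert a F)) := by
  unfold Ew
  rw [Finset.sum_powerset_insert ha, Finset.mul_sum, Finset.mul_sum]
  congr 1
  · refine Finset.sum_congr rfl fun F hF => ?_
    have h1 := Finset.card_le_card (Finset.mem_powerset.1 hF)
    rw [Finset.card_insert_of_notMem ha, Nat.succ_sub h1, pow_succ]
    ring
  · refine Finset.sum_congr rfl fun F hF => ?_
    have h2 : a ∉ F := fun h => ha (Finset.mem_powerset.1 hF h)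
    rw [Finset.card_insert_of_notMem ha, Finset.card_insert_of_notMem h2, Nat.add_sub_add_right,
      pow_succ]
    ring

lemma Ew_congr {α : Type*} {A : Finset α} {p : ℝ} {g g' : Finset α → ℝ}
    (h : ∀ F, F ⊆ A → g F = g' F) : Ew A p g = Ew A p g' := by
  unfold Ew
  refine Finset.sum_congr rfl fun F hF => ?_
  rw [h F (Finset.mem_powerset.1 hF)]

lemma Ew_add {α : Type*} (A : Finset α) (p : ℝ) (g g' : Finset α → ℝ) :
    Ew A p (fun F => g F + g' F) = Ew A p g + Ew A p g' := by
  unfold Ew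
  rw [← Finset.sum_add_distrib]
  exact Finset.sum_congr rfl fun F _ => by ring

lemma Ew_sub {α : Type*} (A : Finset α) (p : ℝ) (g g' : Finset α → ℝ) :
    Ew A p (fun F => g F - g' F) = Ew A p g - Ew A p g' := by
  unfold Ew
  rw [← Finset.sum_sub_distrib]
  exact Finset.sum_congr rfl fun F _ => by ring

lemma Ew_mul {α : Type*} (A : Finset α) (p c : ℝ) (g : Finset α → ℝ) :
    Ew A p (fun F => c * g F) = c * Ew A p g := by
  unfold Ew
  rw [Finset.mul_sum]
  exact Finset.sum_congr rfl fun F _ => by ring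

lemma Ew_sum {α β : Type*} (A : Finset α) (p : ℝ) (s : Finset β) (g : β → Finset α → ℝ) :
    Ew A p (fun F => ∑ b ∈ s, g b F) = ∑ b ∈ s, Ew A p (g b) := by
  unfold Ew
  rw [Finset.sum_comm]
  exact Finset.sum_congr rfl fun F _ => by rw [Finset.mul_sum]

lemma Ew_const {α : Type*} (A : Finset α) (p c : ℝ) : Ew A p (fun _ => c) = c := by
  induction A using Finset.induction_on with
  | empty => simp [Ew_empty]
  | insert a A ha ih => rw [Ew_insert ha, ih]; ring

lemma Ew_mono {α : Type*} {A : Finset α} {p : ℝ} (h0 : 0 ≤ p) (h1 : p ≤ 1)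
    {g g' : Finset α → ℝ} (h : ∀ F, F ⊆ A → g F ≤ g' F) : Ew A p g ≤ Ew A p g' := by
  unfold Ew
  refine Finset.sum_le_sum fun F hF => ?_
  have : 0 ≤ 1 - p := by linarith
  exact mul_le_mul_of_nonneg_left (h F (Finset.mem_powerset.1 hF)) (by positivity)

lemma Ew_nonneg {α : Type*} {A : Finset α} {p : ℝ} (h0 : 0 ≤ p) (h1 : p ≤ 1)
    {g : Finset α → ℝ} (h : ∀ F, F ⊆ A → 0 ≤ g F) : 0 ≤ Ew A p g := by
  have := Ew_mono (g := fun _ => 0) h0 h1 h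
  rwa [Ew_const] at this

lemma Ew_union {α : Type*} {A B : Finset α} (h : Disjoint A B) (p : ℝ) (g : Finset α → ℝ) :
    Ew (A ∪ B) p g = Ew A p (fun F => Ew B p (fun G => g (F ∪ G))) := by
  induction A using Finset.induction_on generalizing g with
  | empty => simp [Ew_empty]
  | insert a A ha ih =>
    rw [Finset.disjoint_insert_left] at h
    rw [Finset.insert_union, Ew_insert (by simp [ha, h.1]), Ew_insert ha, ih h.2, ih h.2]
    simp only [Finset.insert_union]

lemma Ew_sprinkle {α : Type*} (A : Finset α) (p q : ℝ) (g : Finset α → ℝ) :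
    Ew A p (fun F => Ew A q (fun R => g (F ∪ R))) = Ew A (p + q - p * q) g := by
  induction A using Finset.induction_on generalizing g with
  | empty => simp [Ew_empty]
  | insert a A ha ih =>
    simp only [Ew_insert ha, Ew_add, Ew_mul, ← ih]
    simp only [Finset.insert_union, Finset.union_insert, Finset.insert_idem]
    ring

lemma Ew_subset {α : Type*} {A S : Finset α} (hS : S ⊆ A) (p : ℝ) :
    Ew A p (fun F => if S ⊆ F then 1 else 0) = p ^ S.card := by
  induction A using Finset.induction_on generalizing S with
  | empty =>
    have : S = ∅ := Finset.subset_empty.1 hS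
    subst this; simp [Ew_empty]
  | insert a A ha ih =>
    rw [Ew_insert ha]
    by_cases haS : a ∈ S
    · have h1 : Ew A p (fun F => if S ⊆ F then (1:ℝ) else 0) = 0 := by
        rw [Ew_congr (g' := fun _ => 0), Ew_const]
        intro F hF
        rw [if_neg]
        exact fun h => ha (hF (h haS))
      have h2 : Ew A p (fun F => if S ⊆ insert a F then (1:ℝ) else 0) = p ^ (S.erase a).card := by
        rw [← ih (S := S.erase a) (by rwa [← Finset.subset_insert_iff])]
        exact Ew_congr fun F hF => by simp only [Finset.subset_insert_iff]
      rw [h1, h2, ← Finset.card_erase_add_one haS, pow_succ]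
      ring
    · have hSA : S ⊆ A := (Finset.subset_insert_iff_of_notMem haS).1 hS
      have h2 : Ew A p (fun F => if S ⊆ insert a F then (1:ℝ) else 0) = p ^ S.card := by
        rw [← ih hSA]
        exact Ew_congr fun F hF => by simp only [Finset.subset_insert_iff_of_notMem haS]
      rw [h2, ih hSA]; ring

/-- expectation of a function of a subset of the coordinates -/
lemma Ew_restrict {α : Type*} {A B : Finset α} (h : B ⊆ A) (p : ℝ) (g : Finset α → ℝ)
    (hg : ∀ F, F ⊆ A → g F = g (F ∩ B)) : Ew A p g = Ew B p g := by
  have hA : A = B ∪ (A \ B) := (Finset.union_sdiff_of_subset h).symm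
  rw [hA, Ew_union Finset.disjoint_sdiff]
  refine Ew_congr fun F hF => ?_
  rw [← Ew_const (A \ B) p (g F)]
  refine Ew_congr fun G hG => ?_
  rw [hg _ (by rw [hA]; exact Finset.union_subset_union hF hG)]
  congr 1
  ext x
  have := @hF x
  have := @hG x
  simp at *
  tauto

/-- Markov -/
lemma Ew_markov {α : Type*} {A : Finset α} {p : ℝ} (h0 : 0 ≤ p) (h1 : p ≤ 1)
    {g : Finset α → ℝ} (hg : ∀ F, F ⊆ A → 0 ≤ g F) {t : ℝ} (ht : 0 < t) :
    Ew A p (fun F => if t ≤ g F then 1 else 0) ≤ Ew A p g / t := by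
  rw [le_div_iff₀ ht, mul_comm, ← Ew_mul]
  refine Ew_mono h0 h1 fun F hF => ?_
  split_ifs with h
  · simpa using h
  · simpa using hg F hF

/-- union bound for containing one of a family of sets of given size -/
lemma Ew_exists_subset_le {α : Type*} {A : Finset α} {p : ℝ} (h0 : 0 ≤ p) (h1 : p ≤ 1)
    (S : Finset (Finset α)) (hS : ∀ Z ∈ S, Z ⊆ A) :
    Ew A p (fun F => if ∃ Z ∈ S, Z ⊆ F then 1 else 0) ≤ ∑ Z ∈ S, p ^ Z.card := by
  have : ∑ Z ∈ S, p ^ Z.card = Ew A p (fun F => ∑ Z ∈ S, if Z ⊆ F then 1 else 0) := by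
    rw [Ew_sum]
    exact Finset.sum_congr rfl fun Z hZ => (Ew_subset (hS Z hZ) p).symm
  rw [this]
  refine Ew_mono h0 h1 fun F hF => ?_
  split_ifs with h
  · obtain ⟨Z, hZ, hZF⟩ := h
    refine le_trans (by simp [hZF]) (Finset.single_le_sum (f := fun Z => if Z ⊆ F then (1:ℝ) else 0)
      (fun Z _ => by positivity) hZ)
  · exact Finset.sum_nonneg fun Z _ => by positivity

lemma probY_eq (n d : ℕ) (p : ℝ) (E : Finset (Finset (Fin n)) → Prop) :
    probY n d p E = Ew (allFaces n d) p (fun F => if E F then 1 else 0) := by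
  unfold probY Ew
  exact Finset.sum_congr rfl fun F _ => by by_cases h : E F <;> simp [h]

end Part1

section Part2
/-! ## Part B: linear algebra of the boundary operator -/

def colv {n : ℕ} (σ : Finset (Fin n)) : Finset (Fin n) → ℝ := fun τ => bdCoeff τ σ

def Wsp {n : ℕ} (F : Finset (Finset (Fin n))) : Submodule ℝ (Finset (Fin n) → ℝ) :=
  Submodule.span ℝ (colv '' (F : Set (Finset (Fin n))))

lemma Wsp_mono {n : ℕ} {F G : Finset (Finset (Fin n))} (h : F ⊆ G) : Wsp F ≤ Wsp G :=
  Submodule.span_mono (Set.image_mono (by exact_mod_cast h))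

lemma colv_mem {n : ℕ} {F : Finset (Finset (Fin n))} {σ} (h : σ ∈ F) : colv σ ∈ Wsp F :=
  Submodule.subset_span ⟨σ, by exact_mod_cast h, rfl⟩

lemma Wsp_insert {n : ℕ} (F : Finset (Finset (Fin n))) (σ) :
    Wsp (insert σ F) = Submodule.span ℝ {colv σ} ⊔ Wsp F := by
  unfold Wsp
  rw [Finset.coe_insert, Set.image_insert_eq, Submodule.span_insert]

lemma Wsp_insert_of_mem {n : ℕ} {F : Finset (Finset (Fin n))} {σ} (h : colv σ ∈ Wsp F) :
    Wsp (insert σ F) = Wsp F := by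
  rw [Wsp_insert, sup_eq_right, Submodule.span_singleton_le_iff_mem]
  exact h

lemma range_boundaryMap {n : ℕ} (F : Finset (Finset (Fin n))) :
    LinearMap.range (boundaryMap n F) = Wsp F := by
  have key : ∀ x, boundaryMap n F x = ∑ σ : F, x σ • colv σ.1 := by
    intro x
    funext τ
    simp [boundaryMap, colv]
  apply le_antisymm
  · rintro _ ⟨x, rfl⟩
    rw [key]
    exact Submodule.sum_mem _ fun σ _ => Submodule.smul_mem _ _ (colv_mem σ.2)
  · unfold Wsp
    rw [Submodule.span_le]
    rintro _ ⟨σ, hσ, rfl⟩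
    refine ⟨Pi.single ⟨σ, by exact_mod_cast hσ⟩ 1, ?_⟩
    rw [key, Finset.sum_eq_single ⟨σ, by exact_mod_cast hσ⟩]
    · simp
    · intro b _ hb
      simp [Pi.single_apply, hb]
    · simp

lemma dimKer_add {n : ℕ} (F : Finset (Finset (Fin n))) :
    dimKer n F + Module.finrank ℝ (Wsp F) = F.card := by
  have := LinearMap.finrank_range_add_finrank_ker (boundaryMap n F)
  rw [range_boundaryMap] at this
  unfold dimKer
  rw [add_comm, this]
  simp

lemma finrank_Wsp_insert_le {n : ℕ} (F : Finset (Finset (Fin n))) (σ) :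
    Module.finrank ℝ (Wsp (insert σ F)) ≤ Module.finrank ℝ (Wsp F) + 1 := by
  rw [Wsp_insert]
  have h1 := Submodule.finrank_add_le_finrank_add_finrank (Submodule.span ℝ {colv σ}) (Wsp F)
  have h2 := finrank_span_le_card (R := ℝ) ({colv σ} : Set (Finset (Fin n) → ℝ))
  simp at h2
  omega

lemma finrank_Wsp_union_le {n : ℕ} (F G : Finset (Finset (Fin n))) :
    Module.finrank ℝ (Wsp (F ∪ G)) ≤ Module.finrank ℝ (Wsp F) + G.card := by
  induction G using Finset.induction_on with
  | empty => rw [Finset.union_empty]; simp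
  | insert a G ha ih =>
    rw [Finset.union_insert, Finset.card_insert_of_notMem ha]
    have := finrank_Wsp_insert_le (F ∪ G) a
    omega

lemma mem_shadowR {n d : ℕ} {F : Finset (Finset (Fin n))} {σ : Finset (Fin n)} :
    σ ∈ shadowR n d F ↔ σ ∈ allFaces n d ∧ σ ∉ F ∧ colv σ ∈ Wsp F := by
  unfold shadowR
  rw [Finset.mem_filter]
  refine and_congr_right fun _ => and_congr_right fun hσ => ?_
  have h1 := dimKer_add F
  have h2 := dimKer_add (insert σ F)
  rw [Finset.card_insert_of_notMem hσ] at h2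
  constructor
  · intro h
    have h3 : Module.finrank ℝ (Wsp (insert σ F)) ≤ Module.finrank ℝ (Wsp F) := by omega
    have h4 := Submodule.eq_of_le_of_finrank_le (Wsp_mono (Finset.subset_insert σ F)) h3
    rw [h4]
    exact colv_mem (Finset.mem_insert_self _ _)
  · intro h
    rw [Wsp_insert_of_mem h] at h2
    omega

lemma dimKer_union_ge {n d : ℕ} (F R : Finset (Finset (Fin n))) :
    (R ∩ shadowR n d F).card ≤ dimKer n (F ∪ R) := by
  have h1 : Wsp (F ∪ ((R \ shadowR n d F) \ F)) = Wsp (F ∪ R) := by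
    apply le_antisymm
    · apply Wsp_mono
      intro x; simp; tauto
    · rw [Wsp, Submodule.span_le]
      rintro _ ⟨σ, hσ, rfl⟩
      by_cases h : σ ∈ shadowR n d F
      · exact Wsp_mono Finset.subset_union_left (mem_shadowR.1 h).2.2
      · apply colv_mem
        simp at hσ ⊢
        tauto
  have h2 := finrank_Wsp_union_le F ((R \ shadowR n d F) \ F)
  rw [h1] at h2
  have h3 := dimKer_add (F ∪ R)
  have h4 := dimKer_add F
  have h5 : (F ∪ R).card = F.card + (R ∩ shadowR n d F).card + ((R \ shadowR n d F) \ F).card := by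
    have e : F ∪ R = F ∪ ((R ∩ shadowR n d F) ∪ ((R \ shadowR n d F) \ F)) := by
      ext x; simp; tauto
    rw [e, Finset.card_union_of_disjoint, Finset.card_union_of_disjoint, add_assoc]
    · rw [Finset.disjoint_left]; intro x; simp; tauto
    · rw [Finset.disjoint_left]; intro x hx
      have : x ∉ shadowR n d F := fun h => (mem_shadowR.1 h).2.1 hx
      simp; tauto
  omega

lemma mem_allFaces {n d : ℕ} {σ : Finset (Fin n)} : σ ∈ allFaces n d ↔ σ.card = d + 1 := by
  simp [allFaces]

/-- the sign of a vertex in a set -/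
def sgn {n : ℕ} (σ : Finset (Fin n)) (v : Fin n) : ℝ :=
  (-1 : ℝ) ^ (σ.filter (fun w => w < v)).card

lemma sgn_sq {n : ℕ} (σ : Finset (Fin n)) (v : Fin n) : sgn σ v * sgn σ v = 1 := by
  unfold sgn
  rw [← mul_pow]; simp

lemma bdCoeff_erase {n : ℕ} {σ : Finset (Fin n)} {v : Fin n} (hv : v ∈ σ) :
    bdCoeff (σ.erase v) σ = sgn σ v := by
  unfold bdCoeff
  rw [if_pos ⟨Finset.erase_subset _ _, Finset.card_erase_add_one hv⟩]
  have : σ \ σ.erase v = {v} := by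
    ext x; simp
    constructor
    · rintro ⟨h1, h2⟩; by_contra h3; exact h2 h3 h1
    · rintro rfl; exact ⟨hv, by simp⟩
  rw [this]; simp [sgn]

lemma exists_erase_of_subset {n : ℕ} {σ τ : Finset (Fin n)} (h : τ ⊆ σ)
    (hc : τ.card + 1 = σ.card) : ∃ v ∈ σ, τ = σ.erase v := by
  obtain ⟨v, hv, e⟩ := (Finset.covBy_iff_card_sdiff_eq_one.2 ⟨h, by
    rw [Finset.card_sdiff_of_subset h]; omega⟩ : τ ⋖ σ).exists_finset_erase
  exact ⟨v, hv, e.symm⟩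

lemma colv_eq {n : ℕ} (σ : Finset (Fin n)) :
    colv σ = ∑ v ∈ σ, sgn σ v • Pi.single (σ.erase v) (1 : ℝ) := by
  funext τ
  unfold colv
  rw [Finset.sum_apply]
  by_cases h : τ ⊆ σ ∧ τ.card + 1 = σ.card
  · obtain ⟨v, hv, rfl⟩ := exists_erase_of_subset h.1 h.2
    rw [bdCoeff_erase hv, Finset.sum_eq_single v]
    · simp
    · intro b hb hbv
      simp only [Pi.smul_apply, smul_eq_mul, mul_eq_zero, Pi.single_apply]
      right
      rw [if_neg]
      intro e
      have : v ∈ σ.erase b := by simp [hv, Ne.symm hbv]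
      rw [← e] at this; simp at this
    · intro h; exact absurd hv h
  · unfold bdCoeff
    rw [if_neg h]
    symm
    apply Finset.sum_eq_zero
    intro v hv
    simp only [Pi.smul_apply, smul_eq_mul, mul_eq_zero, Pi.single_apply]
    right
    rw [if_neg]
    rintro rfl
    exact h ⟨Finset.erase_subset _ _, Finset.card_erase_add_one hv⟩

lemma bdCoeff_ne_zero {n : ℕ} {σ τ : Finset (Fin n)} (h : τ ⊆ σ)
    (hc : τ.card + 1 = σ.card) : bdCoeff τ σ ≠ 0 := by
  obtain ⟨v, hv, rfl⟩ := exists_erase_of_subset h hc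
  rw [bdCoeff_erase hv]
  intro h0
  have := sgn_sq σ v
  rw [h0] at this; simp at this

lemma sgn_erase_anti {n : ℕ} {T : Finset (Fin n)} {u v : Fin n} (hu : u ∈ T) (hv : v ∈ T)
    (huv : u ≠ v) : sgn T v * sgn (T.erase v) u = - (sgn T u * sgn (T.erase u) v) := by
  wlog h : u < v generalizing u v
  · have := this hv hu huv.symm (lt_of_le_of_ne (not_lt.1 h) huv.symm)
    rw [this]; ring
  have h1 : sgn (T.erase v) u = sgn T u := by
    unfold sgn
    congr 2
    ext x; simp
    intro hx
    rintro _ rfl; exact absurd h (not_lt.2 hx.le)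
  have h2 : sgn T v = - sgn (T.erase u) v := by
    unfold sgn
    have : T.filter (fun w => w < v) = insert u ((T.erase u).filter (fun w => w < v)) := by
      ext x; simp
      constructor
      · rintro ⟨a, b⟩
        by_cases e : x = u
        · exact Or.inl e
        · exact Or.inr ⟨⟨e, a⟩, b⟩
      · rintro (rfl | ⟨⟨_, a⟩, b⟩)
        · exact ⟨hu, h⟩
        · exact ⟨a, b⟩
    rw [this, Finset.card_insert_of_notMem (by simp), pow_succ]
    ring
  rw [h1, h2]; ring

lemma boundary_boundary {n : ℕ} (T : Finset (Fin n)) :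
    ∑ v ∈ T, sgn T v • colv (T.erase v) = 0 := by
  set f : Fin n → Fin n → (Finset (Fin n) → ℝ) := fun v u =>
    (sgn T v * sgn (T.erase v) u) • Pi.single ((T.erase v).erase u) (1 : ℝ) with hf
  have h1 : ∑ v ∈ T, sgn T v • colv (T.erase v) = ∑ v ∈ T, ∑ u ∈ T, if u ≠ v then f v u else 0 := by
    refine Finset.sum_congr rfl fun v hv => ?_
    rw [colv_eq, Finset.smul_sum, ← Finset.sum_filter]
    refine Finset.sum_congr ?_ fun u hu => ?_
    · ext x; simp; tauto
    · simp [hf, smul_smul]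
  rw [h1]
  set S := ∑ v ∈ T, ∑ u ∈ T, if u ≠ v then f v u else 0 with hS
  have h2 : S = - S := by
    conv_lhs => rw [hS, Finset.sum_comm]
    rw [hS, ← Finset.sum_neg_distrib]
    refine Finset.sum_congr rfl fun v hv => ?_
    rw [← Finset.sum_neg_distrib]
    refine Finset.sum_congr rfl fun u hu => ?_
    by_cases h : u = v
    · simp [h]
    · rw [if_pos h, if_pos (Ne.symm h)]
      simp only [hf]
      rw [sgn_erase_anti hv hu (Ne.symm h), Finset.erase_right_comm, neg_smul]
  have h3 : (2 : ℝ) • S = 0 := by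
    rw [two_smul]; nth_rewrite 1 [h2]; simp
  exact (smul_eq_zero.1 h3).resolve_left (by norm_num)

/-- If all faces of the simplex `T` other than `T.erase v` are in `F`, then `T.erase v` is in the
span. -/
lemma colv_erase_mem {n : ℕ} {F : Finset (Finset (Fin n))} {T : Finset (Fin n)} {v : Fin n}
    (hv : v ∈ T) (h : ∀ u ∈ T, u ≠ v → T.erase u ∈ F) : colv (T.erase v) ∈ Wsp F := by
  have h1 := boundary_boundary T
  rw [← Finset.add_sum_erase _ _ hv] at h1
  have h2 : sgn T v • colv (T.erase v) ∈ Wsp F := by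
    rw [eq_neg_of_add_eq_zero_left h1]
    refine Submodule.neg_mem _ (Submodule.sum_mem _ fun u hu => Submodule.smul_mem _ _ (colv_mem ?_))
    rw [Finset.mem_erase] at hu
    exact h u hu.2 hu.1
  have h3 := Submodule.smul_mem _ (sgn T v) h2
  rwa [smul_smul, sgn_sq, one_smul] at h3

/-- cores -/
def isCore {n : ℕ} (d : ℕ) (Z : Finset (Finset (Fin n))) : Prop :=
  Z.Nonempty ∧ ∀ τ : Finset (Fin n), τ.card = d → (Z.filter (fun σ => τ ⊆ σ)).card ≠ 1

def simplexFree {n : ℕ} (d : ℕ) (Z : Finset (Finset (Fin n))) : Prop :=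
  ∀ T : Finset (Fin n), T.card = d + 2 → ∃ v ∈ T, T.erase v ∉ Z

/-- faces in cycles -/
def cycF {n : ℕ} (F : Finset (Finset (Fin n))) : Finset (Finset (Fin n)) :=
  F.filter (fun σ => colv σ ∈ Wsp (F.erase σ))

lemma cycF_mono {n : ℕ} {F G : Finset (Finset (Fin n))} (h : F ⊆ G) : cycF F ⊆ cycF G := by
  intro σ hσ
  simp only [cycF, Finset.mem_filter] at *
  exact ⟨h hσ.1, Wsp_mono (Finset.erase_subset_erase _ h) hσ.2⟩

/-- `σ ∉ F` completes a simplex -/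
def completes {n : ℕ} (d : ℕ) (F : Finset (Finset (Fin n))) (σ : Finset (Fin n)) : Prop :=
  ∃ T : Finset (Fin n), T.card = d + 2 ∧ ∃ v ∈ T, σ = T.erase v ∧ ∀ u ∈ T, u ≠ v → T.erase u ∈ F

lemma exists_core {n d : ℕ} {F : Finset (Finset (Fin n))} (hF : F ⊆ allFaces n d)
    {σ : Finset (Fin n)} (hσ : σ ∈ allFaces n d) (hσF : σ ∉ F) (hmem : colv σ ∈ Wsp F)
    (hnc : ¬ completes d F σ) :
    ∃ Z ⊆ insert σ F, isCore d Z ∧ simplexFree d Z ∧ Z ⊆ cycF (insert σ F) := by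
  obtain ⟨Z0, hZ0, hmin⟩ := Finset.exists_min_image (F.powerset.filter (fun Z => colv σ ∈ Wsp Z))
    Finset.card ⟨F, by simp [hmem]⟩
  simp only [Finset.mem_filter, Finset.mem_powerset] at hZ0 hmin
  have hmin' : ∀ ρ ∈ Z0, colv σ ∉ Wsp (Z0.erase ρ) := by
    intro ρ hρ h
    have h1 := hmin (Z0.erase ρ) ⟨(Finset.erase_subset _ _).trans hZ0.1, h⟩
    have := Finset.card_erase_lt_of_mem hρ
    omega
  have hσZ : σ ∉ Z0 := fun h => hσF (hZ0.1 h)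
  have hcyc : ∀ ρ ∈ insert σ Z0, colv ρ ∈ Wsp ((insert σ Z0).erase ρ) := by
    intro ρ hρ
    rcases Finset.mem_insert.1 hρ with rfl | hρ
    · rw [Finset.erase_insert hσZ]; exact hZ0.2
    · have hne : σ ≠ ρ := fun e => hσZ (e ▸ hρ)
      rw [Finset.erase_insert_of_ne hne]
      have h1 : colv σ ∈ Submodule.span ℝ (insert (colv ρ) (colv '' ((Z0.erase ρ : Finset _) : Set _))) := by
        have h2 : Wsp (insert ρ (Z0.erase ρ)) = Wsp Z0 := by rw [Finset.insert_erase hρ]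
        rw [← Set.image_insert_eq, ← Finset.coe_insert]
        change colv σ ∈ Wsp (insert ρ (Z0.erase ρ))
        rw [h2]; exact hZ0.2
      have h3 := mem_span_insert_exchange h1 (hmin' ρ hρ)
      rwa [← Set.image_insert_eq, ← Finset.coe_insert] at h3
  have hall : ∀ ρ ∈ insert σ Z0, ρ.card = d + 1 := by
    intro ρ hρ
    rcases Finset.mem_insert.1 hρ with rfl | hρ
    · exact mem_allFaces.1 hσ
    · exact mem_allFaces.1 (hF (hZ0.1 hρ))
  refine ⟨insert σ Z0, Finset.insert_subset_insert _ hZ0.1, ⟨Finset.insert_nonempty _ _, ?_⟩, ?_, ?_⟩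
  · intro τ hτ hdeg
    obtain ⟨ρ, hρ⟩ := Finset.card_eq_one.1 hdeg
    have hρ1 : ρ ∈ (insert σ Z0).filter (fun σ => τ ⊆ σ) := by rw [hρ]; simp
    rw [Finset.mem_filter] at hρ1
    have hz : ∀ w ∈ Wsp ((insert σ Z0).erase ρ), w τ = 0 := by
      intro w hw
      unfold Wsp at hw
      induction hw using Submodule.span_induction with
      | mem x hx =>
        obtain ⟨κ, hκ, rfl⟩ := hx
        rw [Finset.mem_coe, Finset.mem_erase] at hκ
        unfold colv bdCoeff
        rw [if_neg]
        rintro ⟨h1, h2⟩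
        have : κ ∈ (insert σ Z0).filter (fun σ => τ ⊆ σ) := by
          rw [Finset.mem_filter]; exact ⟨hκ.2, h1⟩
        rw [hρ, Finset.mem_singleton] at this
        exact hκ.1 this
      | zero => rfl
      | add x y _ _ hx hy => simp [hx, hy]
      | smul a x _ hx => simp [hx]
    have h0 := hz _ (hcyc ρ hρ1.1)
    exact bdCoeff_ne_zero hρ1.2 (by rw [hall ρ hρ1.1, hτ]) h0
  · intro T hT
    by_contra hcon
    push Not at hcon
    by_cases hsub : ∃ v ∈ T, σ = T.erase v
    · obtain ⟨v, hv, e⟩ := hsub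
      refine hnc ⟨T, hT, v, hv, e, fun u hu huv => ?_⟩
      rcases Finset.mem_insert.1 (hcon u hu) with h | h
      · exfalso
        rw [e] at h
        have : v ∈ T.erase u := by simp [hv, Ne.symm huv]
        rw [h] at this; simp at this
      · exact hZ0.1 h
    · push Not at hsub
      have hZ : ∀ v ∈ T, T.erase v ∈ Z0 := fun v hv =>
        (Finset.mem_insert.1 (hcon v hv)).resolve_left (fun e => hsub v hv e.symm)
      obtain ⟨v, hv⟩ : T.Nonempty := Finset.card_pos.1 (by omega)
      have h1 : colv (T.erase v) ∈ Wsp (Z0.erase (T.erase v)) := by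
        refine colv_erase_mem hv fun u hu huv => Finset.mem_erase.2 ⟨?_, hZ u hu⟩
        intro e
        have : v ∈ T.erase u := by simp [hv, Ne.symm huv]
        rw [e] at this; simp at this
      have h2 := Wsp_insert_of_mem h1
      rw [Finset.insert_erase (hZ v hv)] at h2
      exact hmin' _ (hZ v hv) (h2 ▸ hZ0.2)
  · intro ρ hρ
    simp only [cycF, Finset.mem_filter]
    have hs : insert σ Z0 ⊆ insert σ F := Finset.insert_subset_insert _ hZ0.1
    exact ⟨hs hρ, Wsp_mono (Finset.erase_subset_erase _ hs) (hcyc ρ hρ)⟩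

end Part2

section Part3
/-! ## Part C: residual norms -/

/-- the column space as a subspace of Euclidean space -/
def WE {n : ℕ} (F : Finset (Finset (Fin n))) : Submodule ℝ (EuclideanSpace ℝ (Finset (Fin n))) :=
  (Wsp F).map (WithLp.linearEquiv 2 ℝ (Finset (Fin n) → ℝ)).symm.toLinearMap

def xF {n : ℕ} (F : Finset (Finset (Fin n))) (τ : Finset (Fin n)) : ℝ :=
  ‖(WE F)ᗮ.starProjection (EuclideanSpace.single τ (1 : ℝ))‖ ^ 2

lemma xF_nonneg {n : ℕ} (F : Finset (Finset (Fin n))) (τ : Finset (Fin n)) : 0 ≤ xF F τ := by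
  unfold xF; positivity

lemma xF_le {n : ℕ} (F : Finset (Finset (Fin n))) (τ : Finset (Fin n))
    {r : Finset (Fin n) → ℝ} (hr : r - Pi.single τ 1 ∈ Wsp F) : xF F τ ≤ ∑ ρ, r ρ ^ 2 := by
  have h1 : (WE F)ᗮ.starProjection (EuclideanSpace.single τ (1 : ℝ)) =
      (WE F)ᗮ.starProjection (WithLp.toLp 2 r) := by
    have h2 : (WithLp.toLp 2 r : EuclideanSpace ℝ (Finset (Fin n)))
      - EuclideanSpace.single τ (1 : ℝ) ∈ WE F := by
      refine ⟨r - Pi.single τ 1, hr, ?_⟩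
      ext ρ
      simp
    have h3 : (WE F)ᗮ.starProjection ((WithLp.toLp 2 r : EuclideanSpace ℝ (Finset (Fin n)))
      - EuclideanSpace.single τ (1 : ℝ)) = 0 := by
      rw [Submodule.starProjection_apply_eq_zero_iff, Submodule.orthogonal_orthogonal]
      exact h2
    rw [map_sub, sub_eq_zero] at h3
    exact h3.symm
  unfold xF
  rw [h1]
  have h4 : ‖(WithLp.toLp 2 r : EuclideanSpace ℝ (Finset (Fin n)))‖ ^ 2 = ∑ ρ, r ρ ^ 2 := by
    rw [EuclideanSpace.real_norm_sq_eq]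
  rw [← h4]
  gcongr
  exact Submodule.norm_starProjection_apply_le _ _

lemma xF_le_one {n : ℕ} (F : Finset (Finset (Fin n))) (τ : Finset (Fin n)) : xF F τ ≤ 1 := by
  have := xF_le F τ (r := Pi.single τ 1) (by simp)
  simpa [Pi.single_apply] using this

lemma sum_xF_univ {n : ℕ} (F : Finset (Finset (Fin n))) :
    ∑ τ, xF F τ = Module.finrank ℝ ((WE F)ᗮ : Submodule ℝ _) := by
  set b := stdOrthonormalBasis ℝ ((WE F)ᗮ : Submodule ℝ _) with hb
  have h1 : ∀ τ, xF F τ = ∑ i, ((b i : EuclideanSpace ℝ (Finset (Fin n))) τ) ^ 2 := by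
    intro τ
    unfold xF
    rw [Submodule.starProjection_apply, ← Submodule.coe_norm, ← b.sum_sq_norm_inner_right]
    refine Finset.sum_congr rfl fun i _ => ?_
    rw [Submodule.inner_orthogonalProjectionOnto_eq_of_mem_left]
    simp [EuclideanSpace.inner_single_right]
  simp only [h1]
  rw [Finset.sum_comm]
  have h2 : ∀ i, ∑ τ, ((b i : EuclideanSpace ℝ (Finset (Fin n))) τ) ^ 2 = 1 := by
    intro i
    rw [← EuclideanSpace.real_norm_sq_eq, ← Submodule.coe_norm, b.norm_eq_one]; simp
  simp [h2]

lemma dimKer_le {n : ℕ} (d : ℕ) (F : Finset (Finset (Fin n))) :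
    (dimKer n F : ℝ) ≤ F.card - n.choose d +
      ∑ τ ∈ Finset.univ.filter (fun τ : Finset (Fin n) => τ.card = d), xF F τ := by
  have h1 := sum_xF_univ F
  have h2 : Module.finrank ℝ (WE F) + Module.finrank ℝ ((WE F)ᗮ : Submodule ℝ _) = 2 ^ n := by
    rw [Submodule.finrank_add_finrank_orthogonal]; simp
  have h3 : Module.finrank ℝ (WE F) = Module.finrank ℝ (Wsp F) :=
    LinearEquiv.finrank_map_eq _ _
  have h4 := dimKer_add F
  rw [← Finset.sum_filter_add_sum_filter_not _ (fun τ : Finset (Fin n) => τ.card = d)] at h1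
  have h5 : ∑ τ ∈ Finset.univ.filter (fun τ : Finset (Fin n) => ¬ τ.card = d), xF F τ ≤
      (Finset.univ.filter (fun τ : Finset (Fin n) => ¬ τ.card = d)).card := by
    have := Finset.sum_le_sum (s := Finset.univ.filter (fun τ : Finset (Fin n) => ¬ τ.card = d))
      (fun τ _ => xF_le_one F τ)
    simpa using this
  have h6 : (Finset.univ.filter (fun τ : Finset (Fin n) => τ.card = d)).card +
      (Finset.univ.filter (fun τ : Finset (Fin n) => ¬ τ.card = d)).card = 2 ^ n := by
    rw [Finset.card_filter_add_card_filter_not]; simp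
  have h7 : (Finset.univ.filter (fun τ : Finset (Fin n) => τ.card = d)).card = n.choose d := by
    rw [← Finset.powerset_univ, ← Finset.powersetCard_eq_filter, Finset.card_powersetCard]; simp
  rw [h7] at h6
  rw [h3] at h2
  have h2' := congrArg (Nat.cast (R := ℝ)) h2
  have h4' := congrArg (Nat.cast (R := ℝ)) h4
  have h6' := congrArg (Nat.cast (R := ℝ)) h6
  push_cast at h2' h4' h6'
  linarith

end Part3

section Part4
/-! ## Part D: the limiting tree -/

open MeasureTheory in
lemma infinitePi_map_comp_inj {α β E : Type*} [MeasurableSpace E] (μ : Measure E)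
    [IsProbabilityMeasure μ] (f : α → β) (hf : Function.Injective f) :
    (Measure.infinitePi (fun _ : β => μ)).map (fun x a => x (f a)) =
      Measure.infinitePi (fun _ : α => μ) := by
  refine Measure.eq_infinitePi _ fun s t ht => ?_
  rw [Measure.map_apply (by fun_prop) (.pi s.countable_toSet fun _ _ => ht _)]
  have h1 : (fun (x : β → E) a => x (f a)) ⁻¹' (Set.pi (s : Set α) t) =
      Set.pi ((s.map ⟨f, hf⟩ : Finset β) : Set β)
        (fun b => if h : ∃ a, f a = b then t h.choose else Set.univ) := by
    ext x
    simp only [Set.mem_preimage, Set.mem_pi, Finset.mem_coe, Finset.mem_map,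
      Function.Embedding.coeFn_mk, forall_exists_index, and_imp, forall_apply_eq_imp_iff₂]
    refine forall_congr' fun a => imp_congr_right fun ha => ?_
    have h : ∃ a', f a' = f a := ⟨a, rfl⟩
    rw [dif_pos h, hf h.choose_spec]
  rw [h1, Measure.infinitePi_pi, Finset.prod_map]
  · refine Finset.prod_congr rfl fun a ha => ?_
    have h : ∃ a', f a' = f a := ⟨a, rfl⟩
    simp only [Function.Embedding.coeFn_mk]
    rw [dif_pos h, hf h.choose_spec]
  · intro b _
    split_ifs
    · exact ht _
    · exact MeasurableSet.univ

/-- the recursion map -/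
def psi (d : ℕ) (m : ℕ) (x : ℕ × Fin d → ENNReal) : ENNReal :=
  (1 + ∑ j ∈ Finset.range m, (∑ i, x (j, i))⁻¹)⁻¹

lemma measurable_psi_right (d m : ℕ) : Measurable (psi d m) := by
  unfold psi; fun_prop

lemma measurable_psi (d : ℕ) :
    Measurable (fun z : ℕ × (ℕ × Fin d → ENNReal) => psi d z.1 z.2) :=
  measurable_from_prod_countable_right fun m => measurable_psi_right d m

lemma continuous_psi (d m : ℕ) : Continuous (psi d m) := by
  unfold psi
  fun_prop

lemma psi_mono {d m : ℕ} {x y : ℕ × Fin d → ENNReal} (h : ∀ b, x b ≤ y b) :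
    psi d m x ≤ psi d m y := by
  unfold psi
  gcongr
  exact h _

lemma psi_le_one (d m : ℕ) (x : ℕ × Fin d → ENNReal) : psi d m x ≤ 1 := by
  unfold psi
  rw [ENNReal.inv_le_one]
  exact le_self_add

abbrev Tr (d : ℕ) := List (ℕ × Fin d) → ℕ

def consU {β : Type*} (z : ℕ × (β × List β → ℕ)) : List β → ℕ
  | [] => z.1
  | b :: l => z.2 (b, l)

open MeasureTheory ProbabilityTheory in
lemma infinitePi_consU {β : Type*} (π : Measure ℕ) [IsProbabilityMeasure π] :
    (π.prod (Measure.infinitePi (fun _ : β × List β => π))).map consU =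
      Measure.infinitePi (fun _ : List β => π) := by
  have hmeas : Measurable (consU : ℕ × (β × List β → ℕ) → (List β → ℕ)) := by
    refine measurable_pi_lambda _ fun l => ?_
    cases l with
    | nil => exact measurable_fst
    | cons b l => exact (measurable_pi_apply (b, l)).comp measurable_snd
  refine Measure.eq_infinitePi _ fun s t ht => ?_
  rw [Measure.map_apply hmeas (.pi s.countable_toSet fun _ _ => ht _)]
  have hinj : Function.Injective (fun p : β × List β => p.1 :: p.2) := by
    rintro ⟨a, b⟩ ⟨a', b'⟩ h
    simpa using h
  set s' : Finset (β × List β) := s.preimage (fun p => p.1 :: p.2) hinj.injOn with hs'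
  have h1 : consU ⁻¹' (Set.pi (s : Set (List β)) t) =
      (if [] ∈ s then t [] else Set.univ) ×ˢ
        (Set.pi (s' : Set (β × List β)) (fun p => t (p.1 :: p.2))) := by
    ext ⟨m, x⟩
    simp only [Set.mem_preimage, Set.mem_pi, Set.mem_prod, hs', Finset.mem_coe, Finset.mem_preimage]
    constructor
    · intro h
      refine ⟨?_, fun p hp => h _ hp⟩
      split_ifs with h0
      · exact h [] h0
      · trivial
    · rintro ⟨h0, h⟩ l hl
      cases l with
      | nil => rw [if_pos hl] at h0; exact h0
      | cons b l => exact h (b, l) hl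
  rw [h1, Measure.prod_prod, Measure.infinitePi_pi _ (fun p _ => ht _)]
  have h2 : s'.map ⟨_, hinj⟩ = s.filter (fun l => l ≠ []) := by
    ext l
    simp only [Finset.mem_map, hs', Finset.mem_preimage, Function.Embedding.coeFn_mk,
      Finset.mem_filter]
    constructor
    · rintro ⟨p, hp, rfl⟩; exact ⟨hp, by simp⟩
    · rintro ⟨hl, hne⟩
      cases l with
      | nil => exact absurd rfl hne
      | cons b l => exact ⟨(b, l), hl, rfl⟩
  have h3 : ∏ p ∈ s', π (t (p.1 :: p.2)) = ∏ l ∈ s.filter (fun l => l ≠ []), π (t l) := by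
    rw [← h2, Finset.prod_map]; rfl
  rw [h3, ← Finset.prod_filter_mul_prod_filter_not s (fun l => l ≠ []), mul_comm]
  congr 1
  by_cases h0 : [] ∈ s
  · have : s.filter (fun l => ¬ l ≠ []) = {[]} := by
      ext l; simp only [Finset.mem_filter, Finset.mem_singleton, not_not]
      constructor
      · exact fun h => h.2
      · rintro rfl; exact ⟨h0, rfl⟩
    rw [this, if_pos h0]; simp
  · have : s.filter (fun l => ¬ l ≠ []) = ∅ := by
      ext l; simp only [Finset.mem_filter, not_not, Finset.notMem_empty, iff_false]
      rintro ⟨h, rfl⟩; exact h0 h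
    rw [this, if_neg h0]; simp

open MeasureTheory ProbabilityTheory in
def TrP (c : NNReal) (d : ℕ) : Measure (Tr d) :=
  Measure.infinitePi (fun _ => poissonMeasure c)

open MeasureTheory ProbabilityTheory in
instance (c : NNReal) (d : ℕ) : IsProbabilityMeasure (TrP c d) := by
  unfold TrP; infer_instance

open MeasureTheory ProbabilityTheory in
/-- the recursion on laws -/
def Phi (c : NNReal) (d : ℕ) (μ : Measure ENNReal) [IsProbabilityMeasure μ] : Measure ENNReal :=
  ((poissonMeasure c).prod (Measure.infinitePi (fun _ : ℕ × Fin d => μ))).map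
    (fun z => psi d z.1 z.2)

open MeasureTheory ProbabilityTheory in
instance (c : NNReal) (d : ℕ) (μ : Measure ENNReal) [IsProbabilityMeasure μ] :
    IsProbabilityMeasure (Phi c d μ) := by
  unfold Phi
  exact Measure.isProbabilityMeasure_map (measurable_psi d).aemeasurable

open MeasureTheory ProbabilityTheory in
lemma law_rec (c : NNReal) (d : ℕ) (Y Z : Tr d → ENNReal) (hY : Measurable Y)
    [IsProbabilityMeasure ((TrP c d).map Y)]
    (h : ∀ ω, Z ω = psi d (ω []) (fun b => Y (fun l => ω (b :: l)))) :
    (TrP c d).map Z = Phi c d ((TrP c d).map Y) := by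
  have h1 := infinitePi_consU (β := ℕ × Fin d) (poissonMeasure c)
  have hcons : Measurable (consU : ℕ × ((ℕ × Fin d) × List (ℕ × Fin d) → ℕ) → Tr d) := by
    refine measurable_pi_lambda _ fun l => ?_
    cases l with
    | nil => exact measurable_fst
    | cons b l => exact (measurable_pi_apply (b, l)).comp measurable_snd
  have hZ : Measurable Z := by
    have : Z = (fun z : ℕ × (ℕ × Fin d → ENNReal) => psi d z.1 z.2) ∘
      (fun ω => (ω [], fun b => Y (fun l => ω (b :: l)))) := by
      funext ω; exact h ω
    rw [this]
    exact (measurable_psi d).comp (by fun_prop)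
  have hcY : Measurable (fun (x : (ℕ × Fin d) × List (ℕ × Fin d) → ℕ) b => Y (fun l => x (b, l))) := by
    fun_prop
  have h2 : (Measure.infinitePi (fun _ : (ℕ × Fin d) × List (ℕ × Fin d) => poissonMeasure c)).map
      (fun x b => Y (fun l => x (b, l))) = Measure.infinitePi (fun _ => (TrP c d).map Y) := by
    rw [← Measure.infinitePi_map_pi (μ := fun _ : ℕ × Fin d => TrP c d) (f := fun _ => Y)
      (fun _ => hY)]
    unfold TrP
    rw [← Measure.infinitePi_map_curry, Measure.map_map (by fun_prop) (by fun_prop)]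
    rfl
  unfold Phi
  rw [← h2]
  conv_lhs => rw [TrP, ← h1, Measure.map_map hZ hcons]
  have h3 : (poissonMeasure c).prod ((Measure.infinitePi (fun _ : (ℕ × Fin d) × List (ℕ × Fin d) => poissonMeasure c)).map
      (fun x b => Y (fun l => x (b, l)))) =
      ((poissonMeasure c).prod (Measure.infinitePi (fun _ : (ℕ × Fin d) × List (ℕ × Fin d) => poissonMeasure c))).map (Prod.map id (fun x b => Y (fun l => x (b, l)))) := by
    rw [← Measure.map_prod_map _ _ measurable_id hcY, Measure.map_id]
  rw [h3, Measure.map_map (measurable_psi d) (by fun_prop)]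
  congr 1
  funext z
  simp only [Function.comp, h]
  rfl

/-- the approximations -/
def Xk (d : ℕ) : ℕ → Tr d → ENNReal
  | 0 => fun _ => 1
  | k + 1 => fun ω => psi d (ω []) (fun b => Xk d k (fun l => ω (b :: l)))

lemma Xk_succ (d k : ℕ) (ω : Tr d) :
    Xk d (k + 1) ω = psi d (ω []) (fun b => Xk d k (fun l => ω (b :: l))) := rfl

lemma Xk_zero (d : ℕ) (ω : Tr d) : Xk d 0 ω = 1 := rfl

lemma measurable_Xk (d k : ℕ) : Measurable (Xk d k) := by
  induction k with
  | zero => exact measurable_const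
  | succ k ih =>
    have : Xk d (k+1) = (fun z : ℕ × (ℕ × Fin d → ENNReal) => psi d z.1 z.2) ∘
      (fun ω => (ω [], fun b => Xk d k (fun l => ω (b :: l)))) := rfl
    rw [this]
    exact (measurable_psi d).comp (by fun_prop)

lemma Xk_le_one (d k : ℕ) (ω : Tr d) : Xk d k ω ≤ 1 := by
  cases k with
  | zero => rw [Xk_zero]
  | succ k => rw [Xk_succ]; exact psi_le_one _ _ _

lemma Xk_succ_le (d k : ℕ) (ω : Tr d) : Xk d (k + 1) ω ≤ Xk d k ω := by
  induction k generalizing ω with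
  | zero => rw [Xk_succ, Xk_zero]; exact psi_le_one _ _ _
  | succ k ih => rw [Xk_succ, Xk_succ d k]; exact psi_mono fun b => ih _

def Xinf (d : ℕ) (ω : Tr d) : ENNReal := ⨅ k, Xk d k ω

lemma measurable_Xinf (d : ℕ) : Measurable (Xinf d) := by
  unfold Xinf
  exact Measurable.iInf fun k => measurable_Xk d k

lemma tendsto_Xk (d : ℕ) (ω : Tr d) : Tendsto (fun k => Xk d k ω) atTop (nhds (Xinf d ω)) :=
  tendsto_atTop_iInf (antitone_nat_of_succ_le fun k => Xk_succ_le d k ω)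

lemma Xinf_rec (d : ℕ) (ω : Tr d) :
    Xinf d ω = psi d (ω []) (fun b => Xinf d (fun l => ω (b :: l))) := by
  have h1 : Tendsto (fun k => Xk d (k + 1) ω) atTop
      (nhds (psi d (ω []) (fun b => Xinf d (fun l => ω (b :: l))))) :=
    ((continuous_psi d (ω [])).tendsto _).comp (tendsto_pi_nhds.2 fun b => tendsto_Xk d _)
  exact tendsto_nhds_unique ((tendsto_Xk d ω).comp (tendsto_add_atTop_nat 1)) h1

open MeasureTheory in
/-- the law of the approximations -/
def muk (c : NNReal) (d k : ℕ) : Measure ENNReal := (TrP c d).map (Xk d k)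

open MeasureTheory in
instance (c : NNReal) (d k : ℕ) : IsProbabilityMeasure (muk c d k) :=
  Measure.isProbabilityMeasure_map (measurable_Xk d k).aemeasurable

open MeasureTheory in
def muinf (c : NNReal) (d : ℕ) : Measure ENNReal := (TrP c d).map (Xinf d)

open MeasureTheory in
instance (c : NNReal) (d : ℕ) : IsProbabilityMeasure (muinf c d) :=
  Measure.isProbabilityMeasure_map (measurable_Xinf d).aemeasurable

lemma muk_succ (c : NNReal) (d k : ℕ) : muk c d (k + 1) = Phi c d (muk c d k) := by
  have : MeasureTheory.IsProbabilityMeasure ((TrP c d).map (Xk d k)) :=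
    inferInstanceAs (MeasureTheory.IsProbabilityMeasure (muk c d k))
  exact law_rec c d (Xk d k) (Xk d (k+1)) (measurable_Xk d k) fun ω => rfl

lemma muinf_eq (c : NNReal) (d : ℕ) : muinf c d = Phi c d (muinf c d) := by
  have : MeasureTheory.IsProbabilityMeasure ((TrP c d).map (Xinf d)) :=
    inferInstanceAs (MeasureTheory.IsProbabilityMeasure (muinf c d))
  exact law_rec c d (Xinf d) (Xinf d) (measurable_Xinf d) (Xinf_rec d)

open MeasureTheory in
lemma muk_zero (c : NNReal) (d : ℕ) : muk c d 0 = Measure.dirac 1 := by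
  unfold muk
  change Measure.map (fun _ => (1 : ENNReal)) (TrP c d) = _
  rw [Measure.map_const]; simp

/-- multi-vertex recursion map -/
def Psi {ι : Type} (d : ℕ) (m : ι → ℕ)
    (x : (Σ a : ι, Fin (m a) × Fin d) → ENNReal) (a : ι) : ENNReal :=
  (1 + ∑ j : Fin (m a), (∑ i, x ⟨a, j, i⟩)⁻¹)⁻¹

lemma measurable_Psi {ι : Type} (d : ℕ) (m : ι → ℕ) : Measurable (Psi (ι := ι) d m) := by
  refine measurable_pi_lambda _ fun a => ?_
  unfold Psi; fun_prop

open MeasureTheory ProbabilityTheory in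
lemma lintegral_pi_Phi (c : NNReal) (d : ℕ) (μ : Measure ENNReal) [IsProbabilityMeasure μ]
    {ι : Type} [Fintype ι] (G : (ι → ENNReal) → ENNReal) (hG : Measurable G) :
    ∫⁻ x, G x ∂(Measure.pi (fun _ : ι => Phi c d μ)) =
      ∑' m : ι → ℕ, (∏ a, poissonMeasure c {m a}) *
        ∫⁻ x, G (Psi d m x) ∂(Measure.pi (fun _ : (Σ a : ι, Fin (m a) × Fin d) => μ)) := by
  set ν := Measure.infinitePi (fun _ : ℕ × Fin d => μ) with hν
  have h1 : Measure.pi (fun _ : ι => Phi c d μ) =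
      ((Measure.pi (fun _ : ι => (poissonMeasure c).prod ν))).map
        (fun x a => psi d (x a).1 (x a).2) := by
    unfold Phi
    have : ∀ i : ι, IsProbabilityMeasure (((fun _ => (poissonMeasure c).prod ν) i).map (fun z => psi d z.1 z.2)) :=
      fun i => Measure.isProbabilityMeasure_map (measurable_psi d).aemeasurable
    rw [Measure.pi_map_pi (μ := fun _ : ι => (poissonMeasure c).prod ν)
      (f := fun _ z => psi d z.1 z.2) (fun _ => (measurable_psi d).aemeasurable)]
  have hm1 : Measurable (fun (x : ι → ℕ × (ℕ × Fin d → ENNReal)) a => psi d (x a).1 (x a).2) :=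
    measurable_pi_lambda _ fun a => (measurable_psi d).comp (measurable_pi_apply a)
  have hm2 : Measurable (fun (z : (ι → ℕ) × (ι → (ℕ × Fin d → ENNReal))) a => psi d (z.1 a) (z.2 a)) :=
    measurable_pi_lambda _ fun a => (measurable_psi d).comp
      (f := fun z : (ι → ℕ) × (ι → (ℕ × Fin d → ENNReal)) => (z.1 a, z.2 a)) (by fun_prop)
  have hG' : Measurable (fun z : (ι → ℕ) × (ι → (ℕ × Fin d → ENNReal)) =>
      G (fun a => psi d (z.1 a) (z.2 a))) := hG.comp hm2
  rw [h1, lintegral_map hG hm1]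
  have h2 := measurePreserving_arrowProdEquivProdArrow ℕ (ℕ × Fin d → ENNReal) ι
    (fun _ => poissonMeasure c) (fun _ => ν)
  have h3 : ∫⁻ x, G (fun a => psi d (x a).1 (x a).2) ∂(Measure.pi (fun _ : ι => (poissonMeasure c).prod ν))
     = ∫⁻ z, G (fun a => psi d (z.1 a) (z.2 a)) ∂((Measure.pi fun _ : ι => poissonMeasure c).prod (Measure.pi fun _ : ι => ν)) := by
    rw [← h2.lintegral_comp hG']
    rfl
  rw [h3, lintegral_prod _ hG'.aemeasurable, lintegral_countable']
  refine tsum_congr fun m => ?_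
  rw [Measure.pi_singleton, mul_comm]
  congr 1
  have h4 : Measure.pi (fun _ : (Σ a : ι, Fin (m a) × Fin d) => μ) =
      (Measure.pi fun _ : ι => ν).map (fun y s => y s.1 (s.2.1, s.2.2)) := by
    rw [← Measure.infinitePi_eq_pi, ← Measure.infinitePi_eq_pi, hν]
    have h5 := infinitePi_map_comp_inj μ (fun s : (Σ a : ι, Fin (m a) × Fin d) => ((s.1, ((s.2.1 : ℕ), s.2.2)) : ι × (ℕ × Fin d)))
      (by
        rintro ⟨a, j, i⟩ ⟨a', j', i'⟩ h
        simp only [Prod.mk.injEq] at h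
        obtain ⟨rfl, h1, rfl⟩ := h
        have := Fin.ext h1
        subst this; rfl)
    rw [← h5, ← Measure.infinitePi_map_curry_symm (fun (_ : ι) (_ : ℕ × Fin d) => μ), Measure.map_map (by fun_prop) (by fun_prop)]
    rfl
  have hG2 : Measurable (fun x => G (Psi d m x)) := hG.comp (measurable_Psi d m)
  rw [h4, lintegral_map hG2 (by fun_prop)]
  refine lintegral_congr fun y => ?_
  congr 1
  funext a
  unfold psi Psi
  rw [Finset.sum_range]

end Part4

section Part5
/-! ## Part E: the fixed point equation -/

open MeasureTheory ProbabilityTheory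

/-- law of the inverse of the sum of `d` copies -/
def kap (d : ℕ) (μ : Measure ENNReal) [IsProbabilityMeasure μ] : Measure ENNReal :=
  (Measure.pi (fun _ : Fin d => μ)).map (fun x => (∑ i, x i)⁻¹)

instance (d : ℕ) (μ : Measure ENNReal) [IsProbabilityMeasure μ] :
    IsProbabilityMeasure (kap d μ) :=
  Measure.isProbabilityMeasure_map (by fun_prop)

lemma lintegral_Phi (c : NNReal) (d : ℕ) (μ : Measure ENNReal) [IsProbabilityMeasure μ]
    (g : ENNReal → ENNReal) (hg : Measurable g) :
    ∫⁻ x, g x ∂(Phi c d μ) = ∑' m : ℕ, poissonMeasure c {m} *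
      ∫⁻ y, g ((1 + ∑ j, y j)⁻¹) ∂(Measure.pi (fun _ : Fin m => kap d μ)) := by
  unfold Phi
  have hg' : Measurable (fun z : ℕ × (ℕ × Fin d → ENNReal) => g (psi d z.1 z.2)) :=
    hg.comp (measurable_psi d)
  rw [lintegral_map hg (measurable_psi d), lintegral_prod _ hg'.aemeasurable,
    lintegral_countable']
  refine tsum_congr fun m => ?_
  rw [mul_comm]
  congr 1
  have h1 : Measure.pi (fun _ : Fin m => kap d μ) =
      (Measure.infinitePi (fun _ : ℕ × Fin d => μ)).map
        (fun x (j : Fin m) => (∑ i, x ((j : ℕ), i))⁻¹) := by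
    have h2 := infinitePi_map_comp_inj μ
      (fun s : Fin m × Fin d => (((s.1 : ℕ), s.2) : ℕ × Fin d))
      (by
        rintro ⟨j, i⟩ ⟨j', i'⟩ h
        simp only [Prod.mk.injEq] at h
        obtain ⟨h1, rfl⟩ := h
        have := Fin.ext h1
        subst this; rfl)
    rw [← Measure.infinitePi_eq_pi]
    unfold kap
    have hp := fun (_ : Fin m) => Measure.isProbabilityMeasure_map (μ := Measure.pi (fun _ : Fin d => μ))
      (f := fun x => (∑ i, x i)⁻¹) (by fun_prop)
    rw [← Measure.infinitePi_map_pi (μ := fun _ : Fin m => Measure.pi (fun _ : Fin d => μ))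
      (f := fun _ x => (∑ i, x i)⁻¹) (fun _ => by fun_prop)]
    simp_rw [← Measure.infinitePi_eq_pi]
    rw [← Measure.infinitePi_map_curry (fun (_ : Fin m) (_ : Fin d) => μ), ← h2,
      Measure.map_map (by fun_prop) (by fun_prop), Measure.map_map (by fun_prop) (by fun_prop)]
    rfl
  have hg2 : Measurable (fun y : Fin m → ENNReal => g ((1 + ∑ j, y j)⁻¹)) := by
    exact hg.comp (by fun_prop)
  rw [h1, lintegral_map hg2 (by fun_prop)]
  refine lintegral_congr fun y => ?_
  congr 1
  unfold psi
  rw [Finset.sum_range]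

lemma pi_symm {E : Type*} [MeasurableSpace E] (μ : Measure E) [IsProbabilityMeasure μ] {m : ℕ}
    (e : Equiv.Perm (Fin m)) (g : (Fin m → E) → ENNReal) (hg : Measurable g) :
    ∫⁻ y, g (fun i => y (e i)) ∂(Measure.pi (fun _ : Fin m => μ)) =
      ∫⁻ y, g y ∂(Measure.pi (fun _ : Fin m => μ)) := by
  have h := infinitePi_map_comp_inj μ e e.injective
  simp only [Measure.infinitePi_eq_pi] at h
  conv_rhs => rw [← h, lintegral_map hg (by fun_prop)]

lemma pi_succ {E : Type*} [MeasurableSpace E] (μ : Measure E) [IsProbabilityMeasure μ] (m : ℕ)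
    (g : E → (Fin m → E) → ENNReal) (hg : Measurable (fun z : E × (Fin m → E) => g z.1 z.2)) :
    ∫⁻ y, g (y 0) (fun i => y i.succ) ∂(Measure.pi (fun _ : Fin (m + 1) => μ)) =
      ∫⁻ a, ∫⁻ y, g a y ∂(Measure.pi (fun _ : Fin m => μ)) ∂μ := by
  have h := measurePreserving_piFinSuccAbove (fun _ : Fin (m + 1) => μ) 0
  have h2 := h.lintegral_comp hg
  rw [lintegral_prod _ hg.aemeasurable] at h2
  exact h2

lemma kap_top (d : ℕ) (μ : Measure ENNReal) [IsProbabilityMeasure μ] :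
    kap d μ {⊤} = μ {0} ^ d := by
  unfold kap
  rw [Measure.map_apply (by fun_prop) (measurableSet_singleton _)]
  have : (fun x : Fin d → ENNReal => (∑ i, x i)⁻¹) ⁻¹' {⊤} = Set.pi Set.univ (fun _ => {0}) := by
    ext x; simp [Set.mem_pi]
  rw [this, Measure.pi_pi]; simp

lemma fix_ne_zero (c : NNReal) (d : ℕ) (μ : Measure ENNReal) [IsProbabilityMeasure μ]
    (hμ : μ = Phi c d μ) :
    μ {0}ᶜ = ∑' m : ℕ, poissonMeasure c {m} * (kap d μ {⊤}ᶜ) ^ m := by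
  have h0 : μ {0}ᶜ = ∫⁻ x, Set.indicator {0}ᶜ 1 x ∂(Phi c d μ) := by
    rw [lintegral_indicator_one (measurableSet_singleton _).compl, ← hμ]
  rw [h0, lintegral_Phi _ _ _ _ (measurable_one.indicator (measurableSet_singleton _).compl)]
  refine tsum_congr fun m => ?_
  congr 1
  have h1 : ∀ y : Fin m → ENNReal, Set.indicator ({0}ᶜ : Set ENNReal) (1 : ENNReal → ENNReal) ((1 + ∑ j, y j)⁻¹) =
      Set.indicator (Set.pi Set.univ (fun _ => {⊤}ᶜ)) 1 y := by
    intro y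
    have : (1 + ∑ j, y j)⁻¹ ∈ ({0}ᶜ : Set ENNReal) ↔ y ∈ Set.pi Set.univ (fun _ => ({⊤}ᶜ : Set ENNReal)) := by
      simp [Set.mem_pi, ENNReal.add_eq_top]
    by_cases h : y ∈ Set.pi Set.univ (fun _ => ({⊤}ᶜ : Set ENNReal))
    · rw [Set.indicator_of_mem h, Set.indicator_of_mem (this.2 h)]; rfl
    · rw [Set.indicator_of_notMem h, Set.indicator_of_notMem (fun h' => h (this.1 h'))]
  simp_rw [h1]
  rw [lintegral_indicator_one (MeasurableSet.univ_pi fun _ => (measurableSet_singleton _).compl),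
    Measure.pi_pi]
  simp

lemma frac_sum {m : ℕ} (y : Fin m → ENNReal) :
    (1 + ∑ j, y j)⁻¹ + ∑ j, y j * (1 + ∑ i, y i)⁻¹ =
      Set.indicator ({0}ᶜ : Set ENNReal) 1 ((1 + ∑ j, y j)⁻¹) := by
  rw [← Finset.sum_mul]
  by_cases h : 1 + ∑ j, y j = ⊤
  · simp [h]
  · rw [Set.indicator_of_mem (by simpa using h)]
    nth_rewrite 1 [← one_mul (1 + ∑ j, y j)⁻¹]
    rw [← add_mul, ENNReal.mul_inv_cancel (by simp) h]; rfl

/-- Mecke step -/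
lemma fix_mecke (c : NNReal) (d : ℕ) (μ : Measure ENNReal) [IsProbabilityMeasure μ]
    (hμ : μ = Phi c d μ) :
    ∫⁻ x, x ∂μ + c * ∫⁻ a, ∫⁻ x, a * (a + x⁻¹)⁻¹ ∂μ ∂(kap d μ) = μ {0}ᶜ := by
  set κ := kap d μ with hκ
  have h0 : μ {0}ᶜ = ∫⁻ x, Set.indicator {0}ᶜ 1 x ∂(Phi c d μ) := by
    rw [lintegral_indicator_one (measurableSet_singleton _).compl, ← hμ]
  have h1 : ∫⁻ x, x ∂μ = ∑' m : ℕ, poissonMeasure c {m} *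
      ∫⁻ y, ((1 + ∑ j, y j)⁻¹) ∂(Measure.pi (fun _ : Fin m => κ)) := by
    rw [← lintegral_Phi c d μ (fun x => x) measurable_id, ← hμ]
  rw [h0, lintegral_Phi _ _ _ _ (measurable_one.indicator (measurableSet_singleton _).compl), h1]
  have h2 : ∀ m : ℕ, ∫⁻ y, Set.indicator ({0}ᶜ : Set ENNReal) (1 : ENNReal → ENNReal) ((1 + ∑ j, y j)⁻¹)
      ∂(Measure.pi (fun _ : Fin m => κ)) =
      ∫⁻ y, ((1 + ∑ j, y j)⁻¹) ∂(Measure.pi (fun _ : Fin m => κ)) +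
      ∑ j, ∫⁻ y, y j * (1 + ∑ i, y i)⁻¹ ∂(Measure.pi (fun _ : Fin m => κ)) := by
    intro m
    rw [← lintegral_finsetSum _ (fun j _ => by fun_prop), ← lintegral_add_left (by fun_prop)]
    exact lintegral_congr fun y => (frac_sum y).symm
  have h3 : ∀ m : ℕ, ∀ j : Fin (m + 1), ∫⁻ y, y j * (1 + ∑ i, y i)⁻¹ ∂(Measure.pi (fun _ : Fin (m+1) => κ))
      = ∫⁻ a, ∫⁻ y, a * (a + (1 + ∑ i, y i))⁻¹ ∂(Measure.pi (fun _ : Fin m => κ)) ∂κ := by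
    intro m j
    rw [← pi_symm κ (Equiv.swap 0 j) (fun y => y j * (1 + ∑ i, y i)⁻¹) (by fun_prop),
      ← pi_succ κ m (fun a y => a * (a + (1 + ∑ i, y i))⁻¹) (by fun_prop)]
    refine lintegral_congr fun y => ?_
    beta_reduce
    rw [Equiv.swap_apply_right, Equiv.sum_comp (Equiv.swap 0 j) y, Fin.sum_univ_succ]
    congr 2
    ring
  rw [tsum_congr (fun m => (congrArg (fun z => poissonMeasure c {m} * z) (h2 m)).trans (mul_add _ _ _))]
  rw [ENNReal.tsum_add]
  congr 1
  have h4 : ∀ a, ∫⁻ x, a * (a + x⁻¹)⁻¹ ∂μ = ∑' m : ℕ, poissonMeasure c {m} *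
      ∫⁻ y, a * (a + (1 + ∑ i, y i))⁻¹ ∂(Measure.pi (fun _ : Fin m => κ)) := by
    intro a
    have := lintegral_Phi c d μ (fun x => a * (a + x⁻¹)⁻¹) (by fun_prop)
    rw [← hμ] at this
    rw [this]
    simp_rw [inv_inv]; rfl
  simp_rw [h4]
  rw [lintegral_tsum (fun m => by
    refine (Measurable.const_mul ?_ _).aemeasurable
    exact Measurable.lintegral_prod_right' (f := fun z : ENNReal × (Fin m → ENNReal) => z.1 * (z.1 + (1 + ∑ i, z.2 i))⁻¹) (by fun_prop))]
  have h5 : ∀ m : ℕ, ∫⁻ a, poissonMeasure c {m} *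
      ∫⁻ y, a * (a + (1 + ∑ i, y i))⁻¹ ∂(Measure.pi (fun _ : Fin m => κ)) ∂κ =
      poissonMeasure c {m} * ∫⁻ a, ∫⁻ y, a * (a + (1 + ∑ i, y i))⁻¹ ∂(Measure.pi (fun _ : Fin m => κ)) ∂κ := by
    intro m
    refine lintegral_const_mul _ ?_
    exact Measurable.lintegral_prod_right' (f := fun z : ENNReal × (Fin m → ENNReal) => z.1 * (z.1 + (1 + ∑ i, z.2 i))⁻¹) (by fun_prop)
  simp_rw [h5]
  rw [← ENNReal.tsum_mul_left]
  conv_rhs => rw [tsum_eq_zero_add' ENNReal.summable]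
  simp only [Finset.univ_eq_empty, Finset.sum_empty, mul_zero, zero_add]
  refine tsum_congr fun m => ?_
  simp_rw [h3]
  rw [Finset.sum_const, Finset.card_univ, Fintype.card_fin, nsmul_eq_mul, ← mul_assoc, ← mul_assoc]
  congr 1
  rw [poissonMeasure_singleton, poissonMeasure_singleton, ← ENNReal.ofReal_coe_nnreal,
    ← ENNReal.ofReal_mul (by positivity), ← ENNReal.ofReal_natCast, ← ENNReal.ofReal_mul (by positivity)]
  congr 1
  rw [Nat.factorial_succ]
  push_cast
  field_simp
  ring

lemma frac_id (x S : ENNReal) (hx : x ≠ ⊤) (hS : S ≠ ⊤) :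
    S⁻¹ * (S⁻¹ + x⁻¹)⁻¹ + (Set.indicator ({0}ᶜ : Set ENNReal) 1 x) * (Set.indicator ({0} : Set ENNReal) 1 S)
      = x * (x + S)⁻¹ := by
  by_cases hS0 : S = 0
  · subst hS0
    by_cases hx0 : x = 0
    · subst hx0; simp
    · simp [hx0, ENNReal.mul_inv_cancel hx0 hx]
  · by_cases hx0 : x = 0
    · subst hx0; simp
    · have e1 : S⁻¹ + x⁻¹ = (x + S) * (S⁻¹ * x⁻¹) := by
        rw [add_mul, mul_comm S⁻¹, ← mul_assoc, ENNReal.mul_inv_cancel hx0 hx, one_mul,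
          mul_comm x⁻¹, ← mul_assoc, ENNReal.mul_inv_cancel hS0 hS, one_mul]
      have hxS : x + S ≠ ⊤ := by simp [hx, hS]
      have hxS0 : x + S ≠ 0 := by simp [hx0]
      rw [e1, ENNReal.mul_inv (Or.inl hxS0) (Or.inl hxS), ENNReal.mul_inv (by simp [hS]) (by simp [hS0]), inv_inv, inv_inv]
      have : S⁻¹ * ((x + S)⁻¹ * (S * x)) = (S⁻¹ * S) * (x * (x + S)⁻¹) := by ring
      rw [this, ENNReal.inv_mul_cancel hS0 hS]
      simp [hS0]

lemma exch (d : ℕ) (μ : Measure ENNReal) [IsProbabilityMeasure μ] (hfin : ∀ᵐ x ∂μ, x ≠ ⊤) :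
    (d + 1 : ENNReal) * ∫⁻ y, y 0 * (∑ i, y i)⁻¹ ∂(Measure.pi (fun _ : Fin (d + 1) => μ)) + μ {0} ^ (d + 1) = 1 := by
  have h1 : ∀ j : Fin (d + 1), ∫⁻ y, y j * (∑ i, y i)⁻¹ ∂(Measure.pi (fun _ : Fin (d + 1) => μ)) =
      ∫⁻ y, y 0 * (∑ i, y i)⁻¹ ∂(Measure.pi (fun _ : Fin (d + 1) => μ)) := by
    intro j
    rw [← pi_symm μ (Equiv.swap 0 j) (fun y => y j * (∑ i, y i)⁻¹) (by fun_prop)]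
    refine lintegral_congr fun y => ?_
    beta_reduce
    rw [Equiv.swap_apply_right, Equiv.sum_comp (Equiv.swap 0 j) y]
  have h2 : (d + 1 : ENNReal) * ∫⁻ y, y 0 * (∑ i, y i)⁻¹ ∂(Measure.pi (fun _ : Fin (d + 1) => μ)) =
      ∫⁻ y, (∑ j, y j) * (∑ i, y i)⁻¹ ∂(Measure.pi (fun _ : Fin (d + 1) => μ)) := by
    simp_rw [Finset.sum_mul]
    rw [lintegral_finsetSum _ (fun j _ => by fun_prop), Finset.sum_congr rfl (fun j _ => h1 j)]
    simp
  set B : Set (Fin (d + 1) → ENNReal) := Set.pi Set.univ (fun _ => {0}) with hB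
  have hBm : MeasurableSet B := MeasurableSet.univ_pi fun _ => measurableSet_singleton _
  have h3 : μ {0} ^ (d + 1) = ∫⁻ y, B.indicator 1 y ∂(Measure.pi (fun _ : Fin (d + 1) => μ)) := by
    rw [lintegral_indicator_one hBm, hB, Measure.pi_pi]; simp
  rw [h2, h3, ← lintegral_add_right _ (measurable_one.indicator hBm)]
  have h4 : ∀ᵐ y ∂(Measure.pi (fun _ : Fin (d + 1) => μ)), ∀ i, y i ≠ ⊤ := by
    rw [ae_all_iff]
    intro i
    exact (measurePreserving_eval (fun _ : Fin (d+1) => μ) i).quasiMeasurePreserving.ae hfin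
  rw [lintegral_congr_ae (g := fun _ => 1)]
  · simp
  · filter_upwards [h4] with y hy
    by_cases h0 : ∑ i, y i = 0
    · have : y ∈ B := by
        rw [Finset.sum_eq_zero_iff] at h0
        simpa [hB, Set.mem_pi] using h0
      simp [this, h0]
    · have : y ∉ B := by
        intro h
        apply h0
        apply Finset.sum_eq_zero
        intro i _
        simpa using (Set.mem_pi.1 h) i trivial
      rw [Set.indicator_of_notMem this, ENNReal.mul_inv_cancel h0 (by simp [ENNReal.sum_eq_top, hy]), add_zero]

lemma fix_A (d : ℕ) (μ : Measure ENNReal) [IsProbabilityMeasure μ] (hfin : ∀ᵐ x ∂μ, x ≠ ⊤) :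
    ∫⁻ a, ∫⁻ x, a * (a + x⁻¹)⁻¹ ∂μ ∂(kap d μ) + μ {0}ᶜ * μ {0} ^ d =
     ∫⁻ y, y 0 * (∑ i, y i)⁻¹ ∂(Measure.pi (fun _ : Fin (d + 1) => μ)) := by
  have h1 : ∫⁻ a, ∫⁻ x, a * (a + x⁻¹)⁻¹ ∂μ ∂(kap d μ) =
      ∫⁻ x, ∫⁻ y, (∑ i, y i)⁻¹ * ((∑ i, y i)⁻¹ + x⁻¹)⁻¹ ∂(Measure.pi (fun _ : Fin d => μ)) ∂μ := by
    rw [lintegral_lintegral_swap (by fun_prop)]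
    refine lintegral_congr fun x => ?_
    unfold kap
    rw [lintegral_map (by fun_prop) (by fun_prop)]
  have h2 : μ {0}ᶜ * μ {0} ^ d = ∫⁻ x, ∫⁻ y, (Set.indicator ({0}ᶜ : Set ENNReal) 1 x) *
      (Set.indicator ({0} : Set ENNReal) 1 (∑ i, y i)) ∂(Measure.pi (fun _ : Fin d => μ)) ∂μ := by
    have h3 : ∀ x, ∫⁻ y, (Set.indicator ({0}ᶜ : Set ENNReal) 1 x) *
      (Set.indicator ({0} : Set ENNReal) 1 (∑ i, y i)) ∂(Measure.pi (fun _ : Fin d => μ)) = (Set.indicator ({0}ᶜ : Set ENNReal) 1 x) * μ {0} ^ d := by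
      intro x
      have hm : Measurable (fun y : Fin d → ENNReal =>
          Set.indicator ({0} : Set ENNReal) (1 : ENNReal → ENNReal) (∑ i, y i)) :=
        (measurable_one.indicator (measurableSet_singleton _)).comp (by fun_prop)
      rw [lintegral_const_mul _ hm]
      congr 1
      have h4 : ∀ y : Fin d → ENNReal, Set.indicator ({0} : Set ENNReal) (1 : ENNReal → ENNReal) (∑ i, y i) =
        Set.indicator (Set.pi Set.univ (fun _ => {0})) 1 y := by
        intro y
        have : (∑ i, y i) ∈ ({0} : Set ENNReal) ↔ y ∈ Set.pi Set.univ (fun _ => ({0} : Set ENNReal)) := by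
          simp [Set.mem_pi]
        by_cases h : y ∈ Set.pi Set.univ (fun _ => ({0} : Set ENNReal))
        · rw [Set.indicator_of_mem h, Set.indicator_of_mem (this.2 h)]; rfl
        · rw [Set.indicator_of_notMem h, Set.indicator_of_notMem (fun h' => h (this.1 h'))]
      simp_rw [h4]
      rw [lintegral_indicator_one (MeasurableSet.univ_pi fun _ => (measurableSet_singleton _)), Measure.pi_pi]
      simp
    simp_rw [h3]
    rw [lintegral_mul_const _ (measurable_one.indicator (measurableSet_singleton _).compl), lintegral_indicator_one (measurableSet_singleton _).compl]
  have h5 : ∀ᵐ y ∂(Measure.pi (fun _ : Fin d => μ)), ∀ i, y i ≠ ⊤ := by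
    rw [ae_all_iff]
    intro i
    exact (measurePreserving_eval (fun _ : Fin d => μ) i).quasiMeasurePreserving.ae hfin
  have h6 := pi_succ μ d (fun x y => x * (x + ∑ i, y i)⁻¹) (by fun_prop)
  simp only [← Fin.sum_univ_succ] at h6
  rw [h6, h1, h2, ← lintegral_add_left]
  · refine lintegral_congr_ae ?_
    filter_upwards [hfin] with x hx
    rw [← lintegral_add_left (by fun_prop)]
    refine lintegral_congr_ae ?_
    filter_upwards [h5] with y hy
    exact frac_id x _ hx (by simp [ENNReal.sum_eq_top, hy])
  · exact Measurable.lintegral_prod_right' (f := fun z : ENNReal × (Fin d → ENNReal) => (∑ i, z.2 i)⁻¹ * ((∑ i, z.2 i)⁻¹ + z.1⁻¹)⁻¹) (by fun_prop)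

end Part5

section Part6
/-! ## Part F: calculus -/

section calculus

lemma phi_hasDeriv (d : ℕ) {x : ℝ} (hx : 0 < x) :
    HasDerivAt (fun t : ℝ => ((d:ℝ)+1)*(1-t)+(1+d*t)*Real.log t) (1/x - 1 + d * Real.log x) x := by
  have h := (((hasDerivAt_const x (1:ℝ)).sub (hasDerivAt_id x)).const_mul ((d:ℝ)+1)).add
    ((((hasDerivAt_id x).const_mul (d:ℝ)).const_add 1).mul (Real.hasDerivAt_log hx.ne'))
  refine h.congr_deriv ?_
  simp only [id]
  field_simp
  ring

lemma chi_hasDeriv (d : ℕ) {x : ℝ} (hx : 0 < x) :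
    HasDerivAt (fun t : ℝ => 1/t - 1 + d * Real.log t) ((d * x - 1)/x^2) x := by
  have h := ((hasDerivAt_inv hx.ne').sub_const 1).add ((Real.hasDerivAt_log hx.ne').const_mul (d:ℝ))
  simp only [one_div]
  refine h.congr_deriv ?_
  field_simp
  ring

lemma chi_anti (d : ℕ) (hd : 2 ≤ d) {x y : ℝ} (hx : 0 < x) (hxy : x < y) (hy : y ≤ 1/d) :
    1/y - 1 + d * Real.log y < 1/x - 1 + d * Real.log x := by
  have hd0 : (0:ℝ) < d := by positivity
  have h := strictAntiOn_of_deriv_neg (convex_Icc x y) (f := fun t : ℝ => 1/t - 1 + d * Real.log t)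
    (fun z hz => (chi_hasDeriv d (lt_of_lt_of_le hx hz.1)).continuousAt.continuousWithinAt)
    (fun z hz => by
      rw [interior_Icc] at hz
      have hz0 : 0 < z := lt_trans hx hz.1
      rw [(chi_hasDeriv d hz0).deriv]
      apply div_neg_of_neg_of_pos _ (by positivity)
      have : z < 1/d := lt_of_lt_of_le hz.2 hy
      rw [lt_div_iff₀ hd0] at this
      linarith)
  exact h ⟨le_rfl, hxy.le⟩ ⟨hxy.le, le_rfl⟩ hxy

lemma chi_neg (d : ℕ) (hd : 2 ≤ d) {x : ℝ} (hx : 1/(d:ℝ) ≤ x) (hx1 : x < 1) :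
    1/x - 1 + d * Real.log x < 0 := by
  have hd0 : (0:ℝ) < d := by positivity
  have hx0 : 0 < x := lt_of_lt_of_le (by positivity) hx
  have h := strictMonoOn_of_deriv_pos (convex_Icc x 1) (f := fun t : ℝ => 1/t - 1 + d * Real.log t)
    (fun z hz => (chi_hasDeriv d (lt_of_lt_of_le hx0 hz.1)).continuousAt.continuousWithinAt)
    (fun z hz => by
      rw [interior_Icc] at hz
      have hz0 : 0 < z := lt_trans hx0 hz.1
      rw [(chi_hasDeriv d hz0).deriv]
      apply div_pos _ (by positivity)
      have : 1/d < z := lt_of_le_of_lt hx hz.1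
      rw [div_lt_iff₀ hd0] at this
      linarith)
  have := h ⟨le_rfl, hx1.le⟩ ⟨hx1.le, le_rfl⟩ hx1
  simpa using this

lemma phi_pos (d : ℕ) (hd : 2 ≤ d) {x : ℝ} (hx : 1/(d:ℝ) ≤ x) (hx1 : x < 1) :
    0 < ((d:ℝ)+1)*(1-x)+(1+d*x)*Real.log x := by
  have hd0 : (0:ℝ) < d := by positivity
  have hx0 : 0 < x := lt_of_lt_of_le (by positivity) hx
  have h := strictAntiOn_of_deriv_neg (convex_Icc x 1)
    (f := fun t : ℝ => ((d:ℝ)+1)*(1-t)+(1+d*t)*Real.log t)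
    (fun z hz => (phi_hasDeriv d (lt_of_lt_of_le hx0 hz.1)).continuousAt.continuousWithinAt)
    (fun z hz => by
      rw [interior_Icc] at hz
      have hz0 : 0 < z := lt_trans hx0 hz.1
      rw [(phi_hasDeriv d hz0).deriv]
      exact chi_neg d hd (hx.trans hz.1.le) hz.2)
  have := h ⟨le_rfl, hx1.le⟩ ⟨hx1.le, le_rfl⟩ hx1
  simpa using this

lemma chi_pos (d : ℕ) (hd : 2 ≤ d) {x : ℝ} (hx0 : 0 < x) (hx1 : x < 1)
    (hphi : ((d:ℝ)+1)*(1-x)+(1+d*x)*Real.log x ≤ 0) {s : ℝ} (hs : 0 < s) (hsx : s ≤ x) :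
    x < 1/d ∧ 0 < 1/s - 1 + d * Real.log s := by
  have hd0 : (0:ℝ) < d := by positivity
  have hxd : x < 1/d := by
    by_contra h
    exact absurd (phi_pos d hd (not_lt.1 h) hx1) (not_lt.2 hphi)
  refine ⟨hxd, ?_⟩
  have hp := phi_pos d hd (le_refl (1/(d:ℝ))) (by
    rw [div_lt_one hd0]; exact_mod_cast lt_of_lt_of_le (by norm_num) hd)
  obtain ⟨ξ, hξ, he⟩ := exists_hasDerivAt_eq_slope
    (fun t : ℝ => ((d:ℝ)+1)*(1-t)+(1+d*t)*Real.log t) (fun x => 1/x - 1 + d * Real.log x) hxd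
    (fun z hz => (phi_hasDeriv d (lt_of_lt_of_le hx0 hz.1)).continuousAt.continuousWithinAt)
    (fun z hz => phi_hasDeriv d (lt_trans hx0 hz.1))
  have h1 : 0 < 1/ξ - 1 + d * Real.log ξ := by
    rw [he]
    apply div_pos _ (by linarith)
    linarith
  have h2 := chi_anti d hd hs (lt_of_le_of_lt hsx hξ.1) hξ.2.le
  linarith

lemma calc_main (d : ℕ) (hd : 2 ≤ d) (c td t : ℝ) (hc0 : 0 < c) (htd : td ∈ Set.Ioo (0:ℝ) 1)
    (hroot : ((d:ℝ)+1)*(1-td)+(1+d*td)*Real.log td = 0) (hc : c < -Real.log td/(1-td)^d)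
    (ht1 : t ≤ 1) (hfix : t = Real.exp (-(c*(1-t)^d)))
    (hE : 1 - c/((d:ℝ)+1) ≤ t + c*(t*(1-t)^d) - c/((d:ℝ)+1)*(1-(1-t)^(d+1))) : t = 1 := by
  by_contra hne
  have ht1' : t < 1 := lt_of_le_of_ne ht1 hne
  have ht0 : 0 < t := by rw [hfix]; exact Real.exp_pos _
  have hlog : c*(1-t)^d = -Real.log t := by
    have := congrArg Real.log hfix
    rw [Real.log_exp] at this
    linarith
  have hphi : ((d:ℝ)+1)*(1-t)+(1+d*t)*Real.log t ≤ 0 := by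
    have e : t + c*(t*(1-t)^d) - c/((d:ℝ)+1)*(1-(1-t)^(d+1)) - (1 - c/((d:ℝ)+1)) =
      t + t * (c*(1-t)^d) - 1 + (c*(1-t)^d) * (1-t)/((d:ℝ)+1) := by rw [pow_succ]; field_simp; ring
    have h2 : 0 ≤ t + t * (c*(1-t)^d) - 1 + (c*(1-t)^d) * (1-t)/((d:ℝ)+1) := by linarith
    rw [hlog] at h2
    have h3 : 0 ≤ (t + t * (-Real.log t) - 1 + (-Real.log t) * (1-t)/((d:ℝ)+1)) * ((d:ℝ)+1) :=
      mul_nonneg h2 (by positivity)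
    have e2 : (t + t * (-Real.log t) - 1 + (-Real.log t) * (1-t)/((d:ℝ)+1)) * ((d:ℝ)+1) =
      -(((d:ℝ)+1)*(1-t)+(1+d*t)*Real.log t) := by field_simp; ring
    linarith
  have htt : t ≤ td := by
    by_contra h
    have h := not_le.1 h
    have hm := strictMonoOn_of_deriv_pos (convex_Icc td t)
      (f := fun t : ℝ => ((d:ℝ)+1)*(1-t)+(1+d*t)*Real.log t)
      (fun z hz => (phi_hasDeriv d (lt_of_lt_of_le htd.1 hz.1)).continuousAt.continuousWithinAt)
      (fun z hz => by
        rw [interior_Icc] at hz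
        rw [(phi_hasDeriv d (lt_trans htd.1 hz.1)).deriv]
        exact (chi_pos d hd ht0 ht1' hphi (lt_trans htd.1 hz.1) hz.2.le).2)
    have := hm ⟨le_rfl, h.le⟩ ⟨h.le, le_rfl⟩ h
    simp only [hroot] at this
    linarith
  have hanti := antitoneOn_of_deriv_nonpos (convex_Icc t td)
    (f := fun s : ℝ => Real.log (-Real.log s) - d * Real.log (1 - s)) 
  have hder : ∀ s, 0 < s → s < 1 → HasDerivAt (fun s : ℝ => Real.log (-Real.log s) - d * Real.log (1 - s))
      ((1/s - 1 + d * Real.log s) * s / (s * Real.log s * (1 - s))) s := by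
    intro s hs hs1
    have hl : Real.log s < 0 := Real.log_neg hs hs1
    have h1 := ((Real.hasDerivAt_log hs.ne').neg).log (by simpa using hl.ne)
    have h2 := (((hasDerivAt_id s).const_sub 1).log (by simp; linarith)).const_mul (d:ℝ)
    refine (h1.sub h2).congr_deriv ?_
    have : 1 - s ≠ 0 := by linarith
    have : Real.log s ≠ 0 := hl.ne
    simp only [id, Pi.neg_apply]
    field_simp
    ring
  have hpos : ∀ s, s ∈ Set.Icc t td → 0 < s ∧ s < 1 := fun s hs =>
    ⟨lt_of_lt_of_le ht0 hs.1, lt_of_le_of_lt hs.2 htd.2⟩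
  have := hanti (fun z hz => (hder z (hpos z hz).1 (hpos z hz).2).continuousAt.continuousWithinAt)
    (fun z hz => (hder z (hpos z (interior_subset hz)).1 (hpos z (interior_subset hz)).2).differentiableAt.differentiableWithinAt)
    (fun z hz => by
      have hz := interior_subset hz
      obtain ⟨h0, h1⟩ := hpos z hz
      rw [(hder z h0 h1).deriv]
      have h2 := (chi_pos d hd htd.1 htd.2 hroot.le h0 hz.2).2
      apply div_nonpos_of_nonneg_of_nonpos (by positivity)
      have hl : Real.log z < 0 := Real.log_neg h0 h1
      have h3 : 0 < 1 - z := by linarith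
      have : z * Real.log z < 0 := mul_neg_of_pos_of_neg h0 hl
      exact (mul_neg_of_neg_of_pos this h3).le)
    ⟨le_rfl, htt⟩ ⟨htt, le_rfl⟩ htt
  have hlt : 0 < -Real.log t := by have := Real.log_neg ht0 ht1'; linarith
  have hltd : 0 < -Real.log td := by have := Real.log_neg htd.1 htd.2; linarith
  have h1t : 0 < 1 - t := by linarith
  have h1td : 0 < 1 - td := by linarith [htd.2]
  have hcl : Real.log c < Real.log (-Real.log td/(1-td)^d) := Real.log_lt_log hc0 hc
  rw [Real.log_div hltd.ne' (by positivity), Real.log_pow] at hcl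
  have e : Real.log c + d * Real.log (1 - t) = Real.log (-Real.log t) := by
    rw [← hlog, Real.log_mul hc0.ne' (by positivity), Real.log_pow]
  beta_reduce at this
  linarith

end calculus

section realfix
open MeasureTheory ProbabilityTheory

lemma tsum_pois (c : NNReal) (r : ℝ) (hr : 0 ≤ r) :
    ∑' m : ℕ, poissonMeasure c {m} * (ENNReal.ofReal r) ^ m = ENNReal.ofReal (Real.exp (c * r - c)) := by
  have h1 : ∀ m : ℕ, poissonMeasure c {m} * (ENNReal.ofReal r) ^ m =
      ENNReal.ofReal (Real.exp (-c) * ((c * r) ^ m / m.factorial)) := by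
    intro m
    rw [poissonMeasure_singleton, ← ENNReal.ofReal_pow hr, ← ENNReal.ofReal_mul (by positivity)]
    congr 1
    rw [mul_pow]; ring
  simp_rw [h1]
  have h2 : HasSum (fun m : ℕ => Real.exp (-c) * ((c * r) ^ m / m.factorial)) (Real.exp (-c) * Real.exp (c * r)) := by
    apply HasSum.mul_left
    rw [Real.exp_eq_exp_ℝ]
    exact NormedSpace.expSeries_div_hasSum_exp (c * r : ℝ)
  rw [← ENNReal.ofReal_tsum_of_nonneg (fun m => by positivity) h2.summable, h2.tsum_eq, ← Real.exp_add]
  congr 2; ring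

lemma muinf_le_one (c : NNReal) (d : ℕ) : ∀ᵐ x ∂(muinf c d), x ≤ 1 := by
  unfold muinf
  rw [ae_map_iff (measurable_Xinf d).aemeasurable measurableSet_Iic]
  exact Filter.Eventually.of_forall fun ω => (iInf_le _ 0).trans (Xk_le_one d 0 ω)

lemma muinf_real (c : NNReal) (d : ℕ) : ∃ t : ℝ, t ≤ 1 ∧ t = Real.exp (-(c * (1 - t) ^ d)) ∧
    (∫⁻ x, x ∂(muinf c d)).toReal = t + c*(t*(1-t)^d) - c/((d:ℝ)+1)*(1-(1-t)^(d+1)) := by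
  set μ := muinf c d with hμ
  have hfin : ∀ᵐ x ∂μ, x ≠ ⊤ := by
    filter_upwards [muinf_le_one c d] with x hx
    exact ne_top_of_le_ne_top (by simp) hx
  have hE1 : ∫⁻ x, x ∂μ ≤ 1 := by
    calc _ ≤ ∫⁻ _, 1 ∂μ := lintegral_mono_ae (muinf_le_one c d)
      _ = 1 := by simp
  set z := (μ {0}).toReal with hz
  have hz0 : 0 ≤ z := ENNReal.toReal_nonneg
  have hzo : μ {0} = ENNReal.ofReal z := (ENNReal.ofReal_toReal (measure_ne_top _ _)).symm
  have hz1 : z ≤ 1 := by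
    have := prob_le_one (μ := μ) (s := {0})
    rw [hzo] at this
    simpa using this
  have hc0 : μ {0}ᶜ = ENNReal.ofReal (1 - z) := by
    rw [prob_compl_eq_one_sub (measurableSet_singleton _), hzo, ENNReal.ofReal_sub _ hz0]; simp
  have h1 := fix_ne_zero c d μ (muinf_eq c d)
  have h2 := fix_mecke c d μ (muinf_eq c d)
  have h3 := exch d μ hfin
  have h4 := fix_A d μ hfin
  set A := ∫⁻ a, ∫⁻ x, a * (a + x⁻¹)⁻¹ ∂μ ∂(kap d μ)
  set E := ∫⁻ x, x ∂μ
  set Y := ∫⁻ y, y 0 * (∑ i, y i)⁻¹ ∂(Measure.pi (fun _ : Fin (d + 1) => μ))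
  have hY : Y ≠ ⊤ := by
    intro h
    rw [h] at h3
    simp [ENNReal.mul_top] at h3
  have hA : A ≠ ⊤ := by
    intro h
    rw [h] at h4
    simp at h4
    exact hY h4.symm
  refine ⟨1 - z, by linarith, ?_, ?_⟩
  · rw [prob_compl_eq_one_sub (μ := kap d μ) (measurableSet_singleton _), kap_top, hc0, hzo, ← ENNReal.ofReal_pow hz0,
      ← ENNReal.ofReal_one, ← ENNReal.ofReal_sub _ (by positivity), tsum_pois _ _ (by
        have := pow_le_one₀ (n := d) hz0 hz1
        linarith)] at h1
    have := (ENNReal.ofReal_eq_ofReal_iff (by linarith) (Real.exp_pos _).le).1 h1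
    rw [this]
    congr 1
    rw [← this]
    ring
  · have e2 := congrArg ENNReal.toReal h2
    have e3 := congrArg ENNReal.toReal h3
    have e4 := congrArg ENNReal.toReal h4
    rw [hc0, hzo, ← ENNReal.ofReal_pow hz0, ← ENNReal.ofReal_mul (by linarith), ENNReal.toReal_add hA (by simp),
      ENNReal.toReal_ofReal (mul_nonneg (by linarith) (by positivity))] at e4
    rw [hc0, ENNReal.toReal_add (ne_top_of_le_ne_top (by simp) hE1) (ENNReal.mul_ne_top (by simp) hA), ENNReal.toReal_mul,
      ENNReal.toReal_ofReal (by linarith)] at e2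
    rw [hzo, ENNReal.toReal_add (ENNReal.mul_ne_top (by simp [ENNReal.add_eq_top]) hY) (by simp), ENNReal.toReal_mul, ← ENNReal.ofReal_pow hz0,
      ENNReal.toReal_ofReal (by positivity)] at e3
    have e5 : ((d:ENNReal) + 1).toReal = (d:ℝ) + 1 := by
      rw [ENNReal.toReal_add (by simp) (by simp)]; simp
    rw [e5] at e3
    simp only [ENNReal.coe_toReal, ENNReal.toReal_one] at e2 e3
    have e6 : Y.toReal = (1 - z^(d+1))/((d:ℝ)+1) := by
      rw [eq_div_iff (by positivity)]; linarith
    rw [e6] at e4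
    have e7 : A.toReal = (1 - z^(d+1))/((d:ℝ)+1) - (1-z)*z^d := by linarith
    rw [e7] at e2
    have e8 : (1:ℝ) - (1 - z) = z := by ring
    rw [e8]
    have : E.toReal = (1 - z) - c * ((1 - z^(d+1))/((d:ℝ)+1) - (1-z)*z^d) := by linarith
    rw [this]; ring

lemma tendsto_muk (c : NNReal) (d : ℕ) :
    Tendsto (fun k => ∫⁻ x, x ∂(muk c d k)) atTop (nhds (∫⁻ x, x ∂(muinf c d))) := by
  have h1 : ∀ k, ∫⁻ x, x ∂(muk c d k) = ∫⁻ ω, Xk d k ω ∂(TrP c d) := fun k => by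
    unfold muk; rw [lintegral_map (f := fun x => x) measurable_id (measurable_Xk d k)]
  have h2 : ∫⁻ x, x ∂(muinf c d) = ∫⁻ ω, Xinf d ω ∂(TrP c d) := by
    unfold muinf; rw [lintegral_map (f := fun x => x) measurable_id (measurable_Xinf d)]
  simp_rw [h1, h2]
  exact tendsto_lintegral_of_dominated_convergence (fun _ => 1) (fun k => measurable_Xk d k)
    (fun k => Filter.Eventually.of_forall fun ω => Xk_le_one d k ω) (by simp)
    (Filter.Eventually.of_forall fun ω => tendsto_Xk d ω)

/-- If `E X_k ≥ 1 - c/(d+1)` for all `k` then the limit is exactly `1 - c/(d+1)`. -/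
lemma muk_limit (d : ℕ) (hd : 2 ≤ d) (c : NNReal) (td : ℝ) (hc0 : 0 < (c:ℝ)) (htd : td ∈ Set.Ioo (0:ℝ) 1)
    (hroot : ((d:ℝ)+1)*(1-td)+(1+d*td)*Real.log td = 0) (hc : (c:ℝ) < -Real.log td/(1-td)^d)
    (hk : ∀ k, 1 - c/((d:ℝ)+1) ≤ (∫⁻ x, x ∂(muk c d k)).toReal) :
    Tendsto (fun k => (∫⁻ x, x ∂(muk c d k)).toReal) atTop (nhds (1 - c/((d:ℝ)+1))) := by
  have hE1 : ∫⁻ x, x ∂(muinf c d) ≤ 1 := by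
    calc _ ≤ ∫⁻ _, 1 ∂(muinf c d) := lintegral_mono_ae (muinf_le_one c d)
      _ = 1 := by simp
  have h := (ENNReal.tendsto_toReal (ne_top_of_le_ne_top (by simp) hE1)).comp (tendsto_muk c d)
  obtain ⟨t, ht1, hfix, hE⟩ := muinf_real c d
  have hge := ge_of_tendsto' h hk
  rw [hE] at hge h
  have := calc_main d hd c td t hc0 htd hroot hc ht1 hfix hge
  subst this
  have hd0 : (d:ℕ) ≠ 0 := by omega
  have e : 1 + (c:ℝ) * (1 * (1 - 1) ^ d) - c / ((d:ℝ) + 1) * (1 - (1 - 1) ^ (d + 1)) = 1 - c/((d:ℝ)+1) := by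
    simp [hd0]
  rw [e] at h
  exact h

end realfix

end Part6

section Part7
/-! ## Part D: local resolution vectors -/

lemma face_step {n d : ℕ} {F : Finset (Finset (Fin n))} {τ : Finset (Fin n)} {v : Fin n} (hv : v ∉ τ)
    (u : Fin d → Fin n) (hu : Function.Injective u) (hi : Finset.univ.image u = τ)
    (hF : insert v τ ∈ F) :
    ∃ ε : Fin d → ℝ, (∀ i, ε i * ε i = 1) ∧
      (∑ i, ε i • (Pi.single ((insert v τ).erase (u i)) (1:ℝ) : Finset (Fin n) → ℝ)) - Pi.single τ 1 ∈ Wsp F := by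
  refine ⟨fun i => - (sgn (insert v τ) v * sgn (insert v τ) (u i)), fun i => ?_, ?_⟩
  · have h1 := sgn_sq (insert v τ) v
    have h2 := sgn_sq (insert v τ) (u i)
    calc _ = (sgn (insert v τ) v * sgn (insert v τ) v) * (sgn (insert v τ) (u i) * sgn (insert v τ) (u i)) := by ring
      _ = 1 := by rw [h1, h2]; ring
  · have h := colv_eq (insert v τ)
    rw [Finset.sum_insert hv, Finset.erase_insert hv] at h
    have h3 : ∑ w ∈ τ, sgn (insert v τ) w • (Pi.single ((insert v τ).erase w) (1:ℝ) : Finset (Fin n) → ℝ) =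
        ∑ i, sgn (insert v τ) (u i) • (Pi.single ((insert v τ).erase (u i)) (1:ℝ) : Finset (Fin n) → ℝ) := by
      conv_lhs => rw [← hi]
      rw [Finset.sum_image (fun a _ b _ hab => hu hab)]
      rw [hi]
    have h4 : (∑ i, (- (sgn (insert v τ) v * sgn (insert v τ) (u i))) • (Pi.single ((insert v τ).erase (u i)) (1:ℝ) : Finset (Fin n) → ℝ))
        - Pi.single τ 1 = (- sgn (insert v τ) v) • colv (insert v τ) := by
      rw [h, h3, smul_add, smul_smul, neg_mul, sgn_sq, neg_one_smul, Finset.smul_sum]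
      simp_rw [smul_smul, neg_mul]
      abel
    rw [h4]
    exact Submodule.smul_mem _ _ (colv_mem hF)

/-- resolution vectors -/
def Res {n : ℕ} (F : Finset (Finset (Fin n))) {ι : Type} (T : ι → Finset (Fin n))
    (U : Finset (Fin n)) (x : ι → ENNReal) : Prop :=
  ∃ r : ι → (Finset (Fin n) → ℝ), (∀ a, r a - Pi.single (T a) 1 ∈ Wsp F) ∧
    (∀ a, x a = ENNReal.ofReal (r a ⬝ᵥ r a)) ∧ (∀ a, 0 < r a ⬝ᵥ r a) ∧
    (∀ a ρ, r a ρ ≠ 0 → ρ = T a ∨ ¬ ρ ⊆ U) ∧ (∀ a b, a ≠ b → r a ⬝ᵥ r b = 0)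

lemma Res_zero {n : ℕ} (F : Finset (Finset (Fin n))) {ι : Type} (T : ι → Finset (Fin n))
    (hT : Function.Injective T) (U : Finset (Fin n)) : Res F T U (fun _ => 1) := by
  refine ⟨fun a => Pi.single (T a) 1, fun a => by simp, fun a => by simp, fun a => by simp, ?_, ?_⟩
  · intro a ρ h
    left
    by_contra hne
    exact h (by simp [Pi.single_eq_of_ne hne])
  · intro a b hab
    have : T a ≠ T b := fun h => hab (hT h)
    simp [Pi.single_eq_of_ne this.symm]

lemma dot_zero {κ : Type*} [Fintype κ] {x y : κ → ℝ} (h : ∀ ρ, x ρ ≠ 0 → y ρ = 0) : x ⬝ᵥ y = 0 := by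
  unfold dotProduct
  apply Finset.sum_eq_zero
  intro ρ _
  by_cases hx : x ρ = 0
  · simp [hx]
  · simp [h ρ hx]

lemma Res_step {n d : ℕ} (hd : 1 ≤ d) {F1 F2 : Finset (Finset (Fin n))} {ι : Type} {T : ι → Finset (Fin n)}
    {U : Finset (Fin n)} (hT : Function.Injective T) (hTU : ∀ a, T a ⊆ U)
    (u : ι → Fin d → Fin n) (hu : ∀ a, Function.Injective (u a)) (hui : ∀ a, Finset.univ.image (u a) = T a)
    (m : ι → ℕ) (e : (Σ a, Fin (m a)) → Fin n) (hinj : Function.Injective e) (heU : ∀ s, e s ∉ U)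
    {U' : Finset (Fin n)} (hUU' : U ⊆ U')
    (hF1 : ∀ s, insert (e s) (T s.1) ∈ F1)
    {x : (Σ a, Fin (m a) × Fin d) → ENNReal}
    (hR : Res F2 (fun z : Σ a, Fin (m a) × Fin d => (insert (e ⟨z.1, z.2.1⟩) (T z.1)).erase (u z.1 z.2.2)) U' x) :
    Res (F1 ∪ F2) T U (Psi d m x) := by
  obtain ⟨r, hr1, hr2, hr3, hr4, hr5⟩ := hR
  have hfs : ∀ s : Σ a, Fin (m a), ∃ ε : Fin d → ℝ, (∀ i, ε i * ε i = 1) ∧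
      (∑ i, ε i • (Pi.single ((insert (e s) (T s.1)).erase (u s.1 i)) (1:ℝ) : Finset (Fin n) → ℝ))
        - Pi.single (T s.1) 1 ∈ Wsp F1 := fun s =>
    face_step (fun h => heU s (hTU _ h)) (u s.1) (hu _) (hui _) (hF1 s)
  choose ε hε1 hε2 using hfs
  set q : (Σ a, Fin (m a)) → (Finset (Fin n) → ℝ) := fun s => ∑ i, ε s i • r ⟨s.1, s.2, i⟩ with hq
  have hq1 : ∀ s, q s - Pi.single (T s.1) 1 ∈ Wsp (F1 ∪ F2) := by
    intro s
    have e1 : q s - Pi.single (T s.1) 1 = (∑ i, ε s i • (r ⟨s.1, s.2, i⟩ - Pi.single ((insert (e s) (T s.1)).erase (u s.1 i)) 1))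
      + ((∑ i, ε s i • (Pi.single ((insert (e s) (T s.1)).erase (u s.1 i)) (1:ℝ) : Finset (Fin n) → ℝ))
        - Pi.single (T s.1) 1) := by
      simp_rw [smul_sub, Finset.sum_sub_distrib, hq]
      abel
    rw [e1]
    refine Submodule.add_mem _ (Submodule.sum_mem _ fun i _ => Submodule.smul_mem _ _ ?_) ?_
    · exact Wsp_mono Finset.subset_union_right (hr1 ⟨s.1, s.2, i⟩)
    · exact Wsp_mono Finset.subset_union_left (hε2 s)
  set S : (Σ a, Fin (m a)) → ℝ := fun s => ∑ i, r ⟨s.1, s.2, i⟩ ⬝ᵥ r ⟨s.1, s.2, i⟩ with hS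
  have hSpos : ∀ s, 0 < S s := by
    intro s
    have : (Finset.univ : Finset (Fin d)).Nonempty := ⟨⟨0, hd⟩, Finset.mem_univ _⟩
    exact Finset.sum_pos (fun i _ => hr3 _) this
  have hqq : ∀ s t, q s ⬝ᵥ q t = if s = t then S s else 0 := by
    intro s t
    simp only [hq, sum_dotProduct, dotProduct_sum, smul_dotProduct, dotProduct_smul]
    split_ifs with h
    · subst h
      refine Finset.sum_congr rfl fun i _ => ?_
      rw [Finset.sum_eq_single i]
      · rw [smul_smul, hε1, one_smul]
      · intro j _ hj
        rw [hr5 _ _ (by intro h; simp at h; exact hj h)]; simp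
      · simp
    · refine Finset.sum_eq_zero fun i _ => ?_
      rw [Finset.sum_eq_zero (fun j _ => ?_), smul_zero]
      rw [hr5 _ _ (by
        intro h'
        apply h
        obtain ⟨a, j1⟩ := s
        obtain ⟨b, j2⟩ := t
        simp only [Sigma.mk.injEq] at h' ⊢
        obtain ⟨rfl, h'⟩ := h'
        have h' := eq_of_heq h'
        simp only [Prod.mk.injEq] at h'
        exact ⟨rfl, heq_of_eq h'.1⟩)]
      simp
  have hqsupp : ∀ s ρ, ρ ⊆ U → q s ρ = 0 := by
    intro s ρ hρ
    simp only [hq, Finset.sum_apply, Pi.smul_apply]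
    refine Finset.sum_eq_zero fun i _ => ?_
    have : r ⟨s.1, s.2, i⟩ ρ = 0 := by
      by_contra hne
      rcases hr4 _ _ hne with h | h
      · apply heU s
        apply hρ
        rw [h]
        refine Finset.mem_erase.2 ⟨?_, Finset.mem_insert_self _ _⟩
        intro h2
        apply heU s
        rw [h2]
        apply hTU s.1
        rw [← hui s.1]
        exact Finset.mem_image_of_mem _ (Finset.mem_univ _)
      · exact h (hρ.trans hUU')
    rw [this]; simp
  have hTq : ∀ a s, (Pi.single (T a) (1:ℝ) : Finset (Fin n) → ℝ) ⬝ᵥ q s = 0 := by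
    intro a s
    rw [single_dotProduct, hqsupp s _ (hTU a)]; simp
  have hqT0 : ∀ a s, q s (T a) = 0 := fun a s => hqsupp s _ (hTU a)
  set X : ι → ℝ := fun a => (1 + ∑ j, (S ⟨a, j⟩)⁻¹)⁻¹ with hX
  have hden : ∀ a, 0 < 1 + ∑ j, (S ⟨a, j⟩)⁻¹ := fun a =>
    add_pos_of_pos_of_nonneg one_pos (Finset.sum_nonneg fun j _ => (inv_pos.2 (hSpos _)).le)
  have hXpos : ∀ a, 0 < X a := fun a => inv_pos.2 (hden a)
  have hXsum : ∀ a, X a + ∑ j, X a * (S ⟨a, j⟩)⁻¹ = 1 := by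
    intro a
    rw [← Finset.mul_sum, ← mul_one_add]
    exact inv_mul_cancel₀ (hden a).ne'
  set R : ι → (Finset (Fin n) → ℝ) := fun a => X a • Pi.single (T a) (1:ℝ) + ∑ j, (X a * (S ⟨a, j⟩)⁻¹) • q ⟨a, j⟩ with hRdef
  have hRR : ∀ a b, a ≠ b → R a ⬝ᵥ R b = 0 := by
    intro a b hab
    have hTT : T a ≠ T b := fun h => hab (hT h)
    have h0 : ∀ j k, q ⟨a, j⟩ ⬝ᵥ q ⟨b, k⟩ = 0 := by
      intro j k
      rw [hqq, if_neg]
      intro h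
      simp only [Sigma.mk.injEq] at h
      exact hab h.1
    simp [hRdef, sum_dotProduct, dotProduct_sum, smul_dotProduct, dotProduct_smul, hTq, hqT0, h0,
      Pi.single_eq_of_ne hTT.symm]
  have hRa : ∀ a, R a ⬝ᵥ R a = X a := by
    intro a
    have h0 : ∀ j k, q ⟨a, j⟩ ⬝ᵥ q ⟨a, k⟩ = if j = k then S ⟨a, j⟩ else 0 := by
      intro j k
      rw [hqq]
      by_cases h : j = k
      · subst h; simp
      · rw [if_neg h, if_neg]
        intro h'
        simp at h'
        exact h h'
    have h1 : R a ⬝ᵥ R a = X a * X a + ∑ j, (X a * (S ⟨a, j⟩)⁻¹) * ((X a * (S ⟨a, j⟩)⁻¹) * S ⟨a, j⟩) := by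
      simp [hRdef, add_dotProduct, dotProduct_add, sum_dotProduct, dotProduct_sum, smul_dotProduct, dotProduct_smul, hTq, hqT0, h0]
    rw [h1]
    have h2 : ∀ j, (X a * (S ⟨a, j⟩)⁻¹) * ((X a * (S ⟨a, j⟩)⁻¹) * S ⟨a, j⟩) = X a * (X a * (S ⟨a, j⟩)⁻¹) := by
      intro j
      have := (hSpos ⟨a, j⟩).ne'
      field_simp
    simp_rw [h2]
    rw [← Finset.mul_sum, ← mul_add, hXsum, mul_one]
  refine ⟨R, ?_, ?_, ?_, ?_, hRR⟩
  · intro a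
    have e1 : R a - Pi.single (T a) 1 = ∑ j, (X a * (S ⟨a, j⟩)⁻¹) • (q ⟨a, j⟩ - Pi.single (T a) (1:ℝ)) := by
      simp_rw [smul_sub, Finset.sum_sub_distrib, ← Finset.sum_smul]
      have : ∑ j, X a * (S ⟨a, j⟩)⁻¹ = 1 - X a := by linarith [hXsum a]
      rw [this, sub_smul, one_smul]
      simp only [hRdef]
      abel
    rw [e1]
    exact Submodule.sum_mem _ fun j _ => Submodule.smul_mem _ _ (hq1 ⟨a, j⟩)
  · intro a
    rw [hRa]
    unfold Psi
    simp only [hX]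
    rw [ENNReal.ofReal_inv_of_pos (hden a), ENNReal.ofReal_add (by simp) (Finset.sum_nonneg fun j _ => (inv_pos.2 (hSpos _)).le),
      ENNReal.ofReal_sum_of_nonneg (fun j _ => (inv_pos.2 (hSpos _)).le), ENNReal.ofReal_one]
    congr 2
    refine Finset.sum_congr rfl fun j _ => ?_
    rw [ENNReal.ofReal_inv_of_pos (hSpos _)]
    congr 1
    simp only [hS]
    rw [ENNReal.ofReal_sum_of_nonneg (fun i _ => (hr3 _).le)]
    exact Finset.sum_congr rfl fun i _ => hr2 _
  · intro a; rw [hRa]; exact hXpos a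
  · intro a ρ hρ
    by_contra hcon
    push Not at hcon
    apply hρ
    simp only [hRdef, Pi.add_apply, Pi.smul_apply, Finset.sum_apply]
    rw [Pi.single_eq_of_ne hcon.1, Finset.sum_eq_zero]
    · simp
    · intro j _
      rw [hqsupp _ _ hcon.2]; simp

end Part7

section Part8
/-! ## Part D2: counting star configurations -/

/-- the star faces of a configuration -/
def starF {n : ℕ} {ι : Type} [Fintype ι] (T : ι → Finset (Fin n)) (U : Finset (Fin n)) (m : ι → ℕ)
    (e : (Σ a, Fin (m a)) ↪ {v : Fin n // v ∉ U}) : Finset (Finset (Fin n)) :=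
  Finset.univ.image (fun s => insert (e s : Fin n) (T s.1))

def starAll {n : ℕ} {ι : Type} [Fintype ι] (T : ι → Finset (Fin n)) (U : Finset (Fin n)) :
    Finset (Finset (Fin n)) :=
  Finset.univ.image (fun z : ι × {v : Fin n // v ∉ U} => insert (z.2 : Fin n) (T z.1))

def nbF {n : ℕ} {ι : Type} (T : ι → Finset (Fin n)) (U : Finset (Fin n))
    (F : Finset (Finset (Fin n))) (a : ι) : Finset {v : Fin n // v ∉ U} :=
  Finset.univ.filter (fun v => insert (v : Fin n) (T a) ∈ F)

section star
variable {n : ℕ} {ι : Type} [Fintype ι] {T : ι → Finset (Fin n)} {U : Finset (Fin n)}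

lemma insert_inter_U (hTU : ∀ a, T a ⊆ U) (a : ι) (v : Fin n) (hv : v ∉ U) :
    insert v (T a) ∩ U = T a := by
  rw [Finset.insert_inter_of_notMem hv, Finset.inter_eq_left.2 (hTU a)]

lemma insert_eq_insert (hT : Function.Injective T) (hTU : ∀ a, T a ⊆ U) {a b : ι}
    {v w : Fin n} (hv : v ∉ U) (hw : w ∉ U)
    (h : insert v (T a) = insert w (T b)) : a = b ∧ v = w := by
  constructor
  · apply hT
    rw [← insert_inter_U hTU a v hv, h, insert_inter_U hTU b w hw]
  · have : v ∈ insert w (T b) := h ▸ Finset.mem_insert_self _ _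
    rcases Finset.mem_insert.1 this with h | h
    · exact h
    · exact absurd (hTU b h) hv

lemma starF_card (hT : Function.Injective T) (hTU : ∀ a, T a ⊆ U) (m : ι → ℕ)
    (e : (Σ a, Fin (m a)) ↪ {v : Fin n // v ∉ U}) : (starF T U m e).card = ∑ a, m a := by
  unfold starF
  rw [Finset.card_image_of_injective]
  · simp
  · intro s t h
    have := (insert_eq_insert hT hTU (e s).2 (e t).2 h).2
    exact e.injective (Subtype.ext this)

lemma starF_subset (m : ι → ℕ) (e : (Σ a, Fin (m a)) ↪ {v : Fin n // v ∉ U}) :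
    starF T U m e ⊆ starAll T U := by
  intro σ h
  simp only [starF, starAll, Finset.mem_image, Finset.mem_univ, true_and] at h ⊢
  obtain ⟨s, rfl⟩ := h
  exact ⟨(s.1, e s), rfl⟩

lemma nbF_starF (hT : Function.Injective T) (hTU : ∀ a, T a ⊆ U) (m : ι → ℕ)
    (e : (Σ a, Fin (m a)) ↪ {v : Fin n // v ∉ U}) (a : ι) :
    nbF T U (starF T U m e) a = Finset.univ.image (fun j : Fin (m a) => e ⟨a, j⟩) := by
  ext v
  simp only [nbF, starF, Finset.mem_filter, Finset.mem_image, Finset.mem_univ, true_and]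
  constructor
  · rintro ⟨⟨b, j⟩, h⟩
    obtain ⟨h1, h2⟩ := insert_eq_insert hT hTU (e ⟨b, j⟩).2 v.2 h
    simp only at h1
    subst h1
    exact ⟨j, Subtype.ext h2⟩
  · rintro ⟨j, rfl⟩
    exact ⟨⟨a, j⟩, rfl⟩

lemma nbF_card (hT : Function.Injective T) (hTU : ∀ a, T a ⊆ U) (m : ι → ℕ)
    (e : (Σ a, Fin (m a)) ↪ {v : Fin n // v ∉ U}) (a : ι) :
    (nbF T U (starF T U m e) a).card = m a := by
  rw [nbF_starF hT hTU, Finset.card_image_of_injective]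
  · simp
  · intro i j h
    have := e.injective h
    simpa using this

lemma starF_count (hT : Function.Injective T) (hTU : ∀ a, T a ⊆ U) (m : ι → ℕ) :
    (n - U.card).descFactorial (∑ a, m a) ≤ (∏ a, (m a).factorial) *
      (Finset.univ.image (starF T U m)).card := by
  have h1 : (Finset.univ : Finset ((Σ a, Fin (m a)) ↪ {v : Fin n // v ∉ U})).card =
      (n - U.card).descFactorial (∑ a, m a) := by
    rw [Finset.card_univ, Fintype.card_embedding_eq]
    congr 1
    · rw [Fintype.card_subtype_compl]; simp
    · simp
  rw [← h1]
  refine Finset.card_le_mul_card_image _ _ fun F hF => ?_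
  simp only [Finset.mem_image, Finset.mem_univ, true_and] at hF
  obtain ⟨e0, rfl⟩ := hF
  have h2 : ∏ a, (m a).factorial =
      Fintype.card (∀ a, (Fin (m a) ↪ (nbF T U (starF T U m e0) a))) := by
    rw [Fintype.card_pi]
    refine Finset.prod_congr rfl fun a _ => ?_
    rw [Fintype.card_embedding_eq, Fintype.card_coe, nbF_card hT hTU, Fintype.card_fin, Nat.descFactorial_self]
  rw [h2, ← Fintype.card_coe]
  have hmem : ∀ e ∈ Finset.univ.filter (fun e => starF T U m e = starF T U m e0),
      ∀ a j, e ⟨a, j⟩ ∈ nbF T U (starF T U m e0) a := by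
    intro e he a j
    rw [← (Finset.mem_filter.1 he).2, nbF_starF hT hTU]
    exact Finset.mem_image_of_mem _ (Finset.mem_univ j)
  refine Fintype.card_le_of_injective
    (fun e a => ⟨fun j => ⟨e.1 ⟨a, j⟩, hmem e.1 e.2 a j⟩, ?_⟩) ?_
  · intro i j h
    have := e.1.injective (congrArg Subtype.val h)
    simpa using this
  · intro e e' h
    apply Subtype.ext
    ext ⟨a, j⟩
    have := congrFun h a
    have := DFunLike.congr_fun this j
    have h3 := congrArg Subtype.val this
    exact congrArg (fun v : {v : Fin n // v ∉ U} => ((v : Fin n) : ℕ)) h3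

lemma starAll_card_le : (starAll T U).card ≤ Fintype.card ι * n := by
  unfold starAll
  refine Finset.card_image_le.trans ?_
  rw [Finset.card_univ, Fintype.card_prod]
  gcongr
  refine (Fintype.card_subtype_le _).trans ?_
  simp

lemma star_lower (hT : Function.Injective T) (hTU : ∀ a, T a ⊆ U) {p : ℝ} (hp0 : 0 ≤ p) (hp1 : p ≤ 1)
    (M : Finset (ι → ℕ)) (h : (ι → ℕ) → ℝ) (hh : ∀ m, 0 ≤ h m) (H : Finset (Finset (Fin n)) → ℝ)
    (hH0 : ∀ F, 0 ≤ H F)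
    (hH : ∀ m ∈ M, ∀ e : (Σ a, Fin (m a)) ↪ {v : Fin n // v ∉ U}, h m ≤ H (starF T U m e)) :
    ∑ m ∈ M, h m * ((n - U.card).descFactorial (∑ a, m a) / (∏ a, ((m a).factorial : ℝ)) * p ^ (∑ a, m a)
      * (1 - p) ^ (Fintype.card ι * n)) ≤ Ew (starAll T U) p H := by
  have h1p : 0 ≤ 1 - p := by linarith
  set fam : (ι → ℕ) → Finset (Finset (Finset (Fin n))) := fun m => Finset.univ.image (starF T U m) with hfam
  have hdisj : ∀ m ∈ M, ∀ m' ∈ M, m ≠ m' → Disjoint (fam m) (fam m') := by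
    intro m _ m' _ hne
    rw [Finset.disjoint_left]
    intro F hF hF'
    simp only [hfam, Finset.mem_image, Finset.mem_univ, true_and] at hF hF'
    obtain ⟨e, rfl⟩ := hF
    obtain ⟨e', he'⟩ := hF'
    apply hne
    funext a
    rw [← nbF_card hT hTU m e a, ← he', nbF_card hT hTU m' e' a]
  have hsub : M.biUnion fam ⊆ (starAll T U).powerset := by
    intro F hF
    obtain ⟨m, _, hF⟩ := Finset.mem_biUnion.1 hF
    simp only [hfam, Finset.mem_image, Finset.mem_univ, true_and] at hF
    obtain ⟨e, rfl⟩ := hF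
    exact Finset.mem_powerset.2 (starF_subset m e)
  unfold Ew
  refine le_trans ?_ (Finset.sum_le_sum_of_subset_of_nonneg hsub (fun F _ _ => by
    have := hH0 F
    positivity))
  rw [Finset.sum_biUnion hdisj]
  refine Finset.sum_le_sum fun m hm => ?_
  have hcount := starF_count hT hTU m
  have hfac : (0:ℝ) < ∏ a, ((m a).factorial : ℝ) := Finset.prod_pos fun a _ => by positivity
  have hc2 : ((n - U.card).descFactorial (∑ a, m a) / (∏ a, ((m a).factorial : ℝ)) : ℝ) ≤ (fam m).card := by
    rw [div_le_iff₀ hfac]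
    have : (((n - U.card).descFactorial (∑ a, m a) : ℕ) : ℝ) ≤ (((∏ a, (m a).factorial) *
      (Finset.univ.image (starF T U m)).card : ℕ) : ℝ) := by exact_mod_cast hcount
    push_cast at this
    rw [mul_comm]
    exact this
  have hterm : ∀ F ∈ fam m, h m * (p ^ (∑ a, m a) * (1 - p) ^ (Fintype.card ι * n)) ≤
      p ^ F.card * (1 - p) ^ ((starAll T U).card - F.card) * H F := by
    intro F hF
    simp only [hfam, Finset.mem_image, Finset.mem_univ, true_and] at hF
    obtain ⟨e, rfl⟩ := hF
    rw [starF_card hT hTU, mul_comm]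
    have hm1 : (1 - p) ^ (Fintype.card ι * n) ≤ (1 - p) ^ ((starAll T U).card - ∑ a, m a) := by
      apply pow_le_pow_of_le_one h1p (by linarith)
      exact (Nat.sub_le _ _).trans starAll_card_le
    have := hH m hm e
    have := hh m
    gcongr
  calc _ = ((n - U.card).descFactorial (∑ a, m a) / (∏ a, ((m a).factorial : ℝ)) : ℝ) *
        (h m * (p ^ (∑ a, m a) * (1 - p) ^ (Fintype.card ι * n))) := by ring
    _ ≤ (fam m).card * (h m * (p ^ (∑ a, m a) * (1 - p) ^ (Fintype.card ι * n))) := by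
        have := hh m
        gcongr
    _ ≤ _ := by
        rw [← nsmul_eq_mul]
        exact Finset.card_nsmul_le_sum _ _ _ hterm

end star

lemma weight_tendsto (c : ℝ) (hc : 0 < c) (s t r : ℕ) :
    Tendsto (fun n : ℕ => ((n - s).descFactorial t : ℝ) * (c / n) ^ t * (1 - c / n) ^ (r * n)) atTop
      (nhds (c ^ t * Real.exp (-c) ^ r)) := by
  have h1 : Tendsto (fun n : ℕ => (1 - c / n) ^ (r * n)) atTop (nhds (Real.exp (-c) ^ r)) := by
    have := (Real.tendsto_one_add_div_pow_exp (-c)).pow r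
    refine this.congr fun n => ?_
    rw [← pow_mul, mul_comm n r]
    congr 1; ring
  have h2 : Tendsto (fun n : ℕ => ((n - s).descFactorial t : ℝ) * (c / n) ^ t) atTop (nhds (c ^ t)) := by
    have h3 : ∀ n : ℕ, s + t ≤ n → ((n - s).descFactorial t : ℝ) * (c / n) ^ t = ∏ i ∈ Finset.range t, (c - (s + i) * (c / n)) := by
      intro n hn
      rcases Nat.eq_zero_or_pos n with h0 | h0
      · have : t = 0 := by omega
        subst this; simp
      rw [Nat.descFactorial_eq_prod_range]
      push_cast
      have hpc : (c / n) ^ t = ∏ _i ∈ Finset.range t, (c / (n:ℝ)) := by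
        rw [Finset.prod_const, Finset.card_range]
      rw [hpc, ← Finset.prod_mul_distrib]
      refine Finset.prod_congr rfl fun i hi => ?_
      have hi := Finset.mem_range.1 hi
      rw [Nat.cast_sub (by omega), Nat.cast_sub (by omega)]
      have : (n:ℝ) ≠ 0 := by positivity
      field_simp
      ring
    have h4 : Tendsto (fun n : ℕ => ∏ i ∈ Finset.range t, (c - (s + i) * (c / n))) atTop (nhds (∏ i ∈ Finset.range t, (c - (s + i) * 0))) := by
      refine tendsto_finsetProd _ fun i _ => ?_
      exact tendsto_const_nhds.sub ((tendsto_const_nhds).mul (tendsto_const_div_atTop_nhds_zero_nat c))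
    simp only [mul_zero, sub_zero, Finset.prod_const, Finset.card_range] at h4
    refine h4.congr' ?_
    filter_upwards [eventually_ge_atTop (s + t)] with n hn
    rw [h3 n hn]
  exact h2.mul h1

end Part8

section Part9
/-! ## Part D3: the local lower bound -/

def RelF {n : ℕ} (d : ℕ) {ι : Type} (T : ι → Finset (Fin n)) (U : Finset (Fin n)) :
    Finset (Finset (Fin n)) :=
  (allFaces n d).filter (fun σ => ¬ σ ⊆ U ∧ ∃ a, σ ∩ U ⊆ T a)

def childT {n d : ℕ} {ι : Type} (T : ι → Finset (Fin n)) (U : Finset (Fin n)) (u : ι → Fin d → Fin n) (m : ι → ℕ)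
    (e : (Σ a, Fin (m a)) ↪ {v : Fin n // v ∉ U}) (z : Σ a, Fin (m a) × Fin d) : Finset (Fin n) :=
  (insert (e ⟨z.1, z.2.1⟩ : Fin n) (T z.1)).erase (u z.1 z.2.2)

section child
variable {n d : ℕ} {ι : Type} {T : ι → Finset (Fin n)} {U : Finset (Fin n)}
  {u : ι → Fin d → Fin n} {m : ι → ℕ} {e : (Σ a, Fin (m a)) ↪ {v : Fin n // v ∉ U}}

lemma u_mem (hui : ∀ a, Finset.univ.image (u a) = T a) (a : ι) (i : Fin d) : u a i ∈ T a := by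
  rw [← hui a]; exact Finset.mem_image_of_mem _ (Finset.mem_univ _)

lemma childT_inter (hTU : ∀ a, T a ⊆ U) (z) :
    childT T U u m e z ∩ U = (T z.1).erase (u z.1 z.2.2) := by
  unfold childT
  rw [Finset.erase_inter, Finset.insert_inter_of_notMem (e ⟨z.1, z.2.1⟩).2, Finset.inter_eq_left.2 (hTU _)]

lemma childT_mem (hTU : ∀ a, T a ⊆ U) (hui : ∀ a, Finset.univ.image (u a) = T a) (z) :
    (e ⟨z.1, z.2.1⟩ : Fin n) ∈ childT T U u m e z := by
  unfold childT
  refine Finset.mem_erase.2 ⟨fun h => ?_, Finset.mem_insert_self _ _⟩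
  exact (e ⟨z.1, z.2.1⟩).2 (h ▸ hTU _ (u_mem hui _ _))

lemma childT_inj (hTU : ∀ a, T a ⊆ U) (hu : ∀ a, Function.Injective (u a))
    (hui : ∀ a, Finset.univ.image (u a) = T a) : Function.Injective (childT T U u m e) := by
  intro z z' h
  have h1 : (e ⟨z.1, z.2.1⟩ : Fin n) = e ⟨z'.1, z'.2.1⟩ := by
    have h2 := childT_mem hTU hui (e := e) (m := m) z
    rw [h] at h2
    have h3 := Finset.mem_of_mem_erase h2
    rcases Finset.mem_insert.1 h3 with h4 | h4
    · exact h4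
    · exact absurd (hTU _ h4) (e ⟨z.1, z.2.1⟩).2
  have h1 := e.injective (Subtype.ext h1)
  obtain ⟨a, j, i⟩ := z
  obtain ⟨a', j', i'⟩ := z'
  simp only [Sigma.mk.injEq] at h1
  obtain ⟨rfl, h1⟩ := h1
  have h1 := eq_of_heq h1
  subst h1
  have h5 := congrArg (fun s => s ∩ U) h
  simp only [childT_inter hTU] at h5
  by_cases hii : i = i'
  · rw [hii]
  · exfalso
    have h6 : u a i' ∈ (T a).erase (u a i) :=
      Finset.mem_erase.2 ⟨fun h => hii (hu a h).symm, u_mem hui _ _⟩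
    rw [h5] at h6
    simp at h6

lemma childT_card (hTd : ∀ a, (T a).card = d) (hTU : ∀ a, T a ⊆ U)
    (hui : ∀ a, Finset.univ.image (u a) = T a) (z) : (childT T U u m e z).card = d := by
  unfold childT
  rw [Finset.card_erase_of_mem (Finset.mem_insert_of_mem (u_mem hui _ _)),
    Finset.card_insert_of_notMem (fun h => (e ⟨z.1, z.2.1⟩).2 (hTU _ h)), hTd]
  simp

lemma child_rel [Fintype ι] (hTd : ∀ a, (T a).card = d) (hTU : ∀ a, T a ⊆ U)
    (hui : ∀ a, Finset.univ.image (u a) = T a) {U' : Finset (Fin n)} (hUU : U ⊆ U')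
    {B : Finset (Finset (Fin n))} (hB : RelF d T U ⊆ B) :
    RelF d (childT T U u m e) U' ⊆ B \ starAll T U := by
  intro σ hσ
  simp only [RelF, Finset.mem_filter] at hσ
  obtain ⟨h1, h2, z, h3⟩ := hσ
  have h4 : σ ∩ U ⊆ (T z.1).erase (u z.1 z.2.2) := by
    rw [← childT_inter (e := e) hTU]
    refine Finset.subset_inter ?_ Finset.inter_subset_right
    exact (Finset.inter_subset_inter_left hUU).trans h3
  rw [Finset.mem_sdiff]
  constructor
  · apply hB
    simp only [RelF, Finset.mem_filter]
    exact ⟨h1, fun h => h2 (h.trans hUU), z.1, h4.trans (Finset.erase_subset _ _)⟩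
  · intro h
    simp only [starAll, Finset.mem_image, Finset.mem_univ, true_and] at h
    obtain ⟨⟨b, v⟩, rfl⟩ := h
    simp only at h4
    rw [insert_inter_U hTU b v v.2] at h4
    have := Finset.card_le_card h4
    rw [Finset.card_erase_of_mem (u_mem hui _ _), hTd, hTd] at this
    have h5 := Finset.card_pos.2 ⟨_, u_mem hui z.1 z.2.2⟩
    rw [hTd] at h5
    omega

lemma star_rel [Fintype ι] (hTd : ∀ a, (T a).card = d) (hTU : ∀ a, T a ⊆ U)
    {B : Finset (Finset (Fin n))} (hB : RelF d T U ⊆ B) : starAll T U ⊆ B := by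
  intro σ h
  apply hB
  simp only [starAll, Finset.mem_image, Finset.mem_univ, true_and] at h
  obtain ⟨⟨b, v⟩, rfl⟩ := h
  simp only [RelF, Finset.mem_filter, mem_allFaces]
  refine ⟨?_, fun h => v.2 (h (Finset.mem_insert_self _ _)), b, ?_⟩
  · rw [Finset.card_insert_of_notMem (fun h => v.2 (hTU _ h)), hTd]
  · rw [insert_inter_U hTU b v v.2]

end child

open MeasureTheory ProbabilityTheory in
lemma exists_finset_sum_ge {β : Type*} (f : β → ENNReal) (hf : ∑' b, f b ≠ ⊤) (θ : ℝ) (h0 : 0 ≤ θ) (h1 : θ < 1) :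
    ∃ M : Finset β, ENNReal.ofReal θ * ∑' b, f b ≤ ∑ b ∈ M, f b := by
  by_cases hz : ∑' b, f b = 0
  · exact ⟨∅, by simp [hz]⟩
  have hlt : ENNReal.ofReal θ * ∑' b, f b < ∑' b, f b := by
    conv_rhs => rw [← one_mul (∑' b, f b)]
    exact ENNReal.mul_lt_mul_left hz hf (by simpa using h1)
  have := (ENNReal.summable (f := f)).hasSum.eventually (lt_mem_nhds hlt)
  obtain ⟨M, hM⟩ := this.exists
  exact ⟨M, hM.le⟩

open MeasureTheory ProbabilityTheory in
lemma local_claim (c : NNReal) (hc : 0 < c) (d : ℕ) (hd : 1 ≤ d) (k : ℕ) :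
    ∀ (ι : Type) [Fintype ι] (G : (ι → ENNReal) → ENNReal), Measurable G → (∀ x, G x ≤ 1) →
    ∀ (s : ℕ) (θ : ℝ), 0 < θ → θ < 1 → ∀ᶠ n : ℕ in atTop, ∀ (T : ι → Finset (Fin n)) (U : Finset (Fin n))
      (B : Finset (Finset (Fin n))) (Γ : Finset (Finset (Fin n)) → ℝ), Function.Injective T →
      (∀ a, (T a).card = d) → (∀ a, T a ⊆ U) → U.card ≤ s → RelF d T U ⊆ B → (∀ F, 0 ≤ Γ F) →
      (∀ F, F ⊆ B → ∀ x, Res F T U x → G x ≤ ENNReal.ofReal (Γ F)) →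
      ENNReal.ofReal θ * ∫⁻ x, G x ∂(Measure.pi (fun _ : ι => muk c d k)) ≤ ENNReal.ofReal (Ew B (c / n) Γ) := by
  have hpev : ∀ᶠ n : ℕ in atTop, (c:ℝ) / n ≤ 1 := by
    filter_upwards [eventually_ge_atTop (⌈(c:ℝ)⌉₊ + 1)] with n hn
    have : (0:ℝ) < n := by exact_mod_cast (by omega : 0 < n)
    rw [div_le_one this]
    exact (Nat.le_ceil _).trans (by exact_mod_cast (by omega : ⌈(c:ℝ)⌉₊ ≤ n))
  induction k with
  | zero =>
    intro ι _ G hG hG1 s θ hθ0 hθ1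
    filter_upwards [hpev] with n hp1 T U B Γ hT hTd hTU hUs hB hΓ0 hΓ
    have hp0 : (0:ℝ) ≤ c / n := by positivity
    have h1 : ∫⁻ x, G x ∂(Measure.pi (fun _ : ι => muk c d 0)) = G (fun _ => 1) := by
      have : Measure.pi (fun _ : ι => muk c d 0) = Measure.dirac (fun _ => 1) := by
        simp_rw [muk_zero]
        refine Measure.pi_eq fun s hs => ?_
        rw [Measure.dirac_apply' _ (MeasurableSet.univ_pi hs)]
        simp_rw [Measure.dirac_apply' _ (hs _)]
        by_cases h : (fun _ : ι => (1:ENNReal)) ∈ Set.pi Set.univ s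
        · rw [Set.indicator_of_mem h]
          rw [Finset.prod_eq_one]
          · rfl
          · intro i _
            rw [Set.indicator_of_mem (h i trivial)]; rfl
        · rw [Set.indicator_of_notMem h]
          simp only [Set.mem_pi, Set.mem_univ, true_imp_iff, not_forall] at h
          obtain ⟨i, hi⟩ := h
          rw [Finset.prod_eq_zero (Finset.mem_univ i)]
          rw [Set.indicator_of_notMem hi]
      rw [this, lintegral_dirac' _ hG]
    rw [h1]
    have hGt : G (fun _ => 1) ≠ ⊤ := ne_top_of_le_ne_top (by simp) (hG1 _)
    calc _ ≤ 1 * G (fun _ => 1) := by gcongr; simpa using hθ1.le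
      _ = ENNReal.ofReal (Ew B (c / n) (fun _ => (G (fun _ => 1)).toReal)) := by
        rw [Ew_const, ENNReal.ofReal_toReal hGt, one_mul]
      _ ≤ _ := by
        apply ENNReal.ofReal_le_ofReal
        refine Ew_mono hp0 hp1 fun F hF => ?_
        exact ENNReal.toReal_le_of_le_ofReal (hΓ0 F) (hΓ F hF _ (Res_zero F T hT U))
  | succ k ih =>
    intro ι _ G hG hG1 s θ hθ0 hθ1
    -- choose θ1
    obtain ⟨θ1, h10, h11, h13⟩ : ∃ θ1 : ℝ, 0 < θ1 ∧ θ1 < 1 ∧ θ ≤ θ1 ^ 3 := by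
      have : Tendsto (fun x : ℝ => x ^ 3) (nhdsWithin 1 (Set.Iio 1)) (nhds (1 ^ 3)) :=
        ((continuous_pow 3).tendsto 1).mono_left nhdsWithin_le_nhds
      rw [one_pow] at this
      have h2 := this.eventually (lt_mem_nhds hθ1)
      have h3 : ∀ᶠ x : ℝ in nhdsWithin 1 (Set.Iio 1), x ∈ Set.Ioo (0:ℝ) 1 := Ioo_mem_nhdsLT one_pos
      obtain ⟨x, hx1, hx2⟩ := (h2.and h3).exists
      exact ⟨x, hx2.1, hx2.2, hx1.le⟩
    have hPhi : ∫⁻ x, G x ∂(Measure.pi (fun _ : ι => muk c d (k+1))) =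
        ∑' m : ι → ℕ, (∏ a, poissonMeasure c {m a}) *
        ∫⁻ x, G (Psi d m x) ∂(Measure.pi (fun _ : (Σ a : ι, Fin (m a) × Fin d) => muk c d k)) := by
      simp_rw [muk_succ]
      exact lintegral_pi_Phi c d (muk c d k) G hG
    set I : (ι → ℕ) → ENNReal := fun m =>
      ∫⁻ x, G (Psi d m x) ∂(Measure.pi (fun _ : (Σ a : ι, Fin (m a) × Fin d) => muk c d k)) with hI
    have hI1 : ∀ m, I m ≤ 1 := by
      intro m
      calc I m ≤ ∫⁻ x, 1 ∂(Measure.pi (fun _ : (Σ a : ι, Fin (m a) × Fin d) => muk c d k)) :=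
            lintegral_mono fun x => hG1 _
        _ = 1 := by simp
    have hItop : ∀ m, I m ≠ ⊤ := fun m => ne_top_of_le_ne_top (by simp) (hI1 m)
    have htot : ∫⁻ x, G x ∂(Measure.pi (fun _ : ι => muk c d (k+1))) ≤ 1 := by
      calc _ ≤ ∫⁻ x, 1 ∂(Measure.pi (fun _ : ι => muk c d (k+1))) :=
            lintegral_mono fun x => hG1 _
        _ = 1 := by simp
    obtain ⟨M, hM⟩ := exists_finset_sum_ge (fun m : ι → ℕ => (∏ a, poissonMeasure c {m a}) * I m)
      (by rw [← hPhi]; exact ne_top_of_le_ne_top (by simp) htot) θ1 h10.le h11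
    rw [← hPhi] at hM
    -- weights
    have hpois : ∀ m : ι → ℕ, (∏ a, poissonMeasure c {m a}) =
        ENNReal.ofReal ((c:ℝ) ^ (∑ a, m a) * Real.exp (-c) ^ (Fintype.card ι) / ∏ a, ((m a).factorial : ℝ)) := by
      intro m
      simp_rw [poissonMeasure_singleton]
      rw [← ENNReal.ofReal_prod_of_nonneg (fun a _ => by positivity)]
      congr 1
      rw [Finset.prod_div_distrib, Finset.prod_mul_distrib, Finset.prod_pow_eq_pow_sum, Finset.prod_const, Finset.card_univ]
      ring
    have hw : ∀ m ∈ M, ∀ᶠ n : ℕ in atTop, θ1 * ((c:ℝ) ^ (∑ a, m a) * Real.exp (-c) ^ (Fintype.card ι)) ≤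
        ((n - s).descFactorial (∑ a, m a) : ℝ) * (c / n) ^ (∑ a, m a) * (1 - c / n) ^ (Fintype.card ι * n) := by
      intro m _
      have hpos : 0 < (c:ℝ) ^ (∑ a, m a) * Real.exp (-c) ^ (Fintype.card ι) := by
        have : 0 < (c:ℝ) := hc
        positivity
      have := (weight_tendsto c hc s (∑ a, m a) (Fintype.card ι)).eventually
        (lt_mem_nhds (a := θ1 * ((c:ℝ) ^ (∑ a, m a) * Real.exp (-c) ^ (Fintype.card ι))) (by nlinarith))
      filter_upwards [this] with n hn using hn.le
    have hw' := (Filter.eventually_all_finset M).2 hw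
    have hih := fun (m : ι → ℕ) (_ : m ∈ M) =>
      ih (Σ a : ι, Fin (m a) × Fin d) (fun x => G (Psi d m x)) (hG.comp (measurable_Psi d m))
        (fun x => hG1 _) (s + ∑ a, m a) θ1 h10 h11
    have hih' := (Filter.eventually_all_finset M).2 hih
    filter_upwards [hpev, hw', hih'] with n hp1 hwn hihn T U B Γ hT hTd hTU hUs hB hΓ0 hΓ
    have hp0 : (0:ℝ) ≤ c / n := by positivity
    have h1p : (0:ℝ) ≤ 1 - c / n := by linarith
    set u : ι → Fin d → Fin n := fun a => (T a).orderEmbOfFin (hTd a) with hudef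
    have hu : ∀ a, Function.Injective (u a) := fun a => ((T a).orderEmbOfFin (hTd a)).injective
    have hui : ∀ a, Finset.univ.image (u a) = T a := fun a => by
      simp [hudef]
    have hEw : Ew B (c / n) Γ = Ew (starAll T U) (c / n) (fun F1 => Ew (B \ starAll T U) (c / n) (fun F2 => Γ (F1 ∪ F2))) := by
      have h := Ew_union (p := (c:ℝ) / n) (g := Γ) (Finset.disjoint_sdiff (s := starAll T U) (t := B))
      have h2 := Finset.union_sdiff_of_subset (star_rel hTd hTU hB)
      have h3 : Ew B (c / n) Γ = Ew (starAll T U ∪ (B \ starAll T U)) (c / n) Γ := by rw [h2]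
      rw [h3]
      convert h
    have hkey := star_lower hT hTU hp0 hp1 M (fun m => θ1 * (I m).toReal) (fun m => by positivity)
      (fun F1 => Ew (B \ starAll T U) (c / n) (fun F2 => Γ (F1 ∪ F2)))
      (fun F1 => Ew_nonneg hp0 hp1 fun F2 _ => hΓ0 _) (by
        intro m hm e
        set U' := U ∪ Finset.univ.image (fun s => (e s : Fin n)) with hU'
        have h1 := hihn m hm (childT T U u m e) U' (B \ starAll T U) (fun F2 => Γ (starF T U m e ∪ F2))
          (childT_inj hTU hu hui) (childT_card hTd hTU hui)
          (by
            intro z v hv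
            have hv := Finset.mem_of_mem_erase hv
            rcases Finset.mem_insert.1 hv with h | h
            · exact Finset.mem_union_right _ (h ▸ Finset.mem_image_of_mem _ (Finset.mem_univ _))
            · exact Finset.mem_union_left _ (hTU _ h))
          (by
            refine (Finset.card_union_le _ _).trans (add_le_add hUs ?_)
            refine Finset.card_image_le.trans ?_
            simp)
          (child_rel hTd hTU hui Finset.subset_union_left hB)
          (fun F => hΓ0 _)
          (by
            intro F2 hF2 x hx
            refine hΓ _ ?_ _ ?_
            · refine Finset.union_subset ((starF_subset m e).trans (star_rel hTd hTU hB)) (hF2.trans Finset.sdiff_subset)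
            · exact Res_step hd hT hTU u hu hui m (fun s => (e s : Fin n))
                (fun a b h => e.injective (Subtype.ext h)) (fun s => (e s).2) (Finset.subset_union_left)
                (fun s => Finset.mem_image_of_mem _ (Finset.mem_univ s)) hx)
        have h2 : ENNReal.ofReal (θ1 * (I m).toReal) ≤ ENNReal.ofReal (Ew (B \ starAll T U) (c / n) (fun F2 => Γ (starF T U m e ∪ F2))) := by
          rw [ENNReal.ofReal_mul h10.le, ENNReal.ofReal_toReal (hItop m)]
          exact h1
        exact (ENNReal.ofReal_le_ofReal_iff (Ew_nonneg hp0 hp1 fun F2 _ => hΓ0 _)).1 h2)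
    rw [hEw]
    refine le_trans ?_ (ENNReal.ofReal_le_ofReal hkey)
    rw [ENNReal.ofReal_sum_of_nonneg (fun m _ => by positivity)]
    calc ENNReal.ofReal θ * ∫⁻ x, G x ∂(Measure.pi (fun _ : ι => muk c d (k+1)))
        ≤ ENNReal.ofReal (θ1 ^ 3) * ∫⁻ x, G x ∂(Measure.pi (fun _ : ι => muk c d (k+1))) := by
          gcongr
      _ = ENNReal.ofReal (θ1 ^ 2) * (ENNReal.ofReal θ1 * ∫⁻ x, G x ∂(Measure.pi (fun _ : ι => muk c d (k+1)))) := by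
          rw [← mul_assoc, ← ENNReal.ofReal_mul (by positivity)]
          congr 2
      _ ≤ ENNReal.ofReal (θ1 ^ 2) * ∑ m ∈ M, (∏ a, poissonMeasure c {m a}) * I m := by gcongr
      _ = ∑ m ∈ M, ENNReal.ofReal (θ1 ^ 2) * ((∏ a, poissonMeasure c {m a}) * I m) := by rw [Finset.mul_sum]
      _ ≤ _ := by
          refine Finset.sum_le_sum fun m hm => ?_
          rw [hpois]
          conv_lhs => rw [← ENNReal.ofReal_toReal (hItop m)]
          rw [← ENNReal.ofReal_mul (by positivity), ← ENNReal.ofReal_mul (by positivity)]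
          apply ENNReal.ofReal_le_ofReal
          have hfac : (0:ℝ) < ∏ a, ((m a).factorial : ℝ) := Finset.prod_pos fun a _ => by positivity
          have hdes : ((n - s).descFactorial (∑ a, m a) : ℝ) ≤ ((n - U.card).descFactorial (∑ a, m a) : ℝ) := by
            exact_mod_cast Nat.descFactorial_le _ (by omega)
          have h4 := hwn m hm
          have h5 : θ1 * ((c:ℝ) ^ (∑ a, m a) * Real.exp (-c) ^ (Fintype.card ι)) ≤
            ((n - U.card).descFactorial (∑ a, m a) : ℝ) * (c / n) ^ (∑ a, m a) * (1 - c / n) ^ (Fintype.card ι * n) := by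
            refine h4.trans ?_
            gcongr
          calc _ = (θ1 * (I m).toReal / (∏ a, ((m a).factorial : ℝ))) * (θ1 * ((c:ℝ) ^ (∑ a, m a) * Real.exp (-c) ^ (Fintype.card ι))) := by
                ring
            _ ≤ (θ1 * (I m).toReal / (∏ a, ((m a).factorial : ℝ))) * (((n - U.card).descFactorial (∑ a, m a) : ℝ) * (c / n) ^ (∑ a, m a) * (1 - c / n) ^ (Fintype.card ι * n)) := by
                gcongr
            _ = _ := by ring

end Part9

section Part10

lemma eventually_p_le_one (c : ℝ) : ∀ᶠ n : ℕ in atTop, c / n ≤ 1 := by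
  filter_upwards [eventually_ge_atTop (⌈c⌉₊ + 1)] with n hn
  have : (0:ℝ) < n := by exact_mod_cast (by omega : 0 < n)
  rw [div_le_one this]
  exact (Nat.le_ceil _).trans (by exact_mod_cast (by omega : ⌈c⌉₊ ≤ n))

open MeasureTheory ProbabilityTheory in
lemma muk_le_one_ae (c : NNReal) (d k : ℕ) : ∀ᵐ x ∂(muk c d k), x ≤ 1 := by
  unfold muk
  rw [ae_map_iff (measurable_Xk d k).aemeasurable measurableSet_Iic]
  exact Filter.Eventually.of_forall fun ω => Xk_le_one d k ω

open MeasureTheory ProbabilityTheory in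
lemma xF_exp (c : NNReal) (hc : 0 < c) (d : ℕ) (hd : 1 ≤ d) (k : ℕ) (ε : ℝ) (hε : 0 < ε) :
    ∀ᶠ n : ℕ in atTop, ∀ τ : Finset (Fin n), τ.card = d →
      Ew (allFaces n d) (c / n) (fun F => xF F τ) ≤ (∫⁻ x, x ∂(muk c d k)).toReal + ε := by
  set θ : ℝ := max (1 / 2) (1 - ε) with hθ
  have hθ0 : 0 < θ := lt_of_lt_of_le (by norm_num) (le_max_left _ _)
  have hθ1 : θ < 1 := max_lt (by norm_num) (by linarith)
  have hθ2 : 1 - ε ≤ θ := le_max_right _ _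
  have h := local_claim c hc d hd k Unit (fun x => 1 - x ()) (by fun_prop) (fun x => tsub_le_self) d θ hθ0 hθ1
  filter_upwards [h, eventually_p_le_one c] with n hn hp1 τ hτ
  have hp0 : (0:ℝ) ≤ c / n := by positivity
  have h1 := hn (fun _ => τ) τ (allFaces n d) (fun F => 1 - xF F τ) (fun a b _ => rfl) (fun _ => hτ) (fun _ => subset_rfl)
    hτ.le (fun σ hσ => by simp only [RelF, Finset.mem_filter] at hσ; exact hσ.1) (fun F => by linarith [xF_le_one F τ]) (by
      intro F _ x hx
      obtain ⟨r, hr1, hr2, -⟩ := hx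
      have h2 := xF_le F τ (hr1 ())
      rw [hr2 ()]
      have h3 : r () ⬝ᵥ r () = ∑ ρ, r () ρ ^ 2 := by
        simp [dotProduct, pow_two]
      rw [h3, ← ENNReal.ofReal_one, ← ENNReal.ofReal_sub _ (by positivity)]
      exact ENNReal.ofReal_le_ofReal (by linarith))
  have hle : ∫⁻ x, x ∂(muk c d k) ≤ 1 := by
    calc _ ≤ ∫⁻ _, 1 ∂(muk c d k) := lintegral_mono_ae (muk_le_one_ae c d k)
      _ = 1 := by simp
  have hne : ∫⁻ x, x ∂(muk c d k) ≠ ⊤ := ne_top_of_le_ne_top (by simp) hle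
  have h4 : ∫⁻ x, (1 - x ()) ∂(Measure.pi (fun _ : Unit => muk c d k)) = 1 - ∫⁻ x, x ∂(muk c d k) := by
    have hm := (measurePreserving_eval (fun _ : Unit => muk c d k) ())
    rw [hm.lintegral_comp (f := fun x => 1 - x) (by fun_prop)]
    rw [lintegral_sub (f := fun _ => 1) (g := fun x => x) measurable_id hne (muk_le_one_ae c d k)]
    simp
  rw [h4, Ew_sub, Ew_const] at h1
  rw [← ENNReal.ofReal_toReal hne, ← ENNReal.ofReal_one, ← ENNReal.ofReal_sub _ (by positivity),
    ← ENNReal.ofReal_mul hθ0.le] at h1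
  have hm1 : (∫⁻ x, x ∂(muk c d k)).toReal ≤ 1 := by
    have := ENNReal.toReal_mono (by simp) hle
    simpa using this
  have hm0 : 0 ≤ (∫⁻ x, x ∂(muk c d k)).toReal := by positivity
  have hE1 : Ew (allFaces n d) (c / n) (fun F => xF F τ) ≤ 1 := by
    rw [← Ew_const (allFaces n d) (c/n) 1]
    exact Ew_mono hp0 hp1 fun F _ => xF_le_one F τ
  rw [ENNReal.ofReal_le_ofReal_iff (by linarith)] at h1
  nlinarith

lemma Ew_card {α : Type*} (A : Finset α) (p : ℝ) : Ew A p (fun F => (F.card : ℝ)) = p * A.card := by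
  have : ∀ F, F ⊆ A → (F.card : ℝ) = ∑ a ∈ A, if {a} ⊆ F then 1 else 0 := by
    intro F hF
    rw [Finset.sum_boole]
    congr 2
    ext a
    simp only [Finset.mem_filter, Finset.singleton_subset_iff]
    exact ⟨fun h => ⟨hF h, h⟩, fun h => h.2⟩
  rw [Ew_congr this, Ew_sum]
  rw [Finset.sum_congr rfl fun a ha => Ew_subset (Finset.singleton_subset_iff.2 ha) p]
  simp [mul_comm]

lemma card_allFaces (n d : ℕ) : (allFaces n d).card = n.choose (d + 1) := by
  unfold allFaces
  have := Finset.card_powersetCard (d+1) (Finset.univ : Finset (Fin n))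
  rw [Finset.card_univ, Fintype.card_fin] at this
  rw [← this]
  congr 1
  ext; simp [Finset.mem_powersetCard]

lemma card_dsets (n d : ℕ) : (Finset.univ.filter (fun τ : Finset (Fin n) => τ.card = d)).card = n.choose d := by
  have := Finset.card_powersetCard d (Finset.univ : Finset (Fin n))
  rw [Finset.card_univ, Fintype.card_fin] at this
  rw [← this]
  congr 1
  ext; simp [Finset.mem_powersetCard]

open MeasureTheory ProbabilityTheory in
lemma dimKer_exp (c : NNReal) (hc : 0 < c) (d : ℕ) (hd : 1 ≤ d) (k : ℕ) (ε : ℝ) (hε : 0 < ε) :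
    ∀ᶠ n : ℕ in atTop, Ew (allFaces n d) (c / n) (fun F => (dimKer n F : ℝ)) ≤
      n.choose d * (c / ((d:ℝ) + 1) - 1 + (∫⁻ x, x ∂(muk c d k)).toReal + ε) := by
  filter_upwards [xF_exp c hc d hd k ε hε, eventually_p_le_one c, eventually_gt_atTop d] with n hn hp1 hnd
  have hp0 : (0:ℝ) ≤ c / n := by positivity
  refine (Ew_mono hp0 hp1 fun F _ => dimKer_le d F).trans ?_
  rw [Ew_add, Ew_sub, Ew_const, Ew_card, Ew_sum, card_allFaces]
  have h1 : ∑ τ ∈ Finset.univ.filter (fun τ : Finset (Fin n) => τ.card = d), Ew (allFaces n d) (c / n) (fun F => xF F τ)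
      ≤ n.choose d * ((∫⁻ x, x ∂(muk c d k)).toReal + ε) := by
    rw [← card_dsets n d, ← nsmul_eq_mul]
    exact Finset.sum_le_card_nsmul _ _ _ fun τ hτ => hn τ (Finset.mem_filter.1 hτ).2
  have h2 : (c:ℝ) / n * (n.choose (d+1)) ≤ n.choose d * (c / ((d:ℝ) + 1)) := by
    have h3 : (n.choose (d+1) : ℝ) * (d + 1) ≤ n.choose d * n := by
      have := Nat.choose_succ_right_eq n d
      have h5 : n.choose (d+1) * (d+1) ≤ n.choose d * n := by
        rw [this]; exact Nat.mul_le_mul_left _ (Nat.sub_le _ _)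
      exact_mod_cast h5
    have hn0 : (0:ℝ) < n := by exact_mod_cast (by omega : 0 < n)
    rw [div_mul_eq_mul_div, mul_div_assoc', div_le_div_iff₀ hn0 (by positivity)]
    nlinarith [c.coe_nonneg]
  linarith

open MeasureTheory ProbabilityTheory in
theorem dimKer_small (d : ℕ) (hd : 2 ≤ d) (c td : ℝ) (hc0 : 0 < c) (htd : td ∈ Set.Ioo (0:ℝ) 1)
    (hroot : ((d:ℝ)+1)*(1-td)+(1+d*td)*Real.log td = 0) (hc : c < -Real.log td/(1-td)^d) (ε : ℝ) (hε : 0 < ε) :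
    ∀ᶠ n : ℕ in atTop, Ew (allFaces n d) (c / n) (fun F => (dimKer n F : ℝ)) ≤ ε * n ^ d := by
  lift c to NNReal using hc0.le
  have hc0' : 0 < c := hc0
  have hk : ∀ k, 1 - c/((d:ℝ)+1) ≤ (∫⁻ x, x ∂(muk c d k)).toReal := by
    intro k
    refine le_of_forall_pos_le_add fun ε hε => ?_
    obtain ⟨n, h1, h2, h3⟩ := ((dimKer_exp c hc0' d (by omega) k ε hε).and ((eventually_p_le_one c).and (eventually_gt_atTop d))).exists
    have h4 : 0 ≤ Ew (allFaces n d) (c / n) (fun F => (dimKer n F : ℝ)) :=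
      Ew_nonneg (by positivity) h2 fun F _ => by positivity
    have h5 : (0:ℝ) < n.choose d := by exact_mod_cast Nat.choose_pos h3.le
    have := nonneg_of_mul_nonneg_right (h4.trans h1) h5
    linarith
  have hl := muk_limit d hd c td hc0 htd hroot hc hk
  obtain ⟨k, hk2⟩ := (hl.eventually (gt_mem_nhds (show 1 - c/((d:ℝ)+1) < 1 - c/((d:ℝ)+1) + ε / 2 by linarith))).exists
  filter_upwards [dimKer_exp c hc0' d (by omega) k (ε/2) (by positivity)] with n hn
  refine hn.trans ?_
  have h6 : (n.choose d : ℝ) ≤ n ^ d := by exact_mod_cast Nat.choose_le_pow n d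
  have h7 : (0:ℝ) ≤ n.choose d := by positivity
  nlinarith

end Part10

section Part11

def PathP {α V : Type*} (stp : α → V → α) (Sav : α → Finset V) (E : ℝ) : ℕ → α → ℕ → α → Prop
  | 0, K, s, Z => s = 0 ∧ Z = K
  | L+1, K, s, Z => ((Sav K).card : ℝ) ≤ E ∧ ∃ v, (v ∈ Sav K ∧ PathP stp Sav E L (stp K v) (s-1) Z) ∨
      (v ∉ Sav K ∧ PathP stp Sav E L (stp K v) s Z)

lemma PathP_mono {α V : Type*} (stp : α → V → α) (Sav : α → Finset V) (E : ℝ) (L : ℕ) :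
    ∀ (K : α) (s s' : ℕ) (Z : α), s' ≤ s → PathP stp Sav E L K s Z → PathP stp Sav E L K s' Z := by
  induction L with
  | zero => rintro K s s' Z h ⟨h1, h2⟩; exact ⟨by omega, h2⟩
  | succ L ih =>
    rintro K s s' Z h ⟨h1, v, h2 | h2⟩
    · exact ⟨h1, v, Or.inl ⟨h2.1, ih _ _ _ _ (by omega) h2.2⟩⟩
    · exact ⟨h1, v, Or.inr ⟨h2.1, ih _ _ _ _ h h2.2⟩⟩

lemma PathP_count {α V : Type*} [Fintype α] [Fintype V] (stp : α → V → α) (Sav : α → Finset V) (E y : ℝ)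
    (hE : 0 ≤ E) (hy : 1 ≤ y) (L : ℕ) : ∀ (K : α) (s : ℕ),
    ((Finset.univ.filter (fun Z => PathP stp Sav E L K s Z)).card : ℝ) ≤
      (y⁻¹) ^ s * (Fintype.card V + y * E) ^ L := by
  have hy0 : 0 < y := by linarith
  induction L with
  | zero =>
    intro K s
    by_cases hs : s = 0
    · subst hs
      simp only [PathP, true_and, pow_zero, mul_one]
      have : (Finset.univ.filter (fun Z => Z = K)).card ≤ 1 :=
        Finset.card_le_one.2 fun a ha b hb => by
          rw [Finset.mem_filter] at ha hb
          rw [ha.2, hb.2]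
      exact_mod_cast this
    · simp only [PathP, hs, false_and, Finset.filter_false, Finset.card_empty, Nat.cast_zero]
      positivity
  | succ L ih =>
    intro K s
    by_cases hK : ((Sav K).card : ℝ) ≤ E
    swap
    · simp only [PathP, hK, false_and, Finset.filter_false, Finset.card_empty, Nat.cast_zero]
      positivity
    set X := (Fintype.card V + y * E) ^ L with hX
    have hX0 : 0 ≤ X := by positivity
    have hsub : (Finset.univ.filter (fun Z => PathP stp Sav E (L+1) K s Z)) ⊆
        ((Sav K).biUnion fun v => Finset.univ.filter (fun Z => PathP stp Sav E L (stp K v) (s-1) Z)) ∪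
        ((Finset.univ : Finset V).biUnion fun v => Finset.univ.filter (fun Z => PathP stp Sav E L (stp K v) s Z)) := by
      intro Z hZ
      rw [Finset.mem_filter] at hZ
      obtain ⟨-, -, v, h | h⟩ := hZ
      · refine Finset.mem_union_left _ (Finset.mem_biUnion.2 ⟨v, h.1, ?_⟩)
        simpa using h.2
      · refine Finset.mem_union_right _ (Finset.mem_biUnion.2 ⟨v, Finset.mem_univ _, ?_⟩)
        simpa using h.2
    have h1 := (Finset.card_le_card hsub).trans (Finset.card_union_le _ _)
    have h2 : ((((Sav K).biUnion fun v => Finset.univ.filter (fun Z => PathP stp Sav E L (stp K v) (s-1) Z)).card : ℕ) : ℝ)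
        ≤ E * ((y⁻¹) ^ (s-1) * X) := by
      calc _ ≤ ((∑ v ∈ Sav K, (Finset.univ.filter (fun Z => PathP stp Sav E L (stp K v) (s-1) Z)).card : ℕ) : ℝ) := by
            exact_mod_cast Finset.card_biUnion_le
        _ ≤ ∑ v ∈ Sav K, ((y⁻¹) ^ (s-1) * X) := by
            push_cast
            exact Finset.sum_le_sum fun v _ => ih _ _
        _ = (Sav K).card * ((y⁻¹) ^ (s-1) * X) := by rw [Finset.sum_const, nsmul_eq_mul]
        _ ≤ _ := by gcongr
    have h3 : ((((Finset.univ : Finset V).biUnion fun v => Finset.univ.filter (fun Z => PathP stp Sav E L (stp K v) s Z)).card : ℕ) : ℝ)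
        ≤ Fintype.card V * ((y⁻¹) ^ s * X) := by
      calc _ ≤ ((∑ v : V, (Finset.univ.filter (fun Z => PathP stp Sav E L (stp K v) s Z)).card : ℕ) : ℝ) := by
            exact_mod_cast Finset.card_biUnion_le
        _ ≤ ∑ v : V, ((y⁻¹) ^ s * X) := by
            push_cast
            exact Finset.sum_le_sum fun v _ => ih _ _
        _ = _ := by rw [Finset.sum_const, nsmul_eq_mul, Finset.card_univ]
    have h4 : (y⁻¹) ^ (s-1) ≤ y * (y⁻¹) ^ s := by
      rcases Nat.eq_zero_or_pos s with rfl | hs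
      · simpa using hy
      · obtain ⟨t, rfl⟩ : ∃ t, s = t + 1 := ⟨s - 1, by omega⟩
        rw [pow_succ, Nat.add_sub_cancel]
        field_simp
        exact le_rfl
    calc _ ≤ E * ((y⁻¹) ^ (s-1) * X) + Fintype.card V * ((y⁻¹) ^ s * X) := by
          refine le_trans ?_ (add_le_add h2 h3)
          exact_mod_cast h1
      _ ≤ E * ((y * (y⁻¹) ^ s) * X) + Fintype.card V * ((y⁻¹) ^ s * X) := by gcongr
      _ = _ := by rw [pow_succ, ← hX]; ring

end Part11

section Part12

section pot
variable {n : ℕ}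

def degK (K : Finset (Finset (Fin n))) (τ : Finset (Fin n)) : ℕ := (K.filter (fun σ => τ ⊆ σ)).card

def minB (A : Finset (Finset (Fin n))) (B : Finset (Fin n)) : Prop := B ∈ A ∧ ∀ C ∈ A, C ⊆ B → C = B

def qA (A : Finset (Finset (Fin n))) (τ : Finset (Fin n)) : ℕ := (A.filter (fun B => B ⊆ τ ∧ minB A B)).card

def Wt (d q : ℕ) : ℤ := ((d:ℤ) + 2) ^ (2 ^ d - q)

def PhiK (d : ℕ) (A K : Finset (Finset (Fin n))) : ℤ :=
  ∑ τ ∈ Finset.univ.filter (fun τ : Finset (Fin n) => τ.card = d), if degK K τ = 1 then Wt d (qA A τ) else 0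

def SavF (d : ℕ) (A K : Finset (Finset (Fin n))) (τ : Finset (Fin n)) : Finset (Fin n) :=
  Finset.univ.filter (fun v => v ∉ τ ∧ ∃ ρ ⊆ τ, ρ ∉ A ∧ ((ρ.card + 2 ≤ d ∧ insert v ρ ∈ A) ∨
    (ρ.card + 1 = d ∧ 0 < degK K (insert v ρ))))

def rareT (A : Finset (Finset (Fin n))) (τ : Finset (Fin n)) : Prop :=
  ∃ B ⊆ τ, minB A B ∧ ∃ i ∈ B, τ.erase i ∈ A

lemma Wt_pos (d q : ℕ) : 1 ≤ Wt d q := by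
  unfold Wt; exact one_le_pow₀ (by omega)

lemma Wt_anti (d : ℕ) {q q' : ℕ} (h : q ≤ q') : Wt d q' ≤ Wt d q := by
  unfold Wt; exact pow_le_pow_right₀ (by omega) (by omega)

lemma Wt_step (d : ℕ) {q q' : ℕ} (h : q + 1 ≤ q') (h' : q' ≤ 2 ^ d) : ((d:ℤ)+2) * Wt d q' ≤ Wt d q := by
  unfold Wt
  rw [← pow_succ']; exact pow_le_pow_right₀ (by omega) (by omega)

lemma qA_le (A : Finset (Finset (Fin n))) (τ : Finset (Fin n)) : qA A τ ≤ 2 ^ τ.card := by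
  unfold qA
  rw [← Finset.card_powerset]
  apply Finset.card_le_card
  intro B hB
  rw [Finset.mem_filter] at hB
  exact Finset.mem_powerset.2 hB.2.1

lemma qA_mono (A : Finset (Finset (Fin n))) {τ τ' : Finset (Fin n)} (h : τ ⊆ τ') : qA A τ ≤ qA A τ' := by
  unfold qA
  apply Finset.card_le_card
  intro B hB
  rw [Finset.mem_filter] at *
  exact ⟨hB.1, hB.2.1.trans h, hB.2.2⟩

lemma exists_minB {A : Finset (Finset (Fin n))} {ρ : Finset (Fin n)} (h : ρ ∈ A) : ∃ B ⊆ ρ, minB A B := by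
  obtain ⟨B, hB, hmin⟩ := Finset.exists_min_image (A.filter (fun B => B ⊆ ρ)) Finset.card ⟨ρ, by simp [h]⟩
  rw [Finset.mem_filter] at hB
  refine ⟨B, hB.2, hB.1, fun C hC hCB => ?_⟩
  exact Finset.eq_of_subset_of_card_le hCB (hmin C (by rw [Finset.mem_filter]; exact ⟨hC, hCB.trans hB.2⟩))

lemma degK_insert {K : Finset (Finset (Fin n))} {σ : Finset (Fin n)} (hσ : σ ∉ K) (τ : Finset (Fin n)) :
    degK (insert σ K) τ = degK K τ + if τ ⊆ σ then 1 else 0 := by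
  unfold degK
  rw [Finset.filter_insert]
  split_ifs with h
  · rw [Finset.card_insert_of_notMem (by simp [hσ])]
  · rfl

def gK (d : ℕ) (A K : Finset (Finset (Fin n))) (τ : Finset (Fin n)) : ℤ :=
  if degK K τ = 0 then Wt d (qA A τ) else if degK K τ = 1 then - Wt d (qA A τ) else 0

lemma gK_ge (d : ℕ) (A K : Finset (Finset (Fin n))) (τ : Finset (Fin n)) : - Wt d (qA A τ) ≤ gK d A K τ := by
  have := Wt_pos d (qA A τ)
  unfold gK; split_ifs <;> omega

lemma PhiK_insert {d : ℕ} (A : Finset (Finset (Fin n))) {K : Finset (Finset (Fin n))} {τ : Finset (Fin n)} {v : Fin n}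
    (hτ : τ.card = d) (hv : v ∉ τ) (hσ : insert v τ ∉ K) :
    PhiK d A (insert (insert v τ) K) = PhiK d A K + gK d A K τ + ∑ u ∈ τ, gK d A K (insert v (τ.erase u)) := by
  set σ := insert v τ with hσd
  have h1 : PhiK d A (insert σ K) - PhiK d A K = ∑ τ' ∈ Finset.univ.filter (fun τ : Finset (Fin n) => τ.card = d),
      if τ' ⊆ σ then gK d A K τ' else 0 := by
    unfold PhiK
    rw [← Finset.sum_sub_distrib]
    refine Finset.sum_congr rfl fun τ' _ => ?_
    rw [degK_insert hσ]
    unfold gK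
    by_cases h : τ' ⊆ σ
    · simp only [h, if_true]
      by_cases h0 : degK K τ' = 0
      · simp [h0]
      · by_cases h2 : degK K τ' = 1
        · simp [h2]
        · simp [h0, h2]
    · simp [h]
  rw [← Finset.sum_filter] at h1
  have hc : σ.card = d + 1 := by rw [hσd, Finset.card_insert_of_notMem hv, hτ]
  have h2 : (Finset.univ.filter (fun τ : Finset (Fin n) => τ.card = d)).filter (fun τ' => τ' ⊆ σ) =
      σ.image (fun u => σ.erase u) := by
    ext τ'
    simp only [Finset.mem_filter, Finset.mem_univ, true_and, Finset.mem_image]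
    constructor
    · rintro ⟨h3, h4⟩
      obtain ⟨w, hw, e⟩ := exists_erase_of_subset h4 (by omega)
      exact ⟨w, hw, e.symm⟩
    · rintro ⟨w, hw, rfl⟩
      rw [Finset.card_erase_of_mem hw]
      exact ⟨by omega, Finset.erase_subset _ _⟩
  rw [h2, Finset.sum_image (by
    intro a ha b hb hab
    by_contra hne
    have : a ∈ σ.erase b := by simp [hne, Finset.mem_coe.1 ha]
    simp only at hab
    rw [← hab] at this; simp at this)] at h1
  rw [hσd, Finset.sum_insert hv, Finset.erase_insert hv] at h1
  have h3 : ∀ u ∈ τ, gK d A K ((insert v τ).erase u) = gK d A K (insert v (τ.erase u)) := by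
    intro u hu
    rw [Finset.erase_insert_of_ne (show v ≠ u from fun e => hv (e ▸ hu))]
  rw [Finset.sum_congr rfl h3] at h1
  linarith

lemma PhiK_ge {d : ℕ} (A : Finset (Finset (Fin n))) {K : Finset (Finset (Fin n))} {τ : Finset (Fin n)} {v : Fin n}
    (hτ : τ.card = d) (hv : v ∉ τ) (hσ : insert v τ ∉ K) :
    PhiK d A K ≤ PhiK d A (insert (insert v τ) K) + (d + 1) * Wt d 0 := by
  rw [PhiK_insert A hτ hv hσ]
  have h1 := gK_ge d A K τ
  have h2 : ∑ u ∈ τ, (- Wt d 0) ≤ ∑ u ∈ τ, gK d A K (insert v (τ.erase u)) :=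
    Finset.sum_le_sum fun u _ => le_trans (neg_le_neg (Wt_anti d (Nat.zero_le _))) (gK_ge d A K _)
  rw [Finset.sum_const, hτ, nsmul_eq_mul] at h2
  have h3 := Wt_anti d (Nat.zero_le (qA A τ))
  linarith

lemma PhiK_step {d : ℕ} (hd : 2 ≤ d) {A : Finset (Finset (Fin n))} (hA0 : ∅ ∉ A) (hA : ∀ B ∈ A, B.card + 1 ≤ d)
    {K : Finset (Finset (Fin n))} {τ : Finset (Fin n)} {v : Fin n}
    (hτ : τ.card = d) (hv : v ∉ τ) (hσ : insert v τ ∉ K) (hdeg : degK K τ = 1)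
    (hsav : v ∉ SavF d A K τ) (hrare : ¬ rareT A τ) :
    PhiK d A K + 1 ≤ PhiK d A (insert (insert v τ) K) := by
  have hsav' : ∀ ρ ⊆ τ, ρ ∉ A → ¬ ((ρ.card + 2 ≤ d ∧ insert v ρ ∈ A) ∨
    (ρ.card + 1 = d ∧ 0 < degK K (insert v ρ))) := by
    intro ρ h1 h2 h3
    exact hsav (by unfold SavF; rw [Finset.mem_filter]; exact ⟨Finset.mem_univ _, hv, ρ, h1, h2, h3⟩)
  rw [PhiK_insert A hτ hv hσ]
  have hg0 : gK d A K τ = - Wt d (qA A τ) := by unfold gK; simp [hdeg]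
  have hq : ∀ u ∈ τ, qA A (insert v (τ.erase u)) = qA A (τ.erase u) := by
    intro u hu
    unfold qA
    congr 1
    ext B
    simp only [Finset.mem_filter]
    constructor
    · rintro ⟨h1, h2, h3⟩
      refine ⟨h1, ?_, h3⟩
      by_cases hvB : v ∈ B
      · exfalso
        have h5 : B.erase v ⊆ τ := by
          intro x hx
          rw [Finset.mem_erase] at hx
          rcases Finset.mem_insert.1 (h2 hx.2) with h | h
          · exact absurd h hx.1
          · exact Finset.mem_of_mem_erase h
        have h6 : B.erase v ∉ A := by
          intro h
          have := h3.2 _ h (Finset.erase_subset _ _)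
          rw [Finset.erase_eq_self] at this
          exact this hvB
        refine hsav' _ h5 h6 (Or.inl ⟨?_, ?_⟩)
        · have := hA B h1
          have h7 := Finset.card_pos.2 ⟨v, hvB⟩
          rw [Finset.card_erase_of_mem hvB]; omega
        · rwa [Finset.insert_erase hvB]
      · exact (Finset.subset_insert_iff_of_notMem hvB).1 h2
    · rintro ⟨h1, h2, h3⟩
      exact ⟨h1, h2.trans (Finset.subset_insert _ _), h3⟩
  have hgood : ∀ u ∈ τ, τ.erase u ∉ A → gK d A K (insert v (τ.erase u)) = Wt d (qA A (τ.erase u)) := by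
    intro u hu hn
    have h1 := hsav' _ (Finset.erase_subset u τ) hn
    push Not at h1
    have h2 := h1.2 (by rw [Finset.card_erase_of_mem hu]; omega)
    unfold gK
    rw [if_pos (by omega), hq u hu]
  set w := Wt d (qA A τ) with hw
  have hw1 : 1 ≤ w := Wt_pos _ _
  have hd' : (2:ℤ) ≤ d := by exact_mod_cast hd
  by_cases hcase : ∀ u ∈ τ, τ.erase u ∉ A
  · have h1 : ∑ u ∈ τ, w ≤ ∑ u ∈ τ, gK d A K (insert v (τ.erase u)) := by
      refine Finset.sum_le_sum fun u hu => ?_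
      rw [hgood u hu (hcase u hu)]
      exact Wt_anti d (qA_mono A (Finset.erase_subset _ _))
    rw [Finset.sum_const, hτ, nsmul_eq_mul] at h1
    nlinarith
  · push Not at hcase
    obtain ⟨u0, hu0, hu0A⟩ := hcase
    obtain ⟨B, hB, hBmin⟩ := exists_minB hu0A
    have hBτ : B ⊆ τ := hB.trans (Finset.erase_subset _ _)
    obtain ⟨i, hi⟩ : B.Nonempty := Finset.nonempty_iff_ne_empty.2 fun e => hA0 (e ▸ hBmin.1)
    have hiA : τ.erase i ∉ A := fun h => hrare ⟨B, hBτ, hBmin, i, hi, h⟩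
    have hiq : qA A (τ.erase i) + 1 ≤ qA A τ := by
      unfold qA
      apply Finset.card_lt_card
      refine Finset.ssubset_iff_subset_ne.2 ⟨?_, ?_⟩
      · intro C hC
        rw [Finset.mem_filter] at *
        exact ⟨hC.1, hC.2.1.trans (Finset.erase_subset _ _), hC.2.2⟩
      · intro e
        have : B ∈ A.filter (fun B => B ⊆ τ ∧ minB A B) := by
          rw [Finset.mem_filter]; exact ⟨hBmin.1, hBτ, hBmin⟩
        rw [← e, Finset.mem_filter] at this
        have := this.2.1 hi
        simp at this
    have h3 : ((d:ℤ)+2) * w ≤ gK d A K (insert v (τ.erase i)) := by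
      rw [hgood i (hBτ hi) hiA]
      exact Wt_step d hiq (by have := qA_le A τ; rwa [hτ] at this)
    have h4 : ∀ u ∈ τ, - w ≤ gK d A K (insert v (τ.erase u)) := by
      intro u hu
      by_cases huA : τ.erase u ∈ A
      · have h5 : qA A τ = qA A (τ.erase u) := by
          unfold qA
          congr 1
          ext C
          simp only [Finset.mem_filter]
          constructor
          · rintro ⟨k1, k2, k3⟩
            refine ⟨k1, ?_, k3⟩
            rw [Finset.subset_erase]
            exact ⟨k2, fun h => hrare ⟨C, k2, k3, u, h, huA⟩⟩
          · rintro ⟨k1, k2, k3⟩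
            exact ⟨k1, k2.trans (Finset.erase_subset _ _), k3⟩
        have := gK_ge d A K (insert v (τ.erase u))
        rw [hq u hu, ← h5] at this
        exact this
      · rw [hgood u hu huA]
        have := Wt_pos d (qA A (τ.erase u))
        linarith
    rw [← Finset.add_sum_erase _ _ (hBτ hi)]
    have h5 : ∑ u ∈ τ.erase i, (-w) ≤ ∑ u ∈ τ.erase i, gK d A K (insert v (τ.erase u)) :=
      Finset.sum_le_sum fun u hu => h4 u (Finset.mem_of_mem_erase hu)
    rw [Finset.sum_const, Finset.card_erase_of_mem (hBτ hi), hτ, nsmul_eq_mul] at h5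
    have h6 : ((d - 1 : ℕ) : ℤ) = d - 1 := by push_cast [show 1 ≤ d by omega]; ring
    rw [h6] at h5
    nlinarith
end pot

end Part12

section Part13

section pot2
variable {n : ℕ}

def selT (d : ℕ) (K : Finset (Finset (Fin n))) : Finset (Fin n) :=
  if h : ∃ τ : Finset (Fin n), τ.card = d ∧ degK K τ = 1 then Classical.choose h else ∅

lemma selT_spec {d : ℕ} {K : Finset (Finset (Fin n))} (h : ∃ τ : Finset (Fin n), τ.card = d ∧ degK K τ = 1) :
    (selT d K).card = d ∧ degK K (selT d K) = 1 := by
  unfold selT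
  rw [dif_pos h]
  exact Classical.choose_spec h

def stpF (d : ℕ) (K : Finset (Finset (Fin n))) (v : Fin n) : Finset (Finset (Fin n)) :=
  insert (insert v (selT d K)) K

def RK (d : ℕ) (A K : Finset (Finset (Fin n))) : ℕ :=
  (Finset.univ.filter (fun τ : Finset (Fin n) => τ.card = d ∧ rareT A τ ∧ degK K τ ≤ 1)).card

def minCore (d : ℕ) (Z : Finset (Finset (Fin n))) : Prop :=
  isCore d Z ∧ ∀ K ⊆ Z, isCore d K → K = Z

lemma degK_mono {K K' : Finset (Finset (Fin n))} (h : K ⊆ K') (τ : Finset (Fin n)) : degK K τ ≤ degK K' τ :=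
  Finset.card_le_card (Finset.filter_subset_filter _ h)

def C1d (d : ℕ) : ℕ := 1 + (d + 1) * (d + 2) ^ (2 ^ d)

lemma C1d_eq (d : ℕ) : (C1d d : ℤ) = 1 + (d + 1) * Wt d 0 := by
  unfold C1d Wt; push_cast; simp

lemma path_exists {d : ℕ} (hd : 2 ≤ d) {A : Finset (Finset (Fin n))} (hA0 : ∅ ∉ A) (hA : ∀ B ∈ A, B.card + 1 ≤ d)
    {Z : Finset (Finset (Fin n))} (hZ : Z ⊆ allFaces n d) (hmin : minCore d Z) {E : ℝ}
    (hE : ∀ K ⊆ Z, ∀ τ : Finset (Fin n), τ.card = d → ((SavF d A K τ).card : ℝ) ≤ E) (L : ℕ) :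
    ∀ K : Finset (Finset (Fin n)), K ⊆ Z → K.Nonempty → Z.card = K.card + L →
      ∃ s : ℕ, PathP (stpF d) (fun K => SavF d A K (selT d K)) E L K s Z ∧
        (L : ℤ) + PhiK d A K ≤ C1d d * (s + RK d A K) := by
  induction L with
  | zero =>
    intro K hK hne hcard
    have hKZ : K = Z := Finset.eq_of_subset_of_card_le hK (by omega)
    subst hKZ
    refine ⟨0, ⟨rfl, rfl⟩, ?_⟩
    have : PhiK d A K = 0 := by
      unfold PhiK
      refine Finset.sum_eq_zero fun τ hτ => ?_
      rw [if_neg]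
      exact hmin.1.2 τ (Finset.mem_filter.1 hτ).2
    rw [this]
    push_cast
    positivity
  | succ L ih =>
    intro K hK hne hcard
    have hex : ∃ τ : Finset (Fin n), τ.card = d ∧ degK K τ = 1 := by
      by_contra hcon
      push Not at hcon
      have := hmin.2 K hK ⟨hne, hcon⟩
      rw [this] at hcard
      omega
    obtain ⟨hτ, hdeg⟩ := selT_spec hex
    set τ := selT d K with hτd
    have hdZ : 2 ≤ degK Z τ := by
      have h1 := degK_mono hK τ
      have h2 : degK Z τ ≠ 1 := hmin.1.2 τ hτ
      omega
    obtain ⟨σ, hσZ, hσK⟩ : ∃ σ ∈ Z.filter (fun σ => τ ⊆ σ), σ ∉ K.filter (fun σ => τ ⊆ σ) := by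
      by_contra hcon
      push Not at hcon
      have := Finset.card_le_card (show Z.filter (fun σ => τ ⊆ σ) ⊆ K.filter (fun σ => τ ⊆ σ) from hcon)
      unfold degK at hdeg hdZ
      omega
    rw [Finset.mem_filter] at hσZ hσK
    have hσK' : σ ∉ K := fun h => hσK ⟨h, hσZ.2⟩
    have hσc := mem_allFaces.1 (hZ hσZ.1)
    obtain ⟨v, hvσ, hτσ⟩ := exists_erase_of_subset hσZ.2 (by omega)
    have hv : v ∉ τ := by rw [hτσ]; simp
    have hσe : insert v τ = σ := by rw [hτσ, Finset.insert_erase hvσ]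
    have hstp : stpF d K v = insert σ K := by unfold stpF; rw [← hτd, hσe]
    obtain ⟨s, hs1, hs2⟩ := ih (insert σ K) (Finset.insert_subset hσZ.1 hK) (Finset.insert_nonempty _ _)
      (by rw [Finset.card_insert_of_notMem hσK']; omega)
    have hC1 := C1d_eq d
    have hC0 : (0:ℤ) ≤ C1d d := by positivity
    have hR : RK d A (insert σ K) ≤ RK d A K := by
      apply Finset.card_le_card
      intro ρ hρ
      simp only [Finset.mem_filter, Finset.mem_univ, true_and] at *
      exact ⟨hρ.1, hρ.2.1, (degK_mono (Finset.subset_insert σ K) ρ).trans hρ.2.2⟩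
    have hPge := PhiK_ge A (K := K) hτ hv (by rw [hσe]; exact hσK')
    rw [hσe] at hPge
    have hRz : (RK d A (insert σ K) : ℤ) ≤ RK d A K := by exact_mod_cast hR
    by_cases hsav : v ∈ SavF d A K τ
    · refine ⟨s + 1, ⟨hE K hK τ hτ, v, Or.inl ⟨hsav, ?_⟩⟩, ?_⟩
      · rw [hstp]; exact hs1
      · push_cast
        nlinarith
    · refine ⟨s, ⟨hE K hK τ hτ, v, Or.inr ⟨hsav, ?_⟩⟩, ?_⟩
      · rw [hstp]; exact hs1
      · by_cases hrare : rareT A τ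
        · have hR2 : RK d A (insert σ K) + 1 ≤ RK d A K := by
            apply Finset.card_lt_card
            refine Finset.ssubset_iff_subset_ne.2 ⟨?_, ?_⟩
            · intro ρ hρ
              simp only [Finset.mem_filter, Finset.mem_univ, true_and] at *
              exact ⟨hρ.1, hρ.2.1, (degK_mono (Finset.subset_insert σ K) ρ).trans hρ.2.2⟩
            · intro e
              have : τ ∈ Finset.univ.filter (fun τ : Finset (Fin n) => τ.card = d ∧ rareT A τ ∧ degK K τ ≤ 1) := by
                simp only [Finset.mem_filter, Finset.mem_univ, true_and]
                exact ⟨hτ, hrare, hdeg.le⟩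
              rw [← e] at this
              simp only [Finset.mem_filter, Finset.mem_univ, true_and] at this
              have h2 := this.2.2
              rw [degK_insert hσK', hdeg, if_pos hσZ.2] at h2
              omega
          have hR3 : (RK d A (insert σ K) : ℤ) + 1 ≤ RK d A K := by exact_mod_cast hR2
          push_cast
          nlinarith
        · have := PhiK_step hd hA0 hA hτ hv (by rw [hσe]; exact hσK') hdeg hsav hrare
          rw [hσe] at this
          push_cast
          nlinarith

lemma PhiK_single {d : ℕ} (A : Finset (Finset (Fin n))) {σ : Finset (Fin n)} (hσ : σ.card = d + 1) :
    1 ≤ PhiK d A {σ} := by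
  obtain ⟨v, hv⟩ : σ.Nonempty := Finset.card_pos.1 (by omega)
  unfold PhiK
  have h1 : degK {σ} (σ.erase v) = 1 := by
    unfold degK
    rw [Finset.filter_singleton, if_pos (Finset.erase_subset _ _)]
    simp
  have h2 : σ.erase v ∈ Finset.univ.filter (fun τ : Finset (Fin n) => τ.card = d) := by
    simp [Finset.card_erase_of_mem hv, hσ]
  have h3 := Finset.single_le_sum (f := fun τ => if degK {σ} τ = 1 then Wt d (qA A τ) else 0) (fun τ _ => by
    split_ifs
    · linarith [Wt_pos d (qA A τ)]
    · exact le_rfl) h2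
  simp only [h1, if_true] at h3
  linarith [Wt_pos d (qA A (σ.erase v))]

/-- counting of minimal cores with given heavy family -/
lemma core_count {d : ℕ} (hd : 2 ≤ d) {A : Finset (Finset (Fin n))} (hA0 : ∅ ∉ A) (hA : ∀ B ∈ A, B.card + 1 ≤ d)
    (m s : ℕ) (E : ℝ) (hE0 : 0 < E) (hEn : E ≤ n) (hs : ∀ s' : ℕ, m ≤ C1d d * (s' + RK d A ∅) → s ≤ s')
    (S : Finset (Finset (Finset (Fin n)))) (hS : ∀ Z ∈ S, Z ⊆ allFaces n d ∧ minCore d Z ∧ Z.card = m ∧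
      ∀ K ⊆ Z, ∀ τ : Finset (Fin n), τ.card = d → ((SavF d A K τ).card : ℝ) ≤ E) :
    (S.card : ℝ) ≤ (n:ℝ) ^ (d + 1) * ((E / n) ^ s * (2 * n) ^ (m - 1)) := by
  have hn0 : (0:ℝ) < n := hE0.trans_le hEn
  have hsub : S ⊆ (allFaces n d).biUnion fun σ => Finset.univ.filter
      (fun Z => PathP (stpF d) (fun K => SavF d A K (selT d K)) E (m-1) {σ} s Z) := by
    intro Z hZ
    obtain ⟨h1, h2, h3, h4⟩ := hS Z hZ
    obtain ⟨σ, hσ⟩ := h2.1.1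
    have hm : 1 ≤ m := by rw [← h3]; exact Finset.card_pos.2 ⟨σ, hσ⟩
    obtain ⟨s', hp, hle⟩ := path_exists hd hA0 hA h1 h2 h4 (m-1) {σ} (by simpa using hσ) (by simp) (by simp; omega)
    rw [Finset.mem_biUnion]
    refine ⟨σ, h1 hσ, ?_⟩
    rw [Finset.mem_filter]
    refine ⟨Finset.mem_univ _, PathP_mono _ _ _ _ _ _ _ _ (hs s' ?_) hp⟩
    have h5 := PhiK_single A (mem_allFaces.1 (h1 hσ))
    have h6 : RK d A {σ} ≤ RK d A ∅ := by
      apply Finset.card_le_card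
      intro ρ hρ
      simp only [Finset.mem_filter, Finset.mem_univ, true_and] at *
      exact ⟨hρ.1, hρ.2.1, by simp [degK]⟩
    have h7 : (m:ℤ) ≤ C1d d * (s' + RK d A {σ}) := by
      have : ((m - 1 : ℕ):ℤ) = m - 1 := by push_cast [hm]; ring
      rw [this] at hle
      linarith
    have h8 : m ≤ C1d d * (s' + RK d A {σ}) := by exact_mod_cast h7
    exact h8.trans (Nat.mul_le_mul_left _ (by omega))
  have h1 : (S.card : ℝ) ≤ ∑ σ ∈ allFaces n d, ((Finset.univ.filter
      (fun Z => PathP (stpF d) (fun K => SavF d A K (selT d K)) E (m-1) {σ} s Z)).card : ℝ) := by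
    exact_mod_cast (Finset.card_le_card hsub).trans Finset.card_biUnion_le
  have hy : 1 ≤ n / E := by rw [le_div_iff₀ hE0]; linarith
  have h2 : ∀ σ ∈ allFaces n d, ((Finset.univ.filter
      (fun Z => PathP (stpF d) (fun K => SavF d A K (selT d K)) E (m-1) {σ} s Z)).card : ℝ) ≤
      ((E / n) ^ s * (2 * n) ^ (m - 1)) := by
    intro σ _
    have := PathP_count (stpF d) (fun K => SavF d A K (selT d K)) E (n / E) hE0.le hy (m-1) ({σ} : Finset (Finset (Fin n))) s
    rw [inv_div, Fintype.card_fin, div_mul_cancel₀ _ hE0.ne', ← two_mul] at this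
    exact this
  refine h1.trans ((Finset.sum_le_card_nsmul _ _ _ h2).trans ?_)
  rw [nsmul_eq_mul, card_allFaces]
  gcongr
  exact_mod_cast Nat.choose_le_pow n (d+1)
end pot2

end Part13

section Part14

section heavy
variable {n : ℕ}

lemma sav_bound {d : ℕ} {A K Z : Finset (Finset (Fin n))} (hK : K ⊆ Z) {θlo θhi : ℝ} (hlo : 0 ≤ θlo) (hhi : 0 ≤ θhi)
    (h1 : ∀ ρ : Finset (Fin n), ρ.card + 2 ≤ d → ρ ∉ A →
      ((Finset.univ.filter (fun v => insert v ρ ∈ A)).card : ℝ) ≤ θlo)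
    (h2 : ∀ ρ : Finset (Fin n), ρ.card + 1 = d → ρ ∉ A →
      ((Finset.univ.filter (fun v => v ∉ ρ ∧ 0 < degK Z (insert v ρ))).card : ℝ) ≤ θhi)
    {τ : Finset (Fin n)} (hτ : τ.card = d) : ((SavF d A K τ).card : ℝ) ≤ 2 ^ d * (θlo + θhi) := by
  set f : Finset (Fin n) → Finset (Fin n) := fun ρ =>
    (if ρ.card + 2 ≤ d ∧ ρ ∉ A then Finset.univ.filter (fun v => insert v ρ ∈ A) else ∅) ∪
    (if ρ.card + 1 = d ∧ ρ ∉ A then Finset.univ.filter (fun v => v ∉ ρ ∧ 0 < degK Z (insert v ρ)) else ∅) with hf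
  have hsub : SavF d A K τ ⊆ τ.powerset.biUnion f := by
    intro v hv
    unfold SavF at hv
    rw [Finset.mem_filter] at hv
    obtain ⟨-, hvτ, ρ, hρ, hρA, h⟩ := hv
    rw [Finset.mem_biUnion]
    refine ⟨ρ, Finset.mem_powerset.2 hρ, ?_⟩
    simp only [hf, Finset.mem_union]
    rcases h with h | h
    · left
      rw [if_pos ⟨h.1, hρA⟩]
      simpa using h.2
    · right
      rw [if_pos ⟨h.1, hρA⟩]
      simp only [Finset.mem_filter, Finset.mem_univ, true_and]
      exact ⟨fun h' => hvτ (hρ h'), h.2.trans_le (degK_mono hK _)⟩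
  have hc : ∀ ρ ∈ τ.powerset, ((f ρ).card : ℝ) ≤ θlo + θhi := by
    intro ρ _
    have h3 : ((f ρ).card : ℝ) ≤ _ := Nat.cast_le.2 (Finset.card_union_le _ _)
    push_cast at h3
    refine h3.trans (add_le_add ?_ ?_)
    · split_ifs with h
      · exact h1 ρ h.1 h.2
      · simpa using hlo
    · split_ifs with h
      · exact h2 ρ h.1 h.2
      · simpa using hhi
  have h4 : ((SavF d A K τ).card : ℝ) ≤ ∑ ρ ∈ τ.powerset, ((f ρ).card : ℝ) := by
    exact_mod_cast (Finset.card_le_card hsub).trans Finset.card_biUnion_le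
  refine h4.trans ((Finset.sum_le_card_nsmul _ _ _ hc).trans ?_)
  rw [Finset.card_powerset, hτ, nsmul_eq_mul]
  push_cast
  exact le_rfl

lemma rare_bound {d : ℕ} {A : Finset (Finset (Fin n))} (hA : ∀ B ∈ A, B.card + 1 ≤ d) {θlo : ℝ} (hlo : 0 ≤ θlo)
    (h1 : ∀ ρ : Finset (Fin n), ρ.card + 2 ≤ d → ρ ∉ A →
      ((Finset.univ.filter (fun v => insert v ρ ∈ A)).card : ℝ) ≤ θlo) :
    (RK d A ∅ : ℝ) ≤ (A.filter (fun ρ => ρ.card + 1 = d)).card * (2 ^ d * θlo) := by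
  set f : Finset (Fin n) → Finset (Fin n) → Finset (Finset (Fin n)) := fun ρ B =>
    if B.card + 2 ≤ d ∧ B ∉ A then (Finset.univ.filter (fun v => insert v B ∈ A)).image (fun v => insert v ρ) else ∅ with hf
  have hsub : Finset.univ.filter (fun τ : Finset (Fin n) => τ.card = d ∧ rareT A τ ∧ degK ∅ τ ≤ 1) ⊆
      (A.filter (fun ρ => ρ.card + 1 = d)).biUnion fun ρ => ρ.powerset.biUnion (f ρ) := by
    intro τ hτ
    simp only [Finset.mem_filter, Finset.mem_univ, true_and] at hτ
    obtain ⟨hτd, ⟨B, hBτ, hB, i, hi, hiA⟩, -⟩ := hτ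
    rw [Finset.mem_biUnion]
    refine ⟨τ.erase i, ?_, ?_⟩
    · rw [Finset.mem_filter]
      refine ⟨hiA, ?_⟩
      rw [Finset.card_erase_of_mem (hBτ hi), hτd]
      have := Finset.card_pos.2 ⟨i, hBτ hi⟩
      omega
    · rw [Finset.mem_biUnion]
      refine ⟨B.erase i, Finset.mem_powerset.2 (Finset.erase_subset_erase _ hBτ), ?_⟩
      have h3 : (B.erase i).card + 2 ≤ d := by
        have := hA B hB.1
        have h4 := Finset.card_pos.2 ⟨i, hi⟩
        rw [Finset.card_erase_of_mem hi]; omega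
      have h4 : B.erase i ∉ A := by
        intro h
        have := hB.2 _ h (Finset.erase_subset _ _)
        rw [Finset.erase_eq_self] at this
        exact this hi
      simp only [hf]
      rw [if_pos ⟨h3, h4⟩, Finset.mem_image]
      refine ⟨i, ?_, Finset.insert_erase (hBτ hi)⟩
      simp only [Finset.mem_filter, Finset.mem_univ, true_and]
      rw [Finset.insert_erase hi]; exact hB.1
  have hf1 : ∀ ρ B, ((f ρ B).card : ℝ) ≤ θlo := by
    intro ρ B
    simp only [hf]
    split_ifs with h
    · exact (Nat.cast_le.2 Finset.card_image_le).trans (h1 B h.1 h.2)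
    · simpa using hlo
  have h4 : (RK d A ∅ : ℝ) ≤ ∑ ρ ∈ A.filter (fun ρ => ρ.card + 1 = d), ((ρ.powerset.biUnion (f ρ)).card : ℝ) := by
    unfold RK
    exact_mod_cast (Finset.card_le_card hsub).trans Finset.card_biUnion_le
  refine h4.trans ((Finset.sum_le_card_nsmul _ _ (2 ^ d * θlo) ?_).trans (by rw [nsmul_eq_mul]))
  intro ρ hρ
  have h5 : ((ρ.powerset.biUnion (f ρ)).card : ℝ) ≤ ∑ B ∈ ρ.powerset, ((f ρ B).card : ℝ) := by
    exact_mod_cast Finset.card_biUnion_le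
  refine h5.trans ((Finset.sum_le_card_nsmul _ _ _ fun B _ => hf1 ρ B).trans ?_)
  rw [Finset.card_powerset, nsmul_eq_mul]
  push_cast
  gcongr
  · norm_num
  · have := hA ρ (Finset.mem_filter.1 hρ).1
    omega

lemma dbl_count (R T : Finset (Finset (Fin n))) (k : ℕ) (hT : ∀ τ ∈ T, τ.card ≤ k) (θ : ℝ)
    (hR : ∀ ρ ∈ R, θ ≤ ((Finset.univ.filter (fun v => v ∉ ρ ∧ insert v ρ ∈ T)).card : ℝ)) :
    R.card * θ ≤ k * T.card := by
  have h1 : R.card * θ ≤ ∑ ρ ∈ R, ((Finset.univ.filter (fun v => v ∉ ρ ∧ insert v ρ ∈ T)).card : ℝ) := by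
    rw [← nsmul_eq_mul]; exact Finset.card_nsmul_le_sum _ _ _ hR
  refine h1.trans ?_
  have h2 : ∑ ρ ∈ R, (Finset.univ.filter (fun v => v ∉ ρ ∧ insert v ρ ∈ T)).card ≤ ∑ τ ∈ T, τ.card := by
    rw [← Finset.card_sigma, ← Finset.card_sigma]
    refine Finset.card_le_card_of_injOn (fun x => ⟨insert x.2 x.1, x.2⟩) ?_ ?_
    · rintro ⟨ρ, v⟩ hx
      simp only [Finset.coe_sigma, Set.mem_sigma_iff, Finset.mem_coe, Finset.mem_filter, Finset.mem_univ, true_and] at hx ⊢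
      exact ⟨hx.2.2, Finset.mem_insert_self _ _⟩
    · rintro ⟨ρ, v⟩ hx ⟨ρ', v'⟩ hx' h
      simp only [Finset.coe_sigma, Set.mem_sigma_iff, Finset.mem_coe, Finset.mem_filter, Finset.mem_univ, true_and] at hx hx'
      simp only [Sigma.mk.injEq, heq_eq_eq] at h
      obtain ⟨h3, rfl⟩ := h
      have : ρ = ρ' := by rw [← Finset.erase_insert hx.2.1, h3, Finset.erase_insert hx'.2.1]
      rw [this]
  have h3 : ∑ τ ∈ T, τ.card ≤ T.card * k := Finset.sum_le_card_nsmul _ _ _ hT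
  have h4 := h2.trans h3
  rw [mul_comm (k:ℝ)]
  exact_mod_cast h4

def bdZ (d : ℕ) (Z : Finset (Finset (Fin n))) : Finset (Finset (Fin n)) :=
  Finset.univ.filter (fun τ => τ.card = d ∧ 0 < degK Z τ)

lemma bdZ_card {d : ℕ} {Z : Finset (Finset (Fin n))} (hZ : Z ⊆ allFaces n d) : (bdZ d Z).card ≤ Z.card * (d + 1) := by
  have hsub : bdZ d Z ⊆ Z.biUnion (fun σ => σ.powersetCard d) := by
    intro τ hτ
    simp only [bdZ, Finset.mem_filter, Finset.mem_univ, true_and] at hτ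
    obtain ⟨hτ1, hτ2⟩ := hτ
    unfold degK at hτ2
    obtain ⟨σ, hσ⟩ := Finset.card_pos.1 hτ2
    rw [Finset.mem_filter] at hσ
    rw [Finset.mem_biUnion]
    exact ⟨σ, hσ.1, Finset.mem_powersetCard.2 ⟨hσ.2, hτ1⟩⟩
  refine (Finset.card_le_card hsub).trans (Finset.card_biUnion_le.trans ?_)
  refine Finset.sum_le_card_nsmul _ _ _ fun σ hσ => ?_
  rw [Finset.card_powersetCard, mem_allFaces.1 (hZ hσ)]
  simp

def Hlev (d : ℕ) (Z : Finset (Finset (Fin n))) (θlo θhi : ℝ) : ℕ → Finset (Finset (Fin n))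
  | 0 => Finset.univ.filter (fun ρ => ρ.card + 1 = d ∧
      θhi < ((Finset.univ.filter (fun v => v ∉ ρ ∧ insert v ρ ∈ bdZ d Z)).card : ℝ))
  | j+1 => Finset.univ.filter (fun ρ => ρ.card + (j + 2) = d ∧
      θlo < ((Finset.univ.filter (fun v => v ∉ ρ ∧ insert v ρ ∈ Hlev d Z θlo θhi j)).card : ℝ))

lemma Hlev_card_eq {d : ℕ} {Z : Finset (Finset (Fin n))} {θlo θhi : ℝ} {j : ℕ} {ρ : Finset (Fin n)}
    (h : ρ ∈ Hlev d Z θlo θhi j) : ρ.card + (j + 1) = d := by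
  cases j with
  | zero => simp only [Hlev, Finset.mem_filter] at h; exact h.2.1
  | succ j => simp only [Hlev, Finset.mem_filter] at h; exact h.2.1

lemma heavy_exists {d : ℕ} (hd : 2 ≤ d) {Z : Finset (Finset (Fin n))} (hZ : Z ⊆ allFaces n d) {m : ℕ} (hm : Z.card = m)
    {θlo θhi : ℝ} (hlo : (d:ℝ) ≤ θlo) (hhi : 0 < θhi) (hbig : (d:ℝ) ^ d * (d + 1) * m < θlo ^ (d - 1) * θhi) :
    ∃ A : Finset (Finset (Fin n)), ∅ ∉ A ∧ (∀ B ∈ A, B.card + 1 ≤ d) ∧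
      A.card * θhi ≤ d * (d * (d + 1) * m) ∧ RK d A ∅ * θhi ≤ 2 ^ d * θlo * (d * (d + 1) * m) ∧
      ∀ K ⊆ Z, ∀ τ : Finset (Fin n), τ.card = d → ((SavF d A K τ).card : ℝ) ≤ 2 ^ d * (θlo + θhi) := by
  have hd0 : (0:ℝ) < d := by exact_mod_cast (by omega : 0 < d)
  have hlo0 : 0 < θlo := hd0.trans_le hlo
  set H := Hlev d Z θlo θhi with hH
  set A := (Finset.range d).biUnion H with hAd
  have hH0 : (H 0).card * θhi ≤ d * (d + 1) * m := by
    have h1 := dbl_count (H 0) (bdZ d Z) d (fun τ hτ => by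
      simp only [bdZ, Finset.mem_filter] at hτ; omega) θhi (fun ρ hρ => by
      simp only [hH, Hlev, Finset.mem_filter] at hρ
      exact hρ.2.2.le)
    have h2 : ((bdZ d Z).card : ℝ) ≤ m * (d + 1) := by
      have := bdZ_card hZ
      rw [hm] at this
      exact_mod_cast this
    nlinarith
  have hHs : ∀ j, (H (j+1)).card * θlo ≤ d * (H j).card := by
    intro j
    refine dbl_count (H (j+1)) (H j) d (fun τ hτ => by have := Hlev_card_eq hτ; omega) θlo (fun ρ hρ => ?_)
    simp only [hH, Hlev, Finset.mem_filter] at hρ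
    exact hρ.2.2.le
  have hHle : ∀ j, (H j).card ≤ (H 0).card := by
    intro j
    induction j with
    | zero => exact le_rfl
    | succ j ih =>
      have h1 := hHs j
      have h2 : (d:ℝ) * (H (j+1)).card ≤ d * (H j).card := by
        refine le_trans ?_ h1
        rw [mul_comm]; gcongr
      have h3 := le_of_mul_le_mul_left h2 hd0
      exact (by exact_mod_cast h3 : (H (j+1)).card ≤ (H j).card).trans ih
  have hHpow : ∀ j, ((H j).card : ℝ) * (θlo ^ j * θhi) ≤ d ^ j * (d * (d + 1) * m) := by
    intro j
    induction j with
    | zero => simpa using hH0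
    | succ j ih =>
      have h1 := hHs j
      calc ((H (j+1)).card : ℝ) * (θlo ^ (j+1) * θhi) = ((H (j+1)).card * θlo) * (θlo ^ j * θhi) := by ring
        _ ≤ (d * (H j).card) * (θlo ^ j * θhi) := by gcongr
        _ = d * ((H j).card * (θlo ^ j * θhi)) := by ring
        _ ≤ d * (d ^ j * (d * (d + 1) * m)) := by gcongr
        _ = _ := by ring
  have hAcard : ∀ B ∈ A, B.card + 1 ≤ d := by
    intro B hB
    rw [hAd, Finset.mem_biUnion] at hB
    obtain ⟨j, _, hB⟩ := hB
    have := Hlev_card_eq hB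
    omega
  have hmemA : ∀ ρ : Finset (Fin n), ∀ j, ρ.card + (j + 1) = d → (ρ ∈ A ↔ ρ ∈ H j) := by
    intro ρ j hj
    rw [hAd, Finset.mem_biUnion]
    constructor
    · rintro ⟨i, _, hi⟩
      have := Hlev_card_eq hi
      have : i = j := by omega
      rwa [this] at hi
    · intro h
      exact ⟨j, Finset.mem_range.2 (by omega), h⟩
  have hP1 : ∀ ρ : Finset (Fin n), ρ.card + 2 ≤ d → ρ ∉ A →
      ((Finset.univ.filter (fun v => insert v ρ ∈ A)).card : ℝ) ≤ θlo := by
    intro ρ hρ hρA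
    obtain ⟨j, hj⟩ : ∃ j, ρ.card + (j + 2) = d := ⟨d - 2 - ρ.card, by omega⟩
    rw [hmemA ρ (j+1) hj] at hρA
    have h2 : (Finset.univ.filter (fun v => insert v ρ ∈ A)) ⊆ Finset.univ.filter (fun v => v ∉ ρ ∧ insert v ρ ∈ H j) := by
      intro v hv
      simp only [Finset.mem_filter, Finset.mem_univ, true_and] at hv ⊢
      have hvρ : v ∉ ρ := by
        intro h
        rw [Finset.insert_eq_of_mem h, hmemA ρ (j+1) hj] at hv
        exact hρA hv
      refine ⟨hvρ, ?_⟩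
      rwa [hmemA _ j (by rw [Finset.card_insert_of_notMem hvρ]; omega)] at hv
    refine (Nat.cast_le.2 (Finset.card_le_card h2)).trans ?_
    by_contra hcon
    push Not at hcon
    apply hρA
    simp only [hH, Hlev, Finset.mem_filter, Finset.mem_univ, true_and]
    exact ⟨hj, hcon⟩
  have hP2 : ∀ ρ : Finset (Fin n), ρ.card + 1 = d → ρ ∉ A →
      ((Finset.univ.filter (fun v => v ∉ ρ ∧ 0 < degK Z (insert v ρ))).card : ℝ) ≤ θhi := by
    intro ρ hρ hρA
    rw [hmemA ρ 0 (by omega)] at hρA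
    by_contra hcon
    push Not at hcon
    apply hρA
    simp only [hH, Hlev, Finset.mem_filter, Finset.mem_univ, true_and]
    refine ⟨hρ, hcon.trans_le ?_⟩
    refine Nat.cast_le.2 (Finset.card_le_card ?_)
    intro v hv
    simp only [bdZ, Finset.mem_filter, Finset.mem_univ, true_and] at hv ⊢
    exact ⟨hv.1, by rw [Finset.card_insert_of_notMem hv.1]; omega, hv.2⟩
  refine ⟨A, ?_, hAcard, ?_, ?_, fun K hK τ hτ => sav_bound hK hlo0.le hhi.le hP1 hP2 hτ⟩
  · intro h
    rw [hmemA ∅ (d-1) (by simp; omega)] at h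
    have h1 : (1:ℝ) ≤ (H (d-1)).card := by exact_mod_cast Finset.card_pos.2 ⟨_, h⟩
    have h2 := hHpow (d-1)
    have h3 : (d:ℝ) ^ d = d ^ (d-1) * d := by rw [← pow_succ]; congr 1; omega
    have h4 : 0 < θlo ^ (d-1) * θhi := by positivity
    rw [h3] at hbig
    nlinarith
  · have h1 : A.card ≤ d * (H 0).card := by
      refine Finset.card_biUnion_le.trans ?_
      refine (Finset.sum_le_card_nsmul _ _ _ fun j _ => hHle j).trans ?_
      simp
    have h2 : (A.card : ℝ) ≤ d * (H 0).card := by exact_mod_cast h1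
    nlinarith
  · have h1 := rare_bound hAcard hlo0.le hP1
    have h2 : A.filter (fun ρ => ρ.card + 1 = d) ⊆ H 0 := by
      intro ρ hρ
      rw [Finset.mem_filter] at hρ
      exact (hmemA ρ 0 (by omega)).1 hρ.1
    have h3 : ((A.filter (fun ρ => ρ.card + 1 = d)).card : ℝ) ≤ (H 0).card := by
      exact_mod_cast Finset.card_le_card h2
    calc (RK d A ∅ : ℝ) * θhi ≤ ((H 0).card * (2 ^ d * θlo)) * θhi := by
          gcongr
          exact h1.trans (by gcongr)
      _ = (2 ^ d * θlo) * ((H 0).card * θhi) := by ring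
      _ ≤ _ := by gcongr
end heavy

end Part14

section Part15

section smallm
variable {n : ℕ}

lemma core_nbr {d : ℕ} {Z : Finset (Finset (Fin n))} (hZ : Z ⊆ allFaces n d) (hc : isCore d Z)
    {σ : Finset (Fin n)} (hσ : σ ∈ Z) {u : Fin n} (hu : u ∈ σ) :
    ∃ w, w ∉ σ ∧ insert w (σ.erase u) ∈ Z := by
  have h1 : σ.card = d + 1 := mem_allFaces.1 (hZ hσ)
  have h2 : (σ.erase u).card = d := by rw [Finset.card_erase_of_mem hu, h1]; rfl
  have h3 := hc.2 _ h2
  have h4 : σ ∈ Z.filter (fun σ' => σ.erase u ⊆ σ') := Finset.mem_filter.2 ⟨hσ, Finset.erase_subset _ _⟩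
  have h5 : 1 < (Z.filter (fun σ' => σ.erase u ⊆ σ')).card := by
    have := Finset.card_pos.2 ⟨σ, h4⟩
    omega
  obtain ⟨ρ, hρ, hne⟩ := Finset.exists_mem_ne h5 σ
  rw [Finset.mem_filter] at hρ
  have h6 : ρ.card = d + 1 := mem_allFaces.1 (hZ hρ.1)
  obtain ⟨w, hw, hwe⟩ := exists_erase_of_subset hρ.2 (by omega)
  have hins : insert w (σ.erase u) = ρ := by rw [hwe, Finset.insert_erase hw]
  refine ⟨w, ?_, hins ▸ hρ.1⟩
  intro hwσ
  have hwn : w ∉ σ.erase u := by rw [hwe]; exact Finset.notMem_erase _ _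
  have : w = u := by
    by_contra hwu
    exact hwn (Finset.mem_erase.2 ⟨hwu, hwσ⟩)
  rw [this, Finset.insert_erase hu] at hins
  exact hne hins.symm

lemma vstar_sub {d : ℕ} {Z : Finset (Finset (Fin n))}
    {σ : Finset (Fin n)} (hσ : σ ∈ Z) (w : Fin n → Fin n)
    (hw : ∀ u ∈ σ, w u ∉ σ ∧ insert (w u) (σ.erase u) ∈ Z) (hσd : σ.card = d + 1)
    {v : Fin n} (hv : v ∈ σ) :
    insert σ ((σ.erase v).image (fun u => insert (w u) (σ.erase u))) ⊆ Z.filter (fun ρ => v ∈ ρ) ∧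
    (insert σ ((σ.erase v).image (fun u => insert (w u) (σ.erase u)))).card = d + 1 := by
  have hu : ∀ u ∈ σ, u ∉ insert (w u) (σ.erase u) := by
    intro u hu h
    rw [Finset.mem_insert] at h
    rcases h with h | h
    · exact (hw u hu).1 (h ▸ hu)
    · exact Finset.notMem_erase _ _ h
  constructor
  · intro ρ hρ
    rw [Finset.mem_insert, Finset.mem_image] at hρ
    rcases hρ with rfl | ⟨u, hu, rfl⟩
    · exact Finset.mem_filter.2 ⟨hσ, hv⟩
    · rw [Finset.mem_erase] at hu
      exact Finset.mem_filter.2 ⟨(hw u hu.2).2, Finset.mem_insert_of_mem (Finset.mem_erase.2 ⟨hu.1.symm, hv⟩)⟩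
  · rw [Finset.card_insert_of_notMem, Finset.card_image_of_injOn, Finset.card_erase_of_mem hv, hσd]
    · rfl
    · intro u hu1 u' hu1' h
      simp only [Finset.coe_erase, Set.mem_sdiff, Finset.mem_coe, Set.mem_singleton_iff] at hu1 hu1'
      by_contra hne
      apply hu u hu1.1
      simp only at h
      rw [h]
      exact Finset.mem_insert_of_mem (Finset.mem_erase.2 ⟨hne, hu1.1⟩)
    · rw [Finset.mem_image]
      rintro ⟨u, hu1, h⟩
      rw [Finset.mem_erase] at hu1
      have h7 := hu u hu1.2
      rw [h] at h7
      exact h7 hu1.2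

lemma core_deg_ge {d : ℕ} {Z : Finset (Finset (Fin n))} (hZ : Z ⊆ allFaces n d) (hc : isCore d Z)
    {v : Fin n} (hv : v ∈ Z.biUnion id) : d + 1 ≤ (Z.filter (fun ρ => v ∈ ρ)).card := by
  rw [Finset.mem_biUnion] at hv
  obtain ⟨σ, hσ, hvσ⟩ := hv
  have h := fun u (hu : u ∈ σ) => core_nbr hZ hc hσ hu
  choose! w hw using h
  obtain ⟨h1, h2⟩ := vstar_sub hσ w hw (mem_allFaces.1 (hZ hσ)) hvσ
  rw [← h2]
  exact Finset.card_le_card h1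

lemma core_eq_deg {d : ℕ} (hd : 2 ≤ d) {Z : Finset (Finset (Fin n))} (hZ : Z ⊆ allFaces n d) (hc : isCore d Z)
    (hsf : simplexFree d Z) (heq : ∀ v ∈ Z.biUnion id, (Z.filter (fun ρ => v ∈ ρ)).card ≤ d + 1) : False := by
  obtain ⟨σ, hσ⟩ := hc.1
  have hσd : σ.card = d + 1 := mem_allFaces.1 (hZ hσ)
  have h := fun u (hu : u ∈ σ) => core_nbr hZ hc hσ hu
  choose! w hw using h
  have key : ∀ v ∈ σ, ∀ u ∈ σ, ∀ u' ∈ σ, u ≠ v → u' ≠ v → u ≠ u' → w u = w u' := by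
    intro v hv u hu u' hu' huv hu'v huu'
    obtain ⟨h1, h2⟩ := vstar_sub hσ w hw hσd hv
    have hstar := Finset.eq_of_subset_of_card_le h1 (by
      rw [h2]; exact heq v (Finset.mem_biUnion.2 ⟨σ, hσ, hv⟩))
    have hu'm : u' ∈ insert (w u) (σ.erase u) := Finset.mem_insert_of_mem (Finset.mem_erase.2 ⟨huu'.symm, hu'⟩)
    obtain ⟨x, hx, hxZ⟩ := core_nbr hZ hc (hw u hu).2 hu'm
    have hvx : v ∈ insert x ((insert (w u) (σ.erase u)).erase u') :=
      Finset.mem_insert_of_mem (Finset.mem_erase.2 ⟨hu'v.symm, Finset.mem_insert_of_mem (Finset.mem_erase.2 ⟨huv.symm, hv⟩)⟩)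
    have hmem : _ ∈ Z.filter (fun ρ => v ∈ ρ) := Finset.mem_filter.2 ⟨hxZ, hvx⟩
    rw [← hstar, Finset.mem_insert, Finset.mem_image] at hmem
    have hwu' : w u ≠ u' := fun h => (hw u hu).1 (h ▸ hu')
    have hwm : w u ∈ insert x ((insert (w u) (σ.erase u)).erase u') :=
      Finset.mem_insert_of_mem (Finset.mem_erase.2 ⟨hwu', Finset.mem_insert_self _ _⟩)
    rcases hmem with h | ⟨u'', hu'', h⟩
    · rw [h] at hwm
      exact absurd hwm (hw u hu).1
    · rw [Finset.mem_erase] at hu''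
      rw [← h, Finset.mem_insert, Finset.mem_erase] at hwm
      have hww : w u = w u'' := by
        rcases hwm with h | h
        · exact h
        · exact absurd h.2 (hw u hu).1
      by_cases hu3 : u'' = u'
      · rw [hww, hu3]
      · exfalso
        have hu4 : u'' ∉ insert (w u'') (σ.erase u'') := by
          intro h
          rw [Finset.mem_insert] at h
          rcases h with h | h
          · exact (hw u'' hu''.2).1 (h ▸ hu''.2)
          · exact Finset.notMem_erase _ _ h
        by_cases hu5 : u'' = u
        · subst hu5
          have : u' ∈ insert (w u'') (σ.erase u'') := hu'm
          have hsub : insert x ((insert (w u'') (σ.erase u'')).erase u') = insert (w u'') (σ.erase u'') := h.symm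
          have hxm : x ∈ insert (w u'') (σ.erase u'') := by rw [← hsub]; exact Finset.mem_insert_self _ _
          exact hx hxm
        · apply hu4
          rw [h]
          exact Finset.mem_insert_of_mem (Finset.mem_erase.2 ⟨hu3, Finset.mem_insert_of_mem (Finset.mem_erase.2 ⟨hu5, hu''.2⟩)⟩)
  have hall : ∀ u ∈ σ, ∀ u' ∈ σ, w u = w u' := by
    intro u hu u' hu'
    by_cases h : u = u'
    · rw [h]
    · have h1 : 0 < ((σ.erase u).erase u').card := by
        rw [Finset.card_erase_of_mem (Finset.mem_erase.2 ⟨Ne.symm h, hu'⟩), Finset.card_erase_of_mem hu, hσd]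
        omega
      obtain ⟨v, hv⟩ := Finset.card_pos.1 h1
      rw [Finset.mem_erase, Finset.mem_erase] at hv
      exact key v hv.2.2 u hu u' hu' (Ne.symm hv.2.1) (Ne.symm hv.1) h
  obtain ⟨u0, hu0⟩ := Finset.card_pos.1 (by omega : 0 < σ.card)
  obtain ⟨t, ht, htZ⟩ := hsf (insert (w u0) σ) (by rw [Finset.card_insert_of_notMem (hw u0 hu0).1, hσd])
  apply htZ
  rw [Finset.mem_insert] at ht
  rcases ht with rfl | ht
  · rw [Finset.erase_insert (hw u0 hu0).1]; exact hσ
  · rw [Finset.erase_insert_of_ne (fun h : w u0 = t => (hw u0 hu0).1 (h ▸ ht)), hall u0 hu0 t ht]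
    exact (hw t ht).2

lemma core_vertices {d : ℕ} (hd : 2 ≤ d) {Z : Finset (Finset (Fin n))} (hZ : Z ⊆ allFaces n d) (hc : isCore d Z)
    (hsf : simplexFree d Z) : (Z.biUnion id).card + 1 ≤ Z.card := by
  by_contra hcon
  have hlt : Z.card ≤ (Z.biUnion id).card := by omega
  have hsum : ∑ v ∈ Z.biUnion id, (Z.filter (fun ρ => v ∈ ρ)).card = Z.card * (d + 1) := by
    have h1 : ∀ ρ ∈ Z, ((Z.biUnion id).filter (fun v => v ∈ ρ)).card = d + 1 := by
      intro ρ hρ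
      rw [← mem_allFaces.1 (hZ hρ)]
      congr 1
      ext v
      simp only [Finset.mem_filter, Finset.mem_biUnion, id]
      exact ⟨fun h => h.2, fun h => ⟨⟨ρ, hρ, h⟩, h⟩⟩
    rw [← smul_eq_mul, ← Finset.sum_const, ← Finset.sum_congr rfl h1]
    simp only [Finset.card_filter]
    exact Finset.sum_comm
  have hge := fun v hv => core_deg_ge hZ hc (v := v) hv
  refine core_eq_deg hd hZ hc hsf fun v hv => ?_
  by_contra hbig
  have h2 : ∑ v ∈ Z.biUnion id, (d + 1) < ∑ v ∈ Z.biUnion id, (Z.filter (fun ρ => v ∈ ρ)).card :=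
    Finset.sum_lt_sum hge ⟨v, hv, by omega⟩
  rw [hsum, Finset.sum_const, smul_eq_mul] at h2
  have := Nat.mul_le_mul_right (d + 1) hlt
  omega

lemma small_count {d : ℕ} (hd : 2 ≤ d) (m : ℕ) (S : Finset (Finset (Finset (Fin n))))
    (hS : ∀ Z ∈ S, Z ⊆ allFaces n d ∧ isCore d Z ∧ simplexFree d Z ∧ Z.card = m) :
    S.card ≤ n ^ (m - 1) * 2 ^ 2 ^ (m - 1) := by
  have hsub : S ⊆ (Finset.univ : Finset ((Fin (m-1) → Fin n) × Finset (Finset (Fin (m-1))))).image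
      (fun x => x.2.image (fun s => s.image x.1)) := by
    intro Z hZS
    obtain ⟨hZ, hc, hsf, hm⟩ := hS Z hZS
    have hv := core_vertices hd hZ hc hsf
    have hne : (Z.biUnion id).Nonempty := by
      obtain ⟨σ, hσ⟩ := hc.1
      have := mem_allFaces.1 (hZ hσ)
      obtain ⟨u, hu⟩ := Finset.card_pos.1 (by omega : 0 < σ.card)
      exact ⟨u, Finset.mem_biUnion.2 ⟨σ, hσ, hu⟩⟩
    have : ∃ f : Fin (m-1) → Fin n, ∀ v ∈ Z.biUnion id, ∃ i, f i = v := by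
      set V := Z.biUnion id
      obtain ⟨v0, hv0⟩ := hne
      refine ⟨fun i => if h : i.1 < V.card then (V.equivFin.symm ⟨i.1, h⟩).1 else v0, ?_⟩
      intro v hvV
      refine ⟨⟨(V.equivFin ⟨v, hvV⟩).1, by have := (V.equivFin ⟨v, hvV⟩).2; omega⟩, ?_⟩
      simp
    obtain ⟨f, hf⟩ := this
    rw [Finset.mem_image]
    refine ⟨(f, Z.image (fun σ => Finset.univ.filter (fun i => f i ∈ σ))), Finset.mem_univ _, ?_⟩
    simp only [Finset.image_image]
    have : ∀ σ ∈ Z, ((fun s => Finset.image f s) ∘ fun σ => Finset.univ.filter (fun i => f i ∈ σ)) σ = σ := by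
      intro σ hσ
      ext v
      simp only [Function.comp, Finset.mem_image, Finset.mem_filter, Finset.mem_univ, true_and]
      constructor
      · rintro ⟨i, h1, rfl⟩; exact h1
      · intro h
        obtain ⟨i, rfl⟩ := hf v (Finset.mem_biUnion.2 ⟨σ, hσ, h⟩)
        exact ⟨i, h, rfl⟩
    rw [Finset.image_congr (g := id) this, Finset.image_id]
  refine (Finset.card_le_card hsub).trans (Finset.card_image_le.trans ?_)
  simp

end smallm

end Part15

section Part16

section assemG

/-- minimal simplex-free cores of size m -/
def coreS (n d m : ℕ) : Finset (Finset (Finset (Fin n))) :=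
  (allFaces n d).powerset.filter (fun Z => minCore d Z ∧ simplexFree d Z ∧ Z.card = m)

lemma mem_coreS {n d m : ℕ} {Z : Finset (Finset (Fin n))} :
    Z ∈ coreS n d m ↔ Z ⊆ allFaces n d ∧ minCore d Z ∧ simplexFree d Z ∧ Z.card = m := by
  unfold coreS; rw [Finset.mem_filter, Finset.mem_powerset]

lemma card_small_subsets {α : Type*} [Fintype α] (h : ℕ) (S : Finset (Finset α)) (hS : ∀ A ∈ S, A.card ≤ h) :
    S.card ≤ (Fintype.card α + 1) ^ h := by
  have hsub : S ⊆ (Finset.univ : Finset (Fin h → Option α)).image (fun f => Finset.univ.filter (fun x => ∃ i, f i = some x)) := by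
    intro A hA
    have hc := hS A hA
    rw [Finset.mem_image]
    refine ⟨fun i => if hi : i.1 < A.card then some (A.equivFin.symm ⟨i.1, hi⟩).1 else none, Finset.mem_univ _, ?_⟩
    ext x
    simp only [Finset.mem_filter, Finset.mem_univ, true_and]
    constructor
    · rintro ⟨i, hi⟩
      split_ifs at hi with h1
      rw [Option.some.injEq] at hi
      rw [← hi]
      exact (A.equivFin.symm ⟨i.1, h1⟩).2
    · intro hx
      refine ⟨⟨(A.equivFin ⟨x, hx⟩).1, by have := (A.equivFin ⟨x, hx⟩).2; omega⟩, ?_⟩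
      simp
  refine (Finset.card_le_card hsub).trans (Finset.card_image_le.trans ?_)
  simp

lemma term_bound {n d m s : ℕ} (hn : 0 < n) (hm : 0 < m) {c E N : ℝ} (hc : 0 < c) (hE : 0 ≤ E)
    (hN : N ≤ (n:ℝ) ^ (d+1) * ((E/n)^s*(2*n)^(m-1))) :
    N * (c/n)^m ≤ (n:ℝ)^d * ((2*c)^m * (E/n)^s) := by
  have hn' : (0:ℝ) < n := by exact_mod_cast hn
  obtain ⟨k, rfl⟩ : ∃ k, m = k + 1 := ⟨m - 1, by omega⟩
  refine (mul_le_mul_of_nonneg_right hN (by positivity)).trans ?_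
  have h1 : (n:ℝ) ^ (d+1) * ((E/n)^s*(2*n)^(k+1-1)) * (c/n)^(k+1) = (n:ℝ)^d * (2^k * c^(k+1) * (E/n)^s) := by
    rw [Nat.add_sub_cancel, div_pow c, mul_pow]
    field_simp
    ring
  rw [h1, mul_pow]
  gcongr
  · norm_num
  · omega

lemma range1 {d : ℕ} (hd : 2 ≤ d) {c : ℝ} (hc : 0 < c) (M0 : ℕ) : ∃ K : ℝ, 0 < K ∧ ∀ n m : ℕ, 0 < n → 0 < m → m ≤ M0 →
    ((coreS n d m).card : ℝ) * (c/n)^m ≤ K / n * (1/2)^m := by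
  refine ⟨∑ m ∈ Finset.range (M0 + 1), 2 ^ 2 ^ (m-1) * c^m * 2^m, by positivity, fun n m hn hm hM => ?_⟩
  have hn' : (0:ℝ) < n := by exact_mod_cast hn
  have h1 : ((coreS n d m).card : ℝ) ≤ n ^ (m-1) * 2 ^ 2 ^ (m-1) := by
    exact_mod_cast small_count hd m (coreS n d m) (fun Z hZ => by
      obtain ⟨h1, h2, h3, h4⟩ := mem_coreS.1 hZ
      exact ⟨h1, h2.1, h3, h4⟩)
  have h2 : (2:ℝ) ^ 2 ^ (m-1) * c^m * 2^m ≤ ∑ m ∈ Finset.range (M0 + 1), (2:ℝ) ^ 2 ^ (m-1) * c^m * 2^m :=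
    Finset.single_le_sum (f := fun m => (2:ℝ) ^ 2 ^ (m-1) * c^m * 2^m) (fun i _ => by positivity) (by simp; omega)
  refine (mul_le_mul_of_nonneg_right h1 (by positivity)).trans ?_
  have h3 : (n:ℝ) ^ (m-1) * 2 ^ 2 ^ (m-1) * (c/n)^m = (2:ℝ) ^ 2 ^ (m-1) * c^m * 2^m / n * (1/2)^m := by
    obtain ⟨k, rfl⟩ : ∃ k, m = k + 1 := ⟨m - 1, by omega⟩
    rw [Nat.add_sub_cancel, div_pow c, div_pow 1 (2:ℝ)]
    field_simp
    simp
    ring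
  rw [h3]
  gcongr

lemma pow_absorb {x D0 η : ℝ} {m s C : ℕ} (hx0 : 0 ≤ x) (hx : x ≤ D0) (hD : 1 ≤ D0) (hms : m ≤ C * s) (hη : 0 ≤ η) :
    x ^ m * η ^ s ≤ (D0 ^ C * η) ^ s := by
  rw [mul_pow, ← pow_mul]
  gcongr
  exact (pow_le_pow_left₀ hx0 hx m).trans (pow_le_pow_right₀ hD hms)

lemma ceil_le {m C s' : ℕ} (hC : 0 < C) (h : m ≤ C * s') : (m + C - 1) / C ≤ s' := by
  have : (m + C - 1) / C < s' + 1 := by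
    rw [Nat.div_lt_iff_lt_mul hC]
    have : (s' + 1) * C = C * s' + C := by ring
    omega
  omega

lemma le_ceil {m C : ℕ} (hC : 0 < C) : m ≤ C * ((m + C - 1) / C) := by
  have h := Nat.lt_mul_div_succ (m + C - 1) hC
  have : C * ((m + C - 1) / C + 1) = C * ((m + C - 1) / C) + C := by ring
  omega

lemma C1d_pos (d : ℕ) : 0 < C1d d := by unfold C1d; omega

lemma range2_sav {n d m : ℕ} {Z : Finset (Finset (Fin n))} (hZ : Z ⊆ allFaces n d) (hm : Z.card = m)
    {K : Finset (Finset (Fin n))} (hK : K ⊆ Z) {τ : Finset (Fin n)} (hτ : τ.card = d) :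
    ((SavF d ∅ K τ).card : ℝ) ≤ 2 ^ d * ((d + 1) * m) := by
  have h := sav_bound (d := d) (A := ∅) (θlo := 0) (θhi := (d+1)*m) hK le_rfl (by positivity) (by
    intro ρ _ _; simp) (by
    intro ρ _ _
    have h1 : (Finset.univ.filter (fun v => v ∉ ρ ∧ 0 < degK Z (insert v ρ))) ⊆ Z.biUnion id := by
      intro v hv
      rw [Finset.mem_filter] at hv
      have h2 := hv.2.2
      unfold degK at h2
      obtain ⟨σ, hσ⟩ := Finset.card_pos.1 h2
      rw [Finset.mem_filter] at hσ
      exact Finset.mem_biUnion.2 ⟨σ, hσ.1, hσ.2 (Finset.mem_insert_self _ _)⟩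
    have h2 : (Z.biUnion id).card ≤ Z.card * (d+1) := by
      refine Finset.card_biUnion_le.trans (Finset.sum_le_card_nsmul _ _ _ fun σ hσ => ?_)
      exact (mem_allFaces.1 (hZ hσ)).le
    have h3 := (Finset.card_le_card h1).trans h2
    rw [hm, mul_comm] at h3
    exact_mod_cast h3) hτ
  simpa using h

lemma RK_empty {n d : ℕ} : RK d (∅ : Finset (Finset (Fin n))) ∅ = 0 := by
  unfold RK
  rw [Finset.card_eq_zero, Finset.filter_eq_empty_iff]
  rintro τ - ⟨-, ⟨B, -, hB, -⟩, -⟩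
  exact absurd hB.1 (Finset.notMem_empty _)

lemma range2 {d : ℕ} (hd : 2 ≤ d) {c : ℝ} (hc : 0 < c) : ∃ K : ℝ, 0 < K ∧ ∀ᶠ n : ℕ in atTop, ∀ m : ℕ,
    2 * C1d d * (2 * d + 2) < m → m ^ 2 ≤ n →
    ((coreS n d m).card : ℝ) * (c/n)^m ≤ K / n * (1/2)^m := by
  set C := 2 * C1d d with hC
  have hC0 : 0 < C := by have := C1d_pos d; omega
  set D0 : ℝ := max 1 (4*c) with hD0
  have hD1 : 1 ≤ D0 := le_max_left _ _
  set B : ℝ := D0 ^ C * (2^d * (d+1)) with hB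
  have hB1 : 1 ≤ B := by
    have h1 : (1:ℝ) ≤ D0 ^ C := one_le_pow₀ hD1
    have h2 : (1:ℝ) ≤ 2^d := one_le_pow₀ (by norm_num)
    have h3 : (1:ℝ) ≤ (d:ℝ)+1 := by have : (0:ℝ) ≤ d := by positivity
                                    linarith
    exact one_le_mul_of_one_le_of_one_le h1 (one_le_mul_of_one_le_of_one_le h2 h3)
  refine ⟨(B^2)^(d+1), by positivity, ?_⟩
  have hev : ∀ᶠ n : ℕ in atTop, B ^ 2 ≤ (n:ℝ) := tendsto_natCast_atTop_atTop.eventually_ge_atTop _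
  filter_upwards [hev, eventually_gt_atTop 0] with n hn hn0 m hmM hmn
  have hn' : (0:ℝ) < n := by exact_mod_cast hn0
  have hmn' : (m:ℝ)^2 ≤ n := by exact_mod_cast hmn
  set E : ℝ := 2^d * ((d+1)*m) with hE
  set s := (m + C - 1) / C with hs
  have hBm : B * m ≤ n := by
    have : (B*m)^2 ≤ (n:ℝ)^2 := by
      rw [mul_pow, sq (n:ℝ)]
      exact mul_le_mul hn hmn' (by positivity) hn'.le
    exact le_of_sq_le_sq this hn'.le
  have hDE : D0 ^ C * E = B * m := by rw [hE, hB]; ring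
  have hm0 : 0 < m := by omega
  have hE0 : 0 < E := by have : (0:ℝ) < m := by exact_mod_cast hm0
                         positivity
  have hEn : E ≤ n := by
    refine le_trans ?_ hBm
    rw [← hDE]
    exact le_mul_of_one_le_left hE0.le (one_le_pow₀ hD1)
  have hcnt := core_count (n := n) hd (A := ∅) (by simp) (by simp) m s E hE0 hEn (by
    intro s' h
    rw [RK_empty, add_zero] at h
    refine ceil_le hC0 (h.trans ?_)
    rw [hC]; nlinarith) (coreS n d m) (by
    intro Z hZ
    obtain ⟨h1, h2, h3, h4⟩ := mem_coreS.1 hZ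
    exact ⟨h1, h2, h4, fun K hK τ hτ => range2_sav h1 h4 hK hτ⟩)
  refine (term_bound hn0 hm0 hc hE0.le hcnt).trans ?_
  have hab : (4*c)^m * (E/n)^s ≤ (D0^C * (E/n))^s :=
    pow_absorb (by positivity) (le_max_right _ _) hD1 (le_ceil hC0) (by positivity)
  have hrw : D0^C * (E/n) = B * m / n := by rw [← hDE]; ring
  rw [hrw] at hab
  have hs1 : 2*d+2 ≤ s := by
    rw [hs, Nat.le_div_iff_mul_le hC0, mul_comm]
    omega
  have h5 : (B*m/n)^s ≤ (B*m/n)^(2*d+2) := pow_le_pow_of_le_one (by positivity) ((div_le_one hn').2 hBm) hs1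
  have h6 : (B*m/n)^(2*d+2) ≤ (B^2)^(d+1) / n^(d+1) := by
    have : (B*m/n)^(2*d+2) = ((B*m/n)^2)^(d+1) := by rw [← pow_mul]; ring_nf
    rw [this, ← div_pow]
    gcongr
    rw [div_pow, mul_pow, div_le_div_iff₀ (by positivity) hn']
    have : B^2 * (m:ℝ)^2 * n ≤ B^2 * n * n := by gcongr
    linarith [this, sq (n:ℝ)]
  have h7 : (2*c)^m = (4*c)^m * (1/2)^m := by rw [← mul_pow]; congr 1; ring
  rw [h7]
  calc (n:ℝ)^d * ((4*c)^m * (1/2)^m * (E/n)^s) = (n:ℝ)^d * ((4*c)^m * (E/n)^s) * (1/2)^m := by ring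
    _ ≤ (n:ℝ)^d * ((B^2)^(d+1) / n^(d+1)) * (1/2)^m := by
        gcongr
        exact hab.trans (h5.trans h6)
    _ = _ := by rw [pow_succ (n:ℝ)]; field_simp


lemma ev_fam (d : ℕ) {K : ℝ} (hK : 0 < K) : ∀ᶠ n : ℕ in atTop, ∀ h m : ℕ, (h:ℝ) * n ≤ K * m →
    ((((n:ℝ)+1)^d + 1))^h ≤ 2^m := by
  set r : ℝ := Real.exp (Real.log 2 / K) with hr
  have hr1 : 1 < r := by
    rw [hr, Real.one_lt_exp_iff]
    have := Real.log_pos (by norm_num : (1:ℝ) < 2)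
    positivity
  have ht := tendsto_pow_const_div_const_pow_of_one_lt d hr1
  have hev := ht.eventually_le_const (by positivity : (0:ℝ) < 1 / 2^(d+1))
  filter_upwards [hev, eventually_gt_atTop 0] with n hn hn0 h m hhm
  have hn' : (1:ℝ) ≤ n := by exact_mod_cast hn0
  have h1 : ((n:ℝ)+1)^d + 1 ≤ r^n := by
    rw [div_le_div_iff₀ (by positivity) (by positivity)] at hn
    have h2 : ((n:ℝ)+1)^d ≤ (2*n)^d := by gcongr; linarith
    have h3 : (1:ℝ) ≤ (2*n)^d := one_le_pow₀ (by linarith)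
    have h4 : (2*(n:ℝ))^d * 2 = n^d * 2^(d+1) := by rw [mul_pow]; ring
    linarith
  calc (((n:ℝ)+1)^d + 1)^h ≤ (r^n)^h := by gcongr
    _ = Real.exp (Real.log 2 / K * (h * n)) := by
        rw [hr, ← pow_mul, ← Real.exp_nat_mul]; congr 1; push_cast; ring
    _ ≤ Real.exp (m * Real.log 2) := by
        rw [Real.exp_le_exp]
        have h5 : Real.log 2 / K * (h*n) ≤ Real.log 2 / K * (K*m) := by
          gcongr
        refine h5.trans (le_of_eq ?_)
        field_simp
    _ = 2^m := by rw [Real.exp_nat_mul, Real.exp_log (by norm_num)]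

lemma range3 {d : ℕ} (hd : 2 ≤ d) {c : ℝ} (hc : 0 < c) : ∃ δ : ℝ, 0 < δ ∧ ∀ᶠ n : ℕ in atTop, ∀ m : ℕ,
    n < m ^ 2 → (m:ℝ) ≤ δ * n^d →
    ((coreS n d m).card : ℝ) * (c/n)^m ≤ 1 / n * (1/2)^m := by
  set C := 2 * C1d d with hC
  have hC0 : 0 < C := by have := C1d_pos d; omega
  have hC0' : (0:ℝ) < C := by exact_mod_cast hC0
  have hd0 : (0:ℝ) < d := by exact_mod_cast (by omega : 0 < d)
  set D0 : ℝ := max 1 (16*c) with hD0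
  have hD1 : 1 ≤ D0 := le_max_left _ _
  set D : ℝ := D0 ^ C with hD
  have hDD : 1 ≤ D := one_le_pow₀ hD1
  have hDp : 0 < D := by linarith
  set δ1 : ℝ := 1 / (2^(d+1) * D) with hδ1
  have hdelta_one : 0 < δ1 := by positivity
  set Q : ℝ := C * 2^d * (d * (d+1)) with hQ
  have hQ1 : 1 ≤ Q := by
    have h0 : (1:ℝ) ≤ C := by exact_mod_cast hC0
    have h2 : (1:ℝ) ≤ 2^d := one_le_pow₀ (by norm_num)
    have h3 : (1:ℝ) ≤ d := by exact_mod_cast (by omega : 1 ≤ d)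
    exact one_le_mul_of_one_le_of_one_le (one_le_mul_of_one_le_of_one_le h0 h2)
      (one_le_mul_of_one_le_of_one_le h3 (by linarith))
  have hQp : 0 < Q := by linarith
  set δ2 : ℝ := δ1 / Q with hδ2
  have hdelta_two : 0 < δ2 := by positivity
  have hδ21 : δ2 ≤ δ1 := div_le_self hdelta_one.le hQ1
  set δ : ℝ := δ2^(d-1) * δ1 / (2 * (d^d * (d+1))) with hδ
  refine ⟨δ, by positivity, ?_⟩
  set Kf : ℝ := d * (d * (d+1)) / δ1 with hKf
  have hev1 : ∀ᶠ n : ℕ in atTop, (d:ℝ) / δ2 ≤ (n:ℝ) := tendsto_natCast_atTop_atTop.eventually_ge_atTop _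
  have hev2 : ∀ᶠ n : ℕ in atTop, ∀ m : ℕ, n < m^2 → (n:ℝ)^(d+1) ≤ 2^m := by
    have ht := tendsto_pow_const_div_const_pow_of_one_lt (2*(d+1)) (by norm_num : (1:ℝ) < 2)
    have hev := ht.eventually_le_const (by norm_num : (0:ℝ) < 1)
    obtain ⟨m0, hm0⟩ := eventually_atTop.1 hev
    filter_upwards [eventually_ge_atTop (m0^2)] with n hn m hm
    have h1 : m0 ≤ m := by
      by_contra h
      have := Nat.pow_le_pow_left (by omega : m ≤ m0) 2
      omega
    have h2 := hm0 m h1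
    rw [div_le_one (by positivity)] at h2
    refine le_trans ?_ h2
    rw [pow_mul]
    gcongr
    exact_mod_cast hm.le
  filter_upwards [hev1, hev2, ev_fam d (by positivity : 0 < Kf), eventually_gt_atTop 0] with n hn1 hn2 hn3 hn0 m hmn hmδ
  have hn' : (0:ℝ) < n := by exact_mod_cast hn0
  have hm0 : 0 < m := by
    rcases Nat.eq_zero_or_pos m with h | h
    · subst h; simp at hmn
    · exact h
  have hmp : (0:ℝ) < m := by exact_mod_cast hm0
  set s := (m + C - 1) / C with hs
  set E : ℝ := n / D with hE
  have hE0 : 0 < E := by positivity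
  have hEn : E ≤ n := div_le_self hn'.le hDD
  set h : ℕ := ⌊Kf * m / n⌋₊ with hh
  have hhb : (h:ℝ) * n ≤ Kf * m := by
    have := Nat.floor_le (by positivity : 0 ≤ Kf * m / n)
    rwa [← hh, le_div_iff₀ hn'] at this
  set Fam : Finset (Finset (Finset (Fin n))) := Finset.univ.filter (fun A => ∅ ∉ A ∧ (∀ B ∈ A, B.card + 1 ≤ d) ∧
    A.card ≤ h ∧ C * RK d A ∅ ≤ m) with hFam
  set SA : Finset (Finset (Fin n)) → Finset (Finset (Finset (Fin n))) := fun A => (coreS n d m).filter (fun Z =>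
    ∀ K ⊆ Z, ∀ τ : Finset (Fin n), τ.card = d → ((SavF d A K τ).card : ℝ) ≤ E) with hSA
  have hcov : coreS n d m ⊆ Fam.biUnion SA := by
    intro Z hZ
    obtain ⟨h1, h2, h3, h4⟩ := mem_coreS.1 hZ
    obtain ⟨A, hA0, hA, hAc, hAR, hAS⟩ := heavy_exists hd h1 h4 (θlo := δ2 * n) (θhi := δ1 * n)
      (by rw [div_le_iff₀ hdelta_two] at hn1; linarith) (by positivity) (by
        have e1 : (δ2 * n)^(d-1) * (δ1 * n) = δ2^(d-1) * δ1 * n^d := by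
          obtain ⟨k, rfl⟩ : ∃ k, d = k + 1 := ⟨d - 1, by omega⟩
          rw [Nat.add_sub_cancel, mul_pow]; ring
        rw [e1]
        have e2 : (d:ℝ)^d * (d+1) * m ≤ d^d * (d+1) * (δ * n^d) := by gcongr
        refine e2.trans_lt ?_
        have e3 : (d:ℝ)^d * (d+1) * (δ * n^d) = δ2^(d-1) * δ1 * n^d / 2 := by
          rw [hδ]; field_simp
        rw [e3]
        have : 0 < δ2^(d-1) * δ1 * n^d := by positivity
        linarith)
    rw [Finset.mem_biUnion]
    refine ⟨A, ?_, ?_⟩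
    · rw [hFam, Finset.mem_filter]
      refine ⟨Finset.mem_univ _, hA0, hA, ?_, ?_⟩
      · rw [hh, Nat.le_floor_iff (by positivity), le_div_iff₀ hn', hKf]
        have e4 : (A.card:ℝ) * n * δ1 ≤ d * (d * (d+1)) * m := by
          have : (A.card:ℝ) * (δ1 * n) = A.card * n * δ1 := by ring
          rw [← this]; linarith
        rw [div_mul_eq_mul_div, le_div_iff₀ hdelta_one]
        exact e4
      · have e5 : (RK d A ∅ : ℝ) * (δ1 * n) ≤ 2^d * (δ1 / Q * n) * (d*(d+1)*m) := hAR
        have e6 : 2^d * (δ1 / Q * n) * (d*(d+1)*m) = (m / C) * (δ1 * n) := by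
          rw [hQ]; field_simp
        rw [e6] at e5
        have e7 := le_of_mul_le_mul_right e5 (by positivity)
        rw [le_div_iff₀ hC0', mul_comm] at e7
        exact_mod_cast e7
    · rw [hSA]
      simp only [Finset.mem_filter]
      refine ⟨hZ, fun K hK τ hτ => (hAS K hK τ hτ).trans ?_⟩
      rw [hE]
      calc (2:ℝ)^d * (δ2 * n + δ1 * n) ≤ 2^d * (δ1 * n + δ1 * n) := by gcongr
        _ = n / D := by rw [hδ1, pow_succ]; field_simp; ring
  have hcntA : ∀ A ∈ Fam, ((SA A).card : ℝ) ≤ (n:ℝ) ^ (d+1) * ((E/n)^s*(2*n)^(m-1)) := by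
    intro A hA
    rw [hFam, Finset.mem_filter] at hA
    obtain ⟨-, hA0, hA1, -, hAR⟩ := hA
    refine core_count hd hA0 hA1 m s E hE0 hEn ?_ _ ?_
    · intro s' hs'
      refine ceil_le hC0 ?_
      have : C * RK d A ∅ = 2 * (C1d d * RK d A ∅) := by rw [hC]; ring
      have e2 : C * s' = 2 * (C1d d * s') := by rw [hC]; ring
      rw [mul_add] at hs'
      omega
    · intro Z hZ
      rw [hSA, Finset.mem_filter] at hZ
      obtain ⟨h1, h2, h3, h4⟩ := mem_coreS.1 hZ.1
      exact ⟨h1, h2, h4, hZ.2⟩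
  have hFamc : (Fam.card : ℝ) ≤ 2^m := by
    set U : Finset (Finset (Fin n)) := Finset.univ.filter (fun B => B.card ≤ d) with hU
    have hUc : U.card ≤ (n+1)^d := by
      have := card_small_subsets d U (fun A hA => by rw [hU, Finset.mem_filter] at hA; exact hA.2)
      simpa using this
    have hF1 : Fam.card ≤ (U.card + 1)^h := by
      have := card_small_subsets (α := U) h (Fam.image (fun A => A.subtype (fun x => x ∈ U))) (by
        intro A hA
        rw [Finset.mem_image] at hA
        obtain ⟨A', hA', rfl⟩ := hA
        rw [hFam, Finset.mem_filter] at hA'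
        rw [Finset.card_subtype]
        exact (Finset.card_filter_le _ _).trans hA'.2.2.2.1)
      rw [Fintype.card_coe] at this
      rw [Finset.card_image_of_injOn] at this
      · exact this
      · intro A hA A' hA' heq
        have hsub : ∀ A ∈ Fam, ∀ x ∈ A, x ∈ U := by
          intro A hA x hx
          rw [hFam, Finset.mem_filter] at hA
          rw [hU, Finset.mem_filter]
          have := hA.2.2.1 x hx
          exact ⟨Finset.mem_univ _, by omega⟩
        have h1 := congrArg (fun s => s.map (Function.Embedding.subtype _)) heq
        simp only at h1
        rwa [Finset.subtype_map_of_mem (hsub A hA), Finset.subtype_map_of_mem (hsub A' hA')] at h1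
    refine le_trans ?_ (hn3 h m hhb)
    have : (Fam.card:ℝ) ≤ ((U.card:ℝ) + 1)^h := by exact_mod_cast hF1
    refine this.trans ?_
    gcongr
    exact_mod_cast hUc
  have hcnt : ((coreS n d m).card : ℝ) ≤ 2^m * ((n:ℝ) ^ (d+1) * ((E/n)^s*(2*n)^(m-1))) := by
    have h1 : ((coreS n d m).card : ℝ) ≤ ∑ A ∈ Fam, ((SA A).card : ℝ) := by
      exact_mod_cast (Finset.card_le_card hcov).trans Finset.card_biUnion_le
    refine h1.trans ((Finset.sum_le_card_nsmul _ _ _ hcntA).trans ?_)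
    rw [nsmul_eq_mul]
    gcongr
  have ht := term_bound hn0 hm0 hc hE0.le (le_refl ((n:ℝ) ^ (d+1) * ((E/n)^s*(2*n)^(m-1))))
  have hab : (16*c)^m * (E/n)^s ≤ (D0^C * (E/n))^s :=
    pow_absorb (by positivity) (le_max_right _ _) hD1 (le_ceil hC0) (by positivity)
  have hrw : D0^C * (E/n) = 1 := by rw [← hD, hE]; field_simp
  rw [hrw, one_pow] at hab
  have h9 := hn2 m hmn
  calc ((coreS n d m).card : ℝ) * (c/n)^m ≤ 2^m * ((n:ℝ) ^ (d+1) * ((E/n)^s*(2*n)^(m-1))) * (c/n)^m := by gcongr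
    _ = 2^m * ((n:ℝ) ^ (d+1) * ((E/n)^s*(2*n)^(m-1)) * (c/n)^m) := by ring
    _ ≤ 2^m * ((n:ℝ)^d * ((2*c)^m * (E/n)^s)) := by gcongr
    _ = (n:ℝ)^d * ((16*c)^m * (E/n)^s) * ((1/2)^m * (1/2)^m) := by
        have e1 : (16*c)^m = 2^m * 2^m * 2^m * (2*c)^m := by rw [← mul_pow, ← mul_pow, ← mul_pow]; congr 1; ring
        have e2 : (2:ℝ)^m * (1/2)^m = 1 := by rw [← mul_pow]; norm_num
        rw [e1]
        calc _ = 2^m * ((n:ℝ)^d * ((2*c)^m * (E/n)^s)) * 1 * 1 := by ring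
          _ = 2^m * ((n:ℝ)^d * ((2*c)^m * (E/n)^s)) * ((2:ℝ)^m * (1/2)^m) * ((2:ℝ)^m * (1/2)^m) := by rw [e2]
          _ = _ := by ring
    _ ≤ (n:ℝ)^d * 1 * ((1/2)^m * (1/2)^m) := by gcongr
    _ = (1/n) * (1/2)^m * ((n:ℝ)^(d+1) * (1/2)^m) := by rw [pow_succ (n:ℝ)]; field_simp
    _ ≤ (1/n) * (1/2)^m * 1 := by
        gcongr
        rw [one_div, inv_pow, ← div_eq_mul_inv, div_le_one (by positivity)]
        exact h9
    _ = _ := by ring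

/-- union bound over small cores -/
lemma cores_small {d : ℕ} (hd : 2 ≤ d) {c : ℝ} (hc : 0 < c) : ∃ δ K : ℝ, 0 < δ ∧ 0 < K ∧ ∀ᶠ n : ℕ in atTop,
    ∀ m : ℕ, 0 < m → (m:ℝ) ≤ δ * n^d → ((coreS n d m).card : ℝ) * (c/n)^m ≤ K / n * (1/2)^m := by
  obtain ⟨K1, hK1, h1⟩ := range1 hd hc (2 * C1d d * (2 * d + 2))
  obtain ⟨K2, hK2, h2⟩ := range2 hd hc
  obtain ⟨δ, hδ, h3⟩ := range3 hd hc
  refine ⟨δ, K1 + K2 + 1, hδ, by positivity, ?_⟩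
  filter_upwards [h2, h3, eventually_gt_atTop 0] with n h2 h3 hn m hm hmδ
  have hn' : (0:ℝ) < n := by exact_mod_cast hn
  have key : ∀ K : ℝ, K ≤ K1 + K2 + 1 → K / n * (1/2)^m ≤ (K1+K2+1)/n * (1/2)^m := by
    intro K hK; gcongr
  rcases le_or_gt m (2 * C1d d * (2 * d + 2)) with h | h
  · exact (h1 n m hn hm h).trans (key _ (by linarith))
  · rcases le_or_gt (m^2) n with h' | h'
    · exact (h2 m h h').trans (key _ (by linarith))
    · exact (h3 m h' hmδ).trans (key _ (by linarith))

end assemG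

end Part16

section Part17

section bad

def hasCore {n : ℕ} (d : ℕ) (L : ℝ) (F : Finset (Finset (Fin n))) : Prop :=
  ∃ Z ⊆ F, isCore d Z ∧ simplexFree d Z ∧ (Z.card : ℝ) ≤ L

lemma exists_minCore {n d : ℕ} {Z : Finset (Finset (Fin n))} (h : isCore d Z) : ∃ K ⊆ Z, minCore d K := by
  induction hm : Z.card using Nat.strong_induction_on generalizing Z with
  | _ m ih =>
    by_cases h1 : ∃ K, K ⊆ Z ∧ isCore d K ∧ K ≠ Z
    · obtain ⟨K, hK, hKc, hne⟩ := h1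
      have hlt := Finset.card_lt_card (Finset.ssubset_iff_subset_ne.2 ⟨hK, hne⟩)
      obtain ⟨K', hK', h'⟩ := ih K.card (by omega) hKc rfl
      exact ⟨K', hK'.trans hK, h'⟩
    · push Not at h1
      exact ⟨Z, subset_rfl, h, h1⟩

lemma simplexFree_mono {n d : ℕ} {K Z : Finset (Finset (Fin n))} (h : K ⊆ Z) (hZ : simplexFree d Z) : simplexFree d K := by
  intro T hT
  obtain ⟨v, hv, h1⟩ := hZ T hT
  exact ⟨v, hv, fun h2 => h1 (h h2)⟩

lemma core_prob {d : ℕ} (hd : 2 ≤ d) {c : ℝ} (hc : 0 < c) : ∃ δ : ℝ, 0 < δ ∧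
    Tendsto (fun n : ℕ => Ew (allFaces n d) (c/n) (fun F => if hasCore d (δ * n^d) F then 1 else 0)) atTop (nhds 0) := by
  obtain ⟨δ, K, hδ, hK, hev⟩ := cores_small hd hc
  refine ⟨δ, hδ, ?_⟩
  have hlim : Tendsto (fun n : ℕ => 2 * K / (n:ℝ)) atTop (nhds 0) := tendsto_const_div_atTop_nhds_zero_nat _
  refine tendsto_of_tendsto_of_tendsto_of_le_of_le' tendsto_const_nhds hlim ?_ ?_
  · filter_upwards [eventually_p_le_one c] with n hn
    exact Ew_nonneg (by positivity) hn fun F _ => by split_ifs <;> norm_num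
  · filter_upwards [eventually_p_le_one c, hev, eventually_gt_atTop 0] with n hn h hn0
    have hn' : (0:ℝ) < n := by exact_mod_cast hn0
    set M := ⌊δ * (n:ℝ)^d⌋₊ with hM
    set S : Finset (Finset (Finset (Fin n))) := (Finset.Icc 1 M).biUnion (fun m => coreS n d m) with hS
    have hSsub : ∀ Z ∈ S, Z ⊆ allFaces n d := by
      intro Z hZ
      rw [hS, Finset.mem_biUnion] at hZ
      obtain ⟨m, -, hm⟩ := hZ
      exact (mem_coreS.1 hm).1
    have hEx := Ew_exists_subset_le (A := allFaces n d) (p := c/n) (by positivity) hn S hSsub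
    calc Ew (allFaces n d) (c/n) (fun F => if hasCore d (δ * n^d) F then 1 else 0)
        ≤ Ew (allFaces n d) (c/n) (fun F => if ∃ Z ∈ S, Z ⊆ F then 1 else 0) := by
          refine Ew_mono (by positivity) hn fun F hF => ?_
          by_cases hcore : hasCore d (δ * n^d) F
          · rw [if_pos hcore, if_pos]
            obtain ⟨Z, hZF, hZc, hZs, hZL⟩ := hcore
            obtain ⟨K, hKZ, hKm⟩ := exists_minCore hZc
            refine ⟨K, ?_, hKZ.trans hZF⟩
            rw [hS, Finset.mem_biUnion]
            refine ⟨K.card, ?_, mem_coreS.2 ⟨(hKZ.trans hZF).trans hF, hKm, simplexFree_mono hKZ hZs, rfl⟩⟩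
            rw [Finset.mem_Icc]
            refine ⟨Finset.card_pos.2 hKm.1.1, ?_⟩
            rw [hM, Nat.le_floor_iff (by positivity)]
            have hKc : (K.card:ℝ) ≤ Z.card := by exact_mod_cast Finset.card_le_card hKZ
            exact hKc.trans hZL
          · rw [if_neg hcore]; split_ifs <;> norm_num
      _ ≤ ∑ Z ∈ S, (c/n)^Z.card := by
          refine le_trans (le_of_eq (Ew_congr fun F _ => ?_)) hEx
          split_ifs <;> rfl
      _ ≤ ∑ m ∈ Finset.Icc 1 M, ∑ Z ∈ coreS n d m, (c/n)^Z.card := by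
          rw [hS, Finset.sum_biUnion]
          intro m _ m' _ hne
          rw [Function.onFun, Finset.disjoint_left]
          intro Z hZ hZ'
          exact hne ((mem_coreS.1 hZ).2.2.2.symm.trans (mem_coreS.1 hZ').2.2.2)
      _ = ∑ m ∈ Finset.Icc 1 M, ((coreS n d m).card : ℝ) * (c/n)^m := by
          refine Finset.sum_congr rfl fun m _ => ?_
          rw [← nsmul_eq_mul, ← Finset.sum_const]
          exact Finset.sum_congr rfl fun Z hZ => by rw [(mem_coreS.1 hZ).2.2.2]
      _ ≤ ∑ m ∈ Finset.Icc 1 M, K / n * (1/2)^m := by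
          refine Finset.sum_le_sum fun m hm => ?_
          rw [Finset.mem_Icc] at hm
          refine h m hm.1 ?_
          exact (Nat.le_floor_iff (by positivity)).1 hm.2
      _ ≤ K / n * 2 := by
          rw [← Finset.mul_sum]
          gcongr
          exact (summable_geometric_two.sum_le_tsum _ (fun _ _ => by positivity)).trans tsum_geometric_two.le
      _ = 2 * K / n := by ring

lemma Ew_inter_card {α : Type*} {A S : Finset α} (h : S ⊆ A) (q : ℝ) :
    Ew A q (fun R => ((R ∩ S).card : ℝ)) = q * S.card := by
  rw [← Ew_card]
  rw [Ew_restrict h q _ (fun F _ => by congr 2; ext; simp)]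
  refine Ew_congr fun F hF => ?_
  rw [Finset.inter_eq_left.2 hF]

lemma Ew_inter_card' {α : Type*} [DecidableEq α] {A S : Finset α} (h : S ⊆ A) (q : ℝ) :
    Ew A q (fun R => ((R ∩ S).card : ℝ)) = q * S.card := by
  rw [← Ew_inter_card h q]
  refine Ew_congr fun F _ => ?_
  congr!

lemma Ew_sprinkle' {α : Type*} [DecidableEq α] (A : Finset α) (p q : ℝ) (g : Finset α → ℝ) :
    Ew A p (fun F => Ew A q (fun R => g (F ∪ R))) = Ew A (p + q - p * q) g := by
  rw [← Ew_sprinkle]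
  refine Ew_congr fun F _ => Ew_congr fun R _ => ?_
  congr!

lemma Ew_insert' {α : Type*} [DecidableEq α] {A : Finset α} {a : α} (ha : a ∉ A) (p : ℝ) (g : Finset α → ℝ) :
    Ew (insert a A) p g = (1 - p) * Ew A p g + p * Ew A p (fun F => g (insert a F)) := by
  have := Ew_insert ha p g
  convert this

lemma shadow_sprinkle {n d : ℕ} {p q : ℝ} (hp0 : 0 ≤ p) (hp1 : p ≤ 1) (hq0 : 0 ≤ q) (hq1 : q ≤ 1) :
    q * Ew (allFaces n d) p (fun F => ((shadowR n d F).card : ℝ)) ≤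
      Ew (allFaces n d) (p + q - p * q) (fun F => (dimKer n F : ℝ)) := by
  rw [← Ew_sprinkle', ← Ew_mul]
  refine Ew_mono hp0 hp1 fun F _ => ?_
  rw [← Ew_inter_card' (A := allFaces n d) (fun σ hσ => (mem_shadowR.1 hσ).1)]
  refine Ew_mono hq0 hq1 fun R _ => ?_
  exact_mod_cast dimKer_union_ge F R

lemma cyc_shadow {n d : ℕ} {p : ℝ} :
    (1 - p) * Ew (allFaces n d) p (fun F => ((cycF F).card : ℝ)) =
      p * Ew (allFaces n d) p (fun F => ((shadowR n d F).card : ℝ)) := by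
  have h1 : Ew (allFaces n d) p (fun F => ((cycF F).card : ℝ)) =
      ∑ σ ∈ allFaces n d, Ew (allFaces n d) p (fun F => if σ ∈ F ∧ colv σ ∈ Wsp (F.erase σ) then 1 else 0) := by
    rw [← Ew_sum]
    refine Ew_congr fun F hF => ?_
    rw [Finset.sum_boole]
    congr 2
    ext σ
    simp only [cycF, Finset.mem_filter]
    exact ⟨fun h => ⟨hF h.1, h⟩, fun h => h.2⟩
  have h2 : Ew (allFaces n d) p (fun F => ((shadowR n d F).card : ℝ)) =
      ∑ σ ∈ allFaces n d, Ew (allFaces n d) p (fun F => if σ ∉ F ∧ colv σ ∈ Wsp F then 1 else 0) := by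
    rw [← Ew_sum]
    refine Ew_congr fun F hF => ?_
    rw [Finset.sum_boole]
    congr 2
    ext σ
    rw [mem_shadowR, Finset.mem_filter]
  rw [h1, h2, Finset.mul_sum, Finset.mul_sum]
  refine Finset.sum_congr rfl fun σ hσ => ?_
  have hA : allFaces n d = insert σ ((allFaces n d).erase σ) := (Finset.insert_erase hσ).symm
  have hn : σ ∉ (allFaces n d).erase σ := Finset.notMem_erase _ _
  rw [hA, Ew_insert' hn, Ew_insert' hn]
  have hF : ∀ F, F ⊆ (allFaces n d).erase σ → σ ∉ F := fun F hF h => hn (hF h)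
  have e1 : Ew ((allFaces n d).erase σ) p (fun F => if σ ∈ F ∧ colv σ ∈ Wsp (F.erase σ) then (1:ℝ) else 0) = 0 := by
    rw [Ew_congr (g' := fun _ => 0), Ew_const]
    intro F h; simp [hF F h]
  have e2 : Ew ((allFaces n d).erase σ) p (fun F => if σ ∉ insert σ F ∧ colv σ ∈ Wsp (insert σ F) then (1:ℝ) else 0) = 0 := by
    rw [Ew_congr (g' := fun _ => 0), Ew_const]
    intro F h; simp
  have e3 : Ew ((allFaces n d).erase σ) p (fun F => if σ ∈ insert σ F ∧ colv σ ∈ Wsp ((insert σ F).erase σ) then (1:ℝ) else 0) =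
      Ew ((allFaces n d).erase σ) p (fun F => if σ ∉ F ∧ colv σ ∈ Wsp F then (1:ℝ) else 0) := by
    refine Ew_congr fun F h => ?_
    rw [Finset.erase_insert (hF F h)]
    simp [hF F h]
  rw [e1, e2, e3]
  ring

lemma Ew_inter_empty {α : Type*} {A S : Finset α} (h : S ⊆ A) (q : ℝ) :
    Ew A q (fun R => if R ∩ S = ∅ then 1 else 0) = (1-q)^S.card := by
  rw [Ew_restrict h q _ (fun F _ => by simp [Finset.inter_assoc])]
  have h1 : Ew S q (fun R => if R ∩ S = ∅ then (1:ℝ) else 0) = Ew S q (fun R => if R = ∅ then 1 else 0) :=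
    Ew_congr fun F hF => by rw [Finset.inter_eq_left.2 hF]
  rw [h1]
  clear h h1
  induction S using Finset.induction_on with
  | empty => simp [Ew_empty]
  | insert a S ha ih =>
    rw [Ew_insert ha, ih]
    have : Ew S q (fun F => if insert a F = ∅ then (1:ℝ) else 0) = 0 := by
      rw [Ew_congr (g' := fun _ => 0), Ew_const]
      intro F _; simp
    rw [this, Finset.card_insert_of_notMem ha]
    ring

lemma Ew_inter_empty' {α : Type*} [DecidableEq α] {A S : Finset α} (h : S ⊆ A) (q : ℝ) :
    Ew A q (fun R => if R ∩ S = ∅ then 1 else 0) = (1-q)^S.card := by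
  rw [← Ew_inter_empty h q]
  refine Ew_congr fun F _ => ?_
  congr!

/-- sprinkling parameter -/
lemma sprinkle_q {n : ℕ} {c c1 : ℝ} (hc : 0 < c) (hcc : c < c1) (hn0 : 0 < n) (hn : c1 / n < 1) :
    ∃ q : ℝ, 0 ≤ q ∧ q ≤ 1 ∧ (c1 - c)/n ≤ q ∧ c/n + q - c/n*q = c1/n := by
  have hn' : (0:ℝ) < n := by exact_mod_cast hn0
  have h1 : c/n < c1/n := by gcongr
  have h0 : 0 < c/n := by positivity
  have h2 : 0 < 1 - c/n := by linarith
  refine ⟨(c1/n - c/n)/(1 - c/n), div_nonneg (by linarith) h2.le, ?_, ?_, ?_⟩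
  · rw [div_le_one h2]; linarith
  · rw [sub_div, le_div_iff₀ h2]
    nlinarith
  · generalize c/n = x at *
    generalize c1/n = y at *
    have : (1 - x) * ((y - x)/(1-x)) = y - x := mul_div_cancel₀ _ h2.ne'
    linarith

lemma eventually_p_lt_one (c : ℝ) : ∀ᶠ n : ℕ in atTop, c / n < 1 := by
  have := tendsto_const_div_atTop_nhds_zero_nat c
  exact this.eventually_lt_const (by norm_num)

lemma eventually_p_le_half (c : ℝ) : ∀ᶠ n : ℕ in atTop, c / n ≤ 1/2 := by
  have := tendsto_const_div_atTop_nhds_zero_nat c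
  exact this.eventually_le_const (by norm_num)

lemma cyc_small (d : ℕ) (hd : 2 ≤ d) (c td : ℝ) (hc0 : 0 < c) (htd : td ∈ Set.Ioo (0:ℝ) 1)
    (hroot : ((d:ℝ)+1)*(1-td)+(1+d*td)*Real.log td = 0) (hc : c < -Real.log td/(1-td)^d) (ε : ℝ) (hε : 0 < ε) :
    ∀ᶠ n : ℕ in atTop, Ew (allFaces n d) (c / n) (fun F => ((cycF F).card : ℝ)) ≤ ε * n ^ d := by
  obtain ⟨c2, hcc2, hc2⟩ := exists_between hc
  have hε' : 0 < ε * (c2 - c) / (2 * c) := by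
    have : 0 < c2 - c := by linarith
    positivity
  filter_upwards [dimKer_small d hd c2 td (hc0.trans hcc2) htd hroot hc2 _ hε', eventually_gt_atTop 0,
    eventually_p_lt_one c2, eventually_p_le_half c] with n h hn0 hn2 hn1
  have hn' : (0:ℝ) < n := by exact_mod_cast hn0
  obtain ⟨q, hq0, hq1, hq, hqe⟩ := sprinkle_q hc0 hcc2 hn0 hn2
  have hp0 : 0 ≤ c / n := by positivity
  have h3 := shadow_sprinkle (n := n) (d := d) hp0 (by linarith : c/n ≤ 1) hq0 hq1
  rw [hqe] at h3
  set X := Ew (allFaces n d) (c/n) (fun F => ((shadowR n d F).card : ℝ)) with hX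
  set Y := Ew (allFaces n d) (c/n) (fun F => ((cycF F).card : ℝ)) with hY
  have hX0 : 0 ≤ X := Ew_nonneg hp0 (by linarith) fun F _ => by positivity
  have hY0 : 0 ≤ Y := Ew_nonneg hp0 (by linarith) fun F _ => by positivity
  have h4 : (1 - c/n) * Y = c/n * X := cyc_shadow
  have h5 : (c2 - c)/n * X ≤ ε * (c2 - c) / (2*c) * n^d := (mul_le_mul_of_nonneg_right hq hX0).trans (h3.trans h)
  have h6 : c/n * X ≤ ε/2 * n^d := by
    have h7 : c/n * X = (c/(c2-c)) * ((c2-c)/n * X) := by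
      have : c2 - c ≠ 0 := by linarith
      field_simp
    have h8 : (c/(c2-c)) * (ε * (c2 - c) / (2*c) * n^d) = ε/2 * n^d := by
      have : c2 - c ≠ 0 := by linarith
      field_simp
    rw [h7, ← h8]
    have : 0 < c2 - c := by linarith
    gcongr
  nlinarith

/-- shadow faces not completing a simplex -/
def shOther (n d : ℕ) (F : Finset (Finset (Fin n))) : Finset (Finset (Fin n)) :=
  (shadowR n d F).filter (fun σ => ¬ completes d F σ)

lemma shOther_small (d : ℕ) (hd : 2 ≤ d) (c td : ℝ) (hc0 : 0 < c) (htd : td ∈ Set.Ioo (0:ℝ) 1)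
    (hroot : ((d:ℝ)+1)*(1-td)+(1+d*td)*Real.log td = 0) (hc : c < -Real.log td/(1-td)^d) :
    Tendsto (fun n : ℕ => Ew (allFaces n d) (c/n) (fun F => if n ≤ (shOther n d F).card then 1 else 0)) atTop (nhds 0) := by
  obtain ⟨c1, hcc1, hc1⟩ := exists_between hc
  have hc10 : 0 < c1 := hc0.trans hcc1
  obtain ⟨δ, hδ, hcore⟩ := core_prob hd hc10
  set κ : ℝ := 1 - Real.exp (-(c1 - c)) with hκ
  have hκ0 : 0 < κ := by
    have : Real.exp (-(c1 - c)) < 1 := by rw [Real.exp_lt_one_iff]; linarith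
    linarith
  rw [Metric.tendsto_atTop'] at hcore
  rw [tendsto_order]
  refine ⟨fun a ha => ?_, fun ε hε => ?_⟩
  · filter_upwards [eventually_p_le_one c] with n hn
    exact ha.trans_le (Ew_nonneg (by positivity) hn fun F _ => by split_ifs <;> norm_num)
  obtain ⟨N, hN⟩ := hcore (ε * κ / 2) (by positivity)
  filter_upwards [eventually_gt_atTop N, eventually_gt_atTop 0, eventually_p_lt_one c1,
    cyc_small d hd c1 td hc10 htd hroot hc1 (ε * κ * δ / 4) (by positivity)] with n hnN hn0 hn1 hcyc
  have hn' : (0:ℝ) < n := by exact_mod_cast hn0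
  obtain ⟨q, hq0, hq1, hq, hqe⟩ := sprinkle_q hc0 hcc1 hn0 hn1
  have hp0 : 0 ≤ c / n := by positivity
  have hp1 : c / n ≤ 1 := by
    have : c/n < c1/n := by gcongr
    linarith
  have hP1 := hN n hnN
  rw [Real.dist_eq, sub_zero] at hP1
  have hP1 := (le_abs_self _).trans_lt hP1
  set A := allFaces n d with hA
  set Bad : Finset (Finset (Fin n)) → ℝ := fun G => (if hasCore d (δ * n^d) G then 1 else 0) +
    (if δ * n^d ≤ ((cycF G).card : ℝ) then 1 else 0) with hBad
  have hBad0 : ∀ G, 0 ≤ Bad G := by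
    intro G; simp only [hBad]; split_ifs <;> norm_num
  have hPB : Ew A (c1/n) Bad < ε * κ := by
    simp only [hBad]
    rw [Ew_add]
    have hm := Ew_markov (A := A) (p := c1/n) (by positivity) hn1.le (g := fun G => ((cycF G).card : ℝ))
      (fun _ _ => by positivity) (t := δ * n^d) (by positivity)
    have hm2 : Ew A (c1/n) (fun G => ((cycF G).card : ℝ)) / (δ * n^d) ≤ ε * κ / 4 := by
      rw [div_le_iff₀ (by positivity)]
      refine hcyc.trans (le_of_eq ?_)
      ring
    have : 0 < ε * κ := by positivity
    linarith
  have key : κ * Ew A (c/n) (fun F => if n ≤ (shOther n d F).card then 1 else 0) ≤ Ew A (c1/n) Bad := by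
    rw [← hqe, ← Ew_sprinkle', ← Ew_mul]
    refine Ew_mono hp0 hp1 fun F hF => ?_
    split_ifs with hbig
    · have hSsub : shOther n d F ⊆ A := fun σ hσ => (mem_shadowR.1 (Finset.mem_filter.1 hσ).1).1
      have h1 : κ * 1 ≤ Ew A q (fun R => 1 - if R ∩ shOther n d F = ∅ then 1 else 0) := by
        rw [Ew_sub, Ew_const, Ew_inter_empty' hSsub, mul_one, hκ]
        have h2 : (1-q)^(shOther n d F).card ≤ (1-q)^n := pow_le_pow_of_le_one (by linarith) (by linarith) hbig
        have h3 : (1-q)^n ≤ Real.exp (-(c1-c)) := by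
          have h4 : 1 - q ≤ Real.exp (-q) := by have := Real.add_one_le_exp (-q); linarith
          have h5 : (1-q)^n ≤ (Real.exp (-q))^n := pow_le_pow_left₀ (by linarith) h4 n
          refine h5.trans ?_
          rw [← Real.exp_nat_mul, Real.exp_le_exp]
          rw [div_le_iff₀ hn'] at hq
          linarith
        linarith
      refine h1.trans (Ew_mono hq0 hq1 fun R hR => ?_)
      split_ifs with hemp
      · simpa using hBad0 (F ∪ R)
      · obtain ⟨σ, hσ⟩ := Finset.nonempty_iff_ne_empty.2 hemp
        rw [Finset.mem_inter] at hσ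
        obtain ⟨hσR, hσS⟩ := hσ
        unfold shOther at hσS
        rw [Finset.mem_filter, mem_shadowR] at hσS
        obtain ⟨Z, hZ, hZc, hZs, hZcyc⟩ := exists_core hF hσS.1.1 hσS.1.2.1 hσS.1.2.2 hσS.2
        have hsub : insert σ F ⊆ F ∪ R := by
          intro x hx
          rw [Finset.mem_insert] at hx
          rcases hx with rfl | hx
          · exact Finset.mem_union_right _ hσR
          · exact Finset.mem_union_left _ hx
        simp only [hBad, sub_zero]
        by_cases hL : (Z.card:ℝ) ≤ δ * n^d
        · have hh : hasCore d (δ * n^d) (F ∪ R) := ⟨Z, hZ.trans hsub, hZc, hZs, hL⟩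
          rw [if_pos hh]
          split_ifs <;> norm_num
        · rw [if_pos (show δ * (n:ℝ)^d ≤ ((cycF (F ∪ R)).card : ℝ) from by
            refine (not_le.1 hL).le.trans ?_
            exact_mod_cast Finset.card_le_card (hZcyc.trans (cycF_mono hsub)))]
          split_ifs <;> norm_num
    · rw [mul_zero]
      exact Ew_nonneg hq0 hq1 fun R _ => hBad0 _
  have h9 := key.trans_lt hPB
  rw [mul_comm ε κ] at h9
  exact lt_of_mul_lt_mul_left h9 hκ0.le

end bad

end Part17

section Part18

section moment
variable {n : ℕ}

def JJ (n d : ℕ) : Finset (Finset (Fin n) × Fin n) := Finset.univ.filter (fun j => j.1.card = d + 2 ∧ j.2 ∈ j.1)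

def Sj (j : Finset (Fin n) × Fin n) : Finset (Finset (Fin n)) := (j.1.erase j.2).image (fun u => j.1.erase u)

lemma mem_JJ {d : ℕ} {j : Finset (Fin n) × Fin n} : j ∈ JJ n d ↔ j.1.card = d + 2 ∧ j.2 ∈ j.1 := by
  simp [JJ]

lemma Sj_card {d : ℕ} {j : Finset (Fin n) × Fin n} (hj : j ∈ JJ n d) : (Sj j).card = d + 1 := by
  rw [mem_JJ] at hj
  unfold Sj
  rw [Finset.card_image_of_injOn, Finset.card_erase_of_mem hj.2, hj.1]
  · rfl
  · intro u hu u' hu' h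
    have hu1 : u ∈ j.1 := Finset.mem_of_mem_erase (by exact_mod_cast hu)
    by_contra hne
    have h1 : u ∈ j.1.erase u' := Finset.mem_erase.2 ⟨hne, hu1⟩
    simp only at h
    rw [← h] at h1
    exact Finset.notMem_erase _ _ h1

lemma Sj_sub {d : ℕ} {j : Finset (Fin n) × Fin n} (hj : j ∈ JJ n d) : Sj j ⊆ allFaces n d := by
  rw [mem_JJ] at hj
  intro σ hσ
  unfold Sj at hσ
  rw [Finset.mem_image] at hσ
  obtain ⟨u, hu, rfl⟩ := hσ
  rw [mem_allFaces, Finset.card_erase_of_mem (Finset.mem_of_mem_erase hu), hj.1]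
  rfl

lemma Sj_mem_sub {j : Finset (Fin n) × Fin n} {σ : Finset (Fin n)} (h : σ ∈ Sj j) : σ ⊆ j.1 := by
  unfold Sj at h
  rw [Finset.mem_image] at h
  obtain ⟨u, -, rfl⟩ := h
  exact Finset.erase_subset _ _

/-- adjacent tops -/
def adjT (d : ℕ) (j j' : Finset (Fin n) × Fin n) : Prop := j.1 ≠ j'.1 ∧ (j.1 ∩ j'.1).card = d + 1

lemma inter_card_le {d : ℕ} {T T' : Finset (Fin n)} (hT : T.card = d + 2) (hT' : T'.card = d + 2) (hne : T ≠ T') :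
    (T ∩ T').card ≤ d + 1 := by
  by_contra h
  have h1 : T ∩ T' = T := Finset.eq_of_subset_of_card_le Finset.inter_subset_left (by omega)
  have h2 : T ∩ T' = T' := Finset.eq_of_subset_of_card_le Finset.inter_subset_right (by omega)
  exact hne (h1.symm.trans h2)

lemma Sj_inter {d : ℕ} {j j' : Finset (Fin n) × Fin n} (hj : j ∈ JJ n d) (hj' : j' ∈ JJ n d) (hne : j.1 ≠ j'.1) :
    Sj j ∩ Sj j' ⊆ {j.1 ∩ j'.1} ∧ ((Sj j ∩ Sj j').Nonempty → adjT d j j') := by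
  have h0 := inter_card_le (mem_JJ.1 hj).1 (mem_JJ.1 hj').1 hne
  have key : ∀ σ ∈ Sj j ∩ Sj j', σ = j.1 ∩ j'.1 ∧ (j.1 ∩ j'.1).card = d + 1 := by
    intro σ hσ
    rw [Finset.mem_inter] at hσ
    have h1 := Finset.subset_inter (Sj_mem_sub hσ.1) (Sj_mem_sub hσ.2)
    have h2 := mem_allFaces.1 (Sj_sub hj hσ.1)
    have h3 := Finset.eq_of_subset_of_card_le h1 (by omega)
    exact ⟨h3, by rw [← h3]; exact h2⟩
  refine ⟨fun σ hσ => Finset.mem_singleton.2 (key σ hσ).1, ?_⟩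
  rintro ⟨σ, hσ⟩
  exact ⟨hne, (key σ hσ).2⟩

lemma Sj_union_card {d : ℕ} {j j' : Finset (Fin n) × Fin n} (hj : j ∈ JJ n d) (hj' : j' ∈ JJ n d) (hne : j.1 ≠ j'.1) :
    2 * d + 1 ≤ (Sj j ∪ Sj j').card ∧ (¬ adjT d j j' → 2 * d + 2 ≤ (Sj j ∪ Sj j').card) := by
  have h1 := Finset.card_union_add_card_inter (Sj j) (Sj j')
  rw [Sj_card hj, Sj_card hj'] at h1
  obtain ⟨h2, h3⟩ := Sj_inter hj hj' hne
  have h4 := Finset.card_le_card h2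
  rw [Finset.card_singleton] at h4
  refine ⟨by omega, fun h => ?_⟩
  have : Sj j ∩ Sj j' = ∅ := by
    rw [← Finset.not_nonempty_iff_eq_empty]
    exact fun h' => h (h3 h')
  rw [this, Finset.card_empty] at h1
  omega

lemma pair_bound {d : ℕ} {p : ℝ} (hp0 : 0 ≤ p) (hp1 : p ≤ 1) {j j' : Finset (Fin n) × Fin n} (hj : j ∈ JJ n d) (hj' : j' ∈ JJ n d) :
    p ^ (Sj j ∪ Sj j').card ≤ p^(2*d+2) + (if j.1 = j'.1 then p^(d+1) else 0) + (if adjT d j j' then p^(2*d+1) else 0) := by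
  by_cases h : j.1 = j'.1
  · rw [if_pos h]
    have h1 : p ^ (Sj j ∪ Sj j').card ≤ p^(d+1) := by
      refine pow_le_pow_of_le_one hp0 hp1 ?_
      rw [← Sj_card hj]
      exact Finset.card_le_card Finset.subset_union_left
    have h2 : (0:ℝ) ≤ if adjT d j j' then p^(2*d+1) else 0 := by split_ifs <;> positivity
    have h3 : 0 ≤ p^(2*d+2) := by positivity
    linarith
  · rw [if_neg h]
    obtain ⟨h1, h2⟩ := Sj_union_card hj hj' h
    by_cases h3 : adjT d j j'
    · rw [if_pos h3]
      have h4 := pow_le_pow_of_le_one hp0 hp1 h1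
      have h3 : 0 ≤ p^(2*d+2) := by positivity
      linarith
    · rw [if_neg h3]
      have h4 := pow_le_pow_of_le_one hp0 hp1 (h2 h3)
      linarith

lemma adj_count {d : ℕ} {j : Finset (Fin n) × Fin n} (hj : j ∈ JJ n d) :
    ((JJ n d).filter (fun j' => adjT d j j')).card ≤ (d+2)^2 * n := by
  have hsub : (JJ n d).filter (fun j' => adjT d j j') ⊆
      ((j.1 ×ˢ (Finset.univ : Finset (Fin n))).image (fun x => insert x.2 (j.1.erase x.1))).biUnion
        (fun T => if T.card = d + 2 then T.image (fun v => (T, v)) else ∅) := by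
    intro j' hj'
    rw [Finset.mem_filter] at hj'
    obtain ⟨hj', hne, hc⟩ := hj'
    obtain ⟨hc1, hm1⟩ := mem_JJ.1 hj
    obtain ⟨hc2, hm2⟩ := mem_JJ.1 hj'
    rw [Finset.mem_biUnion]
    refine ⟨j'.1, ?_, ?_⟩
    · obtain ⟨u, hu, hue⟩ := exists_erase_of_subset (Finset.inter_subset_left : j.1 ∩ j'.1 ⊆ j.1) (by omega)
      obtain ⟨x, hx, hxe⟩ := exists_erase_of_subset (Finset.inter_subset_right : j.1 ∩ j'.1 ⊆ j'.1) (by omega)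
      rw [Finset.mem_image]
      refine ⟨(u, x), Finset.mem_product.2 ⟨hu, Finset.mem_univ _⟩, ?_⟩
      simp only
      rw [← hue, hxe, Finset.insert_erase hx]
    · rw [if_pos hc2, Finset.mem_image]
      exact ⟨j'.2, hm2, rfl⟩
  refine (Finset.card_le_card hsub).trans (Finset.card_biUnion_le.trans ?_)
  refine (Finset.sum_le_card_nsmul _ _ (d+2) fun T _ => ?_).trans ?_
  · split_ifs with h
    · exact Finset.card_image_le.trans h.le
    · simp
  · rw [smul_eq_mul]
    have h1 : ((j.1 ×ˢ (Finset.univ : Finset (Fin n))).image (fun x => insert x.2 (j.1.erase x.1))).card ≤ (d+2) * n := by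
      refine Finset.card_image_le.trans ?_
      rw [Finset.card_product, (mem_JJ.1 hj).1]
      simp
    calc _ ≤ (d+2) * n * (d+2) := Nat.mul_le_mul_right _ h1
      _ = _ := by ring

lemma same_count {d : ℕ} {j : Finset (Fin n) × Fin n} (hj : j ∈ JJ n d) :
    ((JJ n d).filter (fun j' => j.1 = j'.1)).card ≤ d + 2 := by
  have hsub : (JJ n d).filter (fun j' => j.1 = j'.1) ⊆ j.1.image (fun v => (j.1, v)) := by
    intro j' hj'
    rw [Finset.mem_filter] at hj'
    rw [Finset.mem_image]
    refine ⟨j'.2, ?_, ?_⟩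
    · rw [hj'.2]; exact (mem_JJ.1 hj'.1).2
    · rw [hj'.2]
  refine (Finset.card_le_card hsub).trans (Finset.card_image_le.trans (mem_JJ.1 hj).1.le)

def Xn (d : ℕ) (F : Finset (Finset (Fin n))) : ℝ := ∑ j ∈ JJ n d, if Sj j ⊆ F then 1 else 0

def Yn (d : ℕ) (F : Finset (Finset (Fin n))) : ℝ :=
  (∑ j ∈ JJ n d, if insert (j.1.erase j.2) (Sj j) ⊆ F then 1 else 0) +
  ∑ j ∈ JJ n d, ∑ j' ∈ (JJ n d).filter (fun j' => adjT d j j'), if Sj j ∪ Sj j' ⊆ F then 1 else 0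

lemma Xn_exp (d : ℕ) (p : ℝ) : Ew (allFaces n d) p (Xn d) = (JJ n d).card * p^(d+1) := by
  unfold Xn
  rw [Ew_sum, ← nsmul_eq_mul, ← Finset.sum_const]
  refine Finset.sum_congr rfl fun j hj => ?_
  rw [← Sj_card hj, ← Ew_subset (Sj_sub hj)]
  exact Ew_congr fun F _ => by split_ifs <;> rfl

lemma Xn_sq (d : ℕ) {p : ℝ} (hp0 : 0 ≤ p) (hp1 : p ≤ 1) : Ew (allFaces n d) p (fun F => (Xn d F)^2) ≤
    ((JJ n d).card * p^(d+1))^2 + (JJ n d).card * ((d+2) * p^(d+1) + (d+2)^2 * n * p^(2*d+1)) := by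
  have h1 : ∀ F : Finset (Finset (Fin n)), (Xn d F)^2 = ∑ j ∈ JJ n d, ∑ j' ∈ JJ n d, if Sj j ∪ Sj j' ⊆ F then (1:ℝ) else 0 := by
    intro F
    unfold Xn
    rw [sq, Finset.sum_mul_sum]
    refine Finset.sum_congr rfl fun j _ => Finset.sum_congr rfl fun j' _ => ?_
    by_cases h1 : Sj j ⊆ F <;> by_cases h2 : Sj j' ⊆ F <;> simp [h1, h2, Finset.union_subset_iff]
  have h2 : Ew (allFaces n d) p (fun F => (Xn d F)^2) = ∑ j ∈ JJ n d, ∑ j' ∈ JJ n d, p ^ (Sj j ∪ Sj j').card := by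
    simp only [h1]
    rw [Ew_sum]
    refine Finset.sum_congr rfl fun j hj => ?_
    rw [Ew_sum]
    refine Finset.sum_congr rfl fun j' hj' => ?_
    rw [← Ew_subset (Finset.union_subset (Sj_sub hj) (Sj_sub hj'))]
    exact Ew_congr fun F _ => by split_ifs <;> rfl
  rw [h2]
  have h3 : ∀ j ∈ JJ n d, ∑ j' ∈ JJ n d, p ^ (Sj j ∪ Sj j').card ≤
      (JJ n d).card * p^(2*d+2) + ((d+2) * p^(d+1) + (d+2)^2 * n * p^(2*d+1)) := by
    intro j hj
    refine (Finset.sum_le_sum fun j' hj' => pair_bound hp0 hp1 hj hj').trans ?_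
    rw [Finset.sum_add_distrib, Finset.sum_add_distrib, Finset.sum_const, nsmul_eq_mul, ← Finset.sum_filter, ← Finset.sum_filter,
      Finset.sum_const, Finset.sum_const, nsmul_eq_mul, nsmul_eq_mul, add_assoc]
    have e1 : (((JJ n d).filter (fun j' => j.1 = j'.1)).card : ℝ) ≤ d + 2 := by exact_mod_cast same_count hj
    have e2 : (((JJ n d).filter (fun j' => adjT d j j')).card : ℝ) ≤ (d+2)^2*n := by exact_mod_cast adj_count hj
    gcongr
  refine (Finset.sum_le_card_nsmul _ _ _ h3).trans (le_of_eq ?_)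
  rw [nsmul_eq_mul]
  ring

lemma Yn_exp (d : ℕ) {p : ℝ} (hp0 : 0 ≤ p) (hp1 : p ≤ 1) : Ew (allFaces n d) p (Yn d) ≤
    (JJ n d).card * (p^(d+2) + (d+2)^2 * n * p^(2*d+1)) := by
  unfold Yn
  rw [Ew_add, mul_add]
  refine add_le_add ?_ ?_
  · rw [Ew_sum, ← nsmul_eq_mul, ← Finset.sum_const]
    refine Finset.sum_le_sum fun j hj => le_of_eq ?_
    have hjm := mem_JJ.1 hj
    have hc : (insert (j.1.erase j.2) (Sj j)).card = d + 2 := by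
      rw [Finset.card_insert_of_notMem, Sj_card hj]
      intro h
      unfold Sj at h
      rw [Finset.mem_image] at h
      obtain ⟨u, hu, he⟩ := h
      rw [Finset.mem_erase] at hu
      have : j.2 ∈ j.1.erase u := Finset.mem_erase.2 ⟨hu.1.symm, hjm.2⟩
      rw [he] at this
      exact Finset.notMem_erase _ _ this
    rw [← hc, ← Ew_subset (A := allFaces n d)]
    · exact Ew_congr fun F _ => by split_ifs <;> rfl
    · intro σ hσ
      rw [Finset.mem_insert] at hσ
      rcases hσ with rfl | hσ
      · rw [mem_allFaces, Finset.card_erase_of_mem hjm.2, hjm.1]; rfl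
      · exact Sj_sub hj hσ
  · rw [Ew_sum, ← nsmul_eq_mul, ← Finset.sum_const]
    refine Finset.sum_le_sum fun j hj => ?_
    rw [Ew_sum]
    have e2 : (((JJ n d).filter (fun j' => adjT d j j')).card : ℝ) ≤ (d+2)^2*n := by exact_mod_cast adj_count hj
    refine (Finset.sum_le_card_nsmul _ _ (p^(2*d+1)) fun j' hj' => ?_).trans ?_
    · rw [Finset.mem_filter] at hj'
      have h1 : Ew (allFaces n d) p (fun F => if Sj j ∪ Sj j' ⊆ F then 1 else 0) = p ^ (Sj j ∪ Sj j').card := by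
        rw [← Ew_subset (Finset.union_subset (Sj_sub hj) (Sj_sub hj'.1))]
        exact Ew_congr fun F _ => by split_ifs <;> rfl
      rw [h1]
      exact pow_le_pow_of_le_one hp0 hp1 (Sj_union_card hj hj'.1 hj'.2.1).1
    · rw [nsmul_eq_mul]
      gcongr

lemma card_le_image_pairs {α β : Type*} (s : Finset α) (f : α → β) :
    s.card ≤ (s.image f).card + ∑ a ∈ s, (s.filter (fun b => a ≠ b ∧ f a = f b)).card := by
  induction s using Finset.induction_on with
  | empty => simp
  | insert a s ha ih =>
    rw [Finset.card_insert_of_notMem ha, Finset.image_insert, Finset.sum_insert ha]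
    have h1 : ∑ x ∈ s, (s.filter (fun b => x ≠ b ∧ f x = f b)).card ≤
        ∑ x ∈ s, ((insert a s).filter (fun b => x ≠ b ∧ f x = f b)).card :=
      Finset.sum_le_sum fun x _ => Finset.card_le_card (Finset.filter_subset_filter _ (Finset.subset_insert _ _))
    by_cases h : f a ∈ s.image f
    · rw [Finset.insert_eq_of_mem h]
      obtain ⟨b, hb, hbe⟩ := Finset.mem_image.1 h
      have h2 : 0 < ((insert a s).filter (fun b => a ≠ b ∧ f a = f b)).card := by
        refine Finset.card_pos.2 ⟨b, Finset.mem_filter.2 ⟨Finset.mem_insert_of_mem hb, ?_, hbe.symm⟩⟩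
        rintro rfl
        exact ha hb
      omega
    · rw [Finset.card_insert_of_notMem h]
      omega

lemma Sj_sub_iff {F : Finset (Finset (Fin n))} {j : Finset (Fin n) × Fin n} :
    Sj j ⊆ F ↔ ∀ u ∈ j.1, u ≠ j.2 → j.1.erase u ∈ F := by
  unfold Sj
  rw [Finset.image_subset_iff]
  simp only [Finset.mem_erase]
  exact ⟨fun h u hu hne => h u ⟨hne, hu⟩, fun h u hu => h u hu.2 hu.1⟩

lemma shadow_le (d : ℕ) (F : Finset (Finset (Fin n))) :
    ((shadowR n d F).card : ℝ) ≤ Xn d F + (shOther n d F).card := by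
  have h1 : shadowR n d F ⊆ ((JJ n d).filter (fun j => Sj j ⊆ F)).image (fun j => j.1.erase j.2) ∪ shOther n d F := by
    intro σ hσ
    rw [Finset.mem_union]
    by_cases h : completes d F σ
    · left
      obtain ⟨T, hT, v, hv, he, hF⟩ := h
      rw [Finset.mem_image]
      exact ⟨(T, v), Finset.mem_filter.2 ⟨mem_JJ.2 ⟨hT, hv⟩, Sj_sub_iff.2 hF⟩, he.symm⟩
    · right
      exact Finset.mem_filter.2 ⟨hσ, h⟩
  have h2 := (Finset.card_le_card h1).trans (Finset.card_union_le _ _)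
  have h3 := h2.trans (Nat.add_le_add_right Finset.card_image_le _)
  unfold Xn
  rw [Finset.sum_boole]
  exact_mod_cast h3

lemma shadow_ge (d : ℕ) (F : Finset (Finset (Fin n))) :
    Xn d F - Yn d F ≤ ((shadowR n d F).card : ℝ) := by
  set J' := (JJ n d).filter (fun j => Sj j ⊆ F ∧ j.1.erase j.2 ∉ F) with hJ'
  have h1 := card_le_image_pairs J' (fun j => j.1.erase j.2)
  have h2 : J'.image (fun j => j.1.erase j.2) ⊆ shadowR n d F := by
    intro σ hσ
    rw [Finset.mem_image] at hσ
    obtain ⟨j, hj, rfl⟩ := hσ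
    rw [hJ', Finset.mem_filter] at hj
    obtain ⟨hj1, hj2⟩ := mem_JJ.1 hj.1
    rw [mem_shadowR, mem_allFaces]
    refine ⟨?_, hj.2.2, colv_erase_mem hj2 (Sj_sub_iff.1 hj.2.1)⟩
    rw [Finset.card_erase_of_mem hj2, hj1]; rfl
  have h3 : Xn d F = (J'.card : ℝ) + (((JJ n d).filter (fun j => insert (j.1.erase j.2) (Sj j) ⊆ F)).card : ℝ) := by
    unfold Xn
    rw [Finset.sum_boole]
    norm_cast
    rw [← Finset.card_filter_add_card_filter_not (s := (JJ n d).filter (fun j => Sj j ⊆ F)) (fun j => j.1.erase j.2 ∉ F)]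
    rw [Finset.filter_filter, Finset.filter_filter]
    congr 2
    ext j
    simp only [Finset.mem_filter, Finset.insert_subset_iff, not_not]
    tauto
  have h4 : ((∑ a ∈ J', (J'.filter (fun b => a ≠ b ∧ a.1.erase a.2 = b.1.erase b.2)).card : ℕ) : ℝ) ≤
      ∑ j ∈ JJ n d, ∑ j' ∈ (JJ n d).filter (fun j' => adjT d j j'), if Sj j ∪ Sj j' ⊆ F then 1 else 0 := by
    push_cast
    have h5 : ∀ j ∈ JJ n d, (0:ℝ) ≤ ∑ j' ∈ (JJ n d).filter (fun j' => adjT d j j'), if Sj j ∪ Sj j' ⊆ F then 1 else 0 :=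
      fun j _ => Finset.sum_nonneg fun _ _ => by split_ifs <;> norm_num
    refine le_trans (Finset.sum_le_sum fun j hj => ?_) (Finset.sum_le_sum_of_subset_of_nonneg (Finset.filter_subset _ _) fun j hj _ => h5 j hj)
    rw [Finset.sum_boole]
    norm_cast
    refine Finset.card_le_card ?_
    intro j' hj'
    rw [hJ', Finset.mem_filter] at hj
    rw [hJ', Finset.mem_filter, Finset.mem_filter] at hj'
    obtain ⟨⟨hj'J, hj'S, hj'F⟩, hne, heq⟩ := hj'
    obtain ⟨hjJ, hjS, hjF⟩ := hj
    obtain ⟨ha1, ha2⟩ := mem_JJ.1 hjJ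
    obtain ⟨hb1, hb2⟩ := mem_JJ.1 hj'J
    rw [Finset.mem_filter, Finset.mem_filter]
    have hT : j.1 ≠ j'.1 := by
      intro hT
      apply hne
      refine Prod.ext hT ?_
      by_contra hv
      have : j.2 ∈ j'.1.erase j'.2 := Finset.mem_erase.2 ⟨hv, hT ▸ ha2⟩
      rw [← heq] at this
      exact Finset.notMem_erase _ _ this
    refine ⟨⟨hj'J, hT, ?_⟩, Finset.union_subset hjS hj'S⟩
    have hle := inter_card_le ha1 hb1 hT
    have hsub : j.1.erase j.2 ⊆ j.1 ∩ j'.1 :=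
      Finset.subset_inter (Finset.erase_subset _ _) (by rw [heq]; exact Finset.erase_subset _ _)
    have := Finset.card_le_card hsub
    rw [Finset.card_erase_of_mem ha2, ha1] at this
    omega
  have h6 : (J'.card : ℝ) ≤ ((J'.image (fun j => j.1.erase j.2)).card : ℝ) +
      ((∑ a ∈ J', (J'.filter (fun b => a ≠ b ∧ a.1.erase a.2 = b.1.erase b.2)).card : ℕ) : ℝ) := by
    exact_mod_cast (h1.trans (le_of_eq (by congr!)))
  have h7 : ((J'.image (fun j => j.1.erase j.2)).card : ℝ) ≤ (shadowR n d F).card := by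
    exact_mod_cast Finset.card_le_card h2
  unfold Yn
  rw [Finset.sum_boole, h3]
  linarith

end moment

end Part18

section Part19

lemma JJ_card (n d : ℕ) : (JJ n d).card = n.choose (d+2) * (d+2) := by
  have h := Finset.card_eq_sum_card_fiberwise (s := JJ n d) (t := Finset.powersetCard (d+2) (Finset.univ : Finset (Fin n)))
    (f := fun j => j.1) (by
      intro j hj
      have := (mem_JJ.1 hj).1
      simp [Finset.mem_powersetCard, this])
  rw [h]
  have h2 : ∀ T ∈ Finset.powersetCard (d+2) (Finset.univ : Finset (Fin n)), ((JJ n d).filter (fun j => j.1 = T)).card = d + 2 := by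
    intro T hT
    have hT2 := (Finset.mem_powersetCard.1 hT).2
    have : (JJ n d).filter (fun j => j.1 = T) = T.image (fun v => (T, v)) := by
      ext ⟨A, v⟩
      simp only [Finset.mem_filter, mem_JJ, Finset.mem_image, Prod.mk.injEq]
      constructor
      · rintro ⟨⟨h1, h2⟩, rfl⟩
        exact ⟨v, h2, rfl, rfl⟩
      · rintro ⟨w, hw, rfl, rfl⟩
        exact ⟨⟨hT2, hw⟩, rfl⟩
    rw [this, Finset.card_image_of_injective _ (fun a b h => (Prod.mk.inj h).2), hT2]
  rw [Finset.sum_congr rfl h2, Finset.sum_const, Finset.card_powersetCard, smul_eq_mul, Finset.card_univ, Fintype.card_fin]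

lemma JJ_upper (n d : ℕ) : ((JJ n d).card : ℝ) ≤ (d+2) * n^(d+2) := by
  have h : (JJ n d).card ≤ (d+2) * n^(d+2) := by
    rw [JJ_card, mul_comm]
    exact Nat.mul_le_mul_left _ (Nat.choose_le_pow _ _)
  exact_mod_cast h

lemma JJ_lower (n d : ℕ) (hn : 2*(d+2) ≤ n) : (n:ℝ)^(d+2) / (2^(d+2) * (d+2).factorial) ≤ ((JJ n d).card : ℝ) := by
  have h1 := Nat.pow_le_choose (α := ℝ) (d+2) n
  have h2 : ((n:ℝ)/2)^(d+2) ≤ ((n + 1 - (d+2) : ℕ) : ℝ)^(d+2) := by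
    gcongr
    have : n ≤ 2 * (n + 1 - (d+2)) := by omega
    have : (n:ℝ) ≤ 2 * ((n + 1 - (d+2) : ℕ) : ℝ) := by exact_mod_cast this
    linarith
  have h3 : ((n.choose (d+2) : ℕ) : ℝ) ≤ ((JJ n d).card : ℝ) := by
    rw [JJ_card]
    exact_mod_cast Nat.le_mul_of_pos_right _ (by omega)
  refine le_trans ?_ h3
  refine le_trans ?_ h1
  rw [div_mul_eq_div_div, ← div_pow]
  push_cast at h2 ⊢
  gcongr

/-- The bad events for the second-moment argument. -/
lemma final_bounds (d : ℕ) (hd : 2 ≤ d) (c : ℝ) (hc0 : 0 < c) :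
    ∃ a0 b0 K : ℝ, 0 < a0 ∧ 0 < b0 ∧ 0 < K ∧ ∀ᶠ n : ℕ in atTop, ∃ μ : ℝ, a0 * n ≤ μ ∧ μ ≤ b0 * n ∧
      Ew (allFaces n d) (c/n) (fun F => (Xn d F - μ)^2) ≤ K * μ ∧
      Ew (allFaces n d) (c/n) (Yn d) ≤ K := by
  refine ⟨c^(d+1) / (2^(d+2) * (d+2).factorial), (d+2) * c^(d+1),
    ((d+2) + (d+2)^2 * c^d) + (d+2) * c^(d+1) * (c + (d+2)^2 * c^d), by positivity, by positivity, by positivity, ?_⟩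
  filter_upwards [eventually_p_le_one c, eventually_ge_atTop (2*(d+2))] with n hp1 hn
  have hnpos : (0:ℝ) < n := by
    have : 0 < n := by omega
    exact_mod_cast this
  have hn1 : (1:ℝ) ≤ n := by
    have : 1 ≤ n := by omega
    exact_mod_cast this
  have hp0 : 0 ≤ c/n := by positivity
  set p := c/(n:ℝ) with hp
  have hnp : n * p = c := by rw [hp]; field_simp
  have hnp2 : (n:ℝ)^2 * p^d ≤ c^d := by
    rw [← hnp, mul_pow]
    gcongr
  have hnp1 : (n:ℝ) * p^d ≤ c^d := by
    refine le_trans ?_ hnp2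
    gcongr
    nlinarith
  set N : ℝ := ((JJ n d).card : ℝ) with hN
  have hN0 : 0 ≤ N := by positivity
  set μ := N * p^(d+1) with hμ
  have hcc : (n:ℝ)^(d+2) * p^(d+1) = c^(d+1) * n := by
    rw [← hnp]; ring
  have hμlow : c^(d+1) / (2^(d+2) * (d+2).factorial) * n ≤ μ := by
    have := mul_le_mul_of_nonneg_right (JJ_lower n d hn) (pow_nonneg hp0 (d+1))
    rw [div_mul_eq_mul_div, hcc] at this
    rw [div_mul_eq_mul_div]
    exact this
  have hμup : μ ≤ (d+2) * c^(d+1) * n := by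
    have := mul_le_mul_of_nonneg_right (JJ_upper n d) (pow_nonneg hp0 (d+1))
    rw [mul_assoc, hcc, ← mul_assoc] at this
    exact this
  have hμ0 : 0 ≤ μ := by positivity
  refine ⟨μ, hμlow, hμup, ?_, ?_⟩
  · have e1 : Ew (allFaces n d) p (fun F => (Xn d F - μ)^2) = Ew (allFaces n d) p (fun F => (Xn d F)^2) - μ^2 := by
      have : ∀ F : Finset (Finset (Fin n)), (Xn d F - μ)^2 = ((Xn d F)^2 + (-2*μ) * Xn d F) + μ^2 := fun F => by ring
      simp only [this]
      rw [Ew_add, Ew_add, Ew_mul, Ew_const]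
      have := Xn_exp (n := n) d p
      change _ + _ * Ew (allFaces n d) p (Xn d) + _ = _
      rw [this, ← hN, ← hμ]
      ring
    rw [e1]
    have e2 := Xn_sq (n := n) d hp0 hp1
    rw [← hN, ← hμ] at e2
    have e3 : N * ((d+2) * p^(d+1) + (d+2)^2 * n * p^(2*d+1)) = ((d+2) + (d+2)^2 * (n * p^d)) * μ := by
      rw [hμ]; ring
    rw [e3] at e2
    have e4 : ((d+2) + (d+2)^2 * (n * p^d)) * μ ≤ ((d+2) + (d+2)^2 * c^d) * μ := by gcongr
    have e5 : 0 ≤ (d+2) * c^(d+1) * (c + (d+2)^2 * c^d) * μ := by positivity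
    nlinarith
  · refine (Yn_exp d hp0 hp1).trans ?_
    rw [← hN]
    have e3 : N * (p^(d+2) + (d+2)^2 * n * p^(2*d+1)) = μ * (p + (d+2)^2 * (n * p^d)) := by
      rw [hμ]; ring
    rw [e3]
    have e4 : μ * (p + (d+2)^2 * (n * p^d)) ≤ ((d+2) * c^(d+1) * n) * (p + (d+2)^2 * (n * p^d)) := by gcongr
    have e5 : ((d+2) * c^(d+1) * n) * (p + (d+2)^2 * (n * p^d)) = (d+2) * c^(d+1) * (n * p + (d+2)^2 * (n^2 * p^d)) := by ring
    have e6 : (d+2) * c^(d+1) * (n * p + (d+2)^2 * (n^2 * p^d)) ≤ (d+2) * c^(d+1) * (c + (d+2)^2 * c^d) := by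
      rw [hnp]; gcongr
    have e7 : 0 ≤ ((d+2) + (d+2)^2 * c^d) := by positivity
    linarith

lemma Yn_nonneg {n : ℕ} (d : ℕ) (F : Finset (Finset (Fin n))) : 0 ≤ Yn d F := by
  unfold Yn
  refine add_nonneg (Finset.sum_nonneg fun j _ => ?_) (Finset.sum_nonneg fun j _ => Finset.sum_nonneg fun j' _ => ?_)
  all_goals split_ifs <;> norm_num

theorem statement2' (d : ℕ) (hd : 2 ≤ d) (c td : ℝ) (hc0 : 0 < c)
    (htd : td ∈ Set.Ioo (0 : ℝ) 1)
    (hroot : ((d : ℝ) + 1) * (1 - td) + (1 + (d : ℝ) * td) * Real.log td = 0)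
    (hc : c < -Real.log td / (1 - td) ^ d) :
    ∃ a b : ℝ, 0 < a ∧ 0 < b ∧
      Filter.Tendsto (fun n : ℕ =>
        probY n d (c / n) (fun F =>
          a * n ≤ ((shadowR n d F).card : ℝ) ∧ ((shadowR n d F).card : ℝ) ≤ b * n))
        atTop (nhds 1) := by
  obtain ⟨a0, b0, K, ha0, hb0, hK, hev⟩ := final_bounds d hd c hc0
  refine ⟨a0/4, 3/2*b0 + 1, by positivity, by positivity, ?_⟩
  have hS := shOther_small d hd c td hc0 htd hroot hc
  have hT : Tendsto (fun n : ℕ => 8 * K / a0 / (n:ℝ)) atTop (nhds 0) :=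
    tendsto_const_nhds.div_atTop tendsto_natCast_atTop_atTop
  have hlow : Tendsto (fun n : ℕ => 1 - (8 * K / a0 / (n:ℝ) + Ew (allFaces n d) (c/n)
      (fun F => if n ≤ (shOther n d F).card then (1:ℝ) else 0))) atTop (nhds 1) := by
    have := (tendsto_const_nhds (x := (1:ℝ))).sub (hT.add hS)
    simpa using this
  refine tendsto_of_tendsto_of_tendsto_of_le_of_le' hlow tendsto_const_nhds ?_ ?_
  · filter_upwards [hev, eventually_p_le_one c, eventually_ge_atTop 1] with n hμ hp1 hn
    obtain ⟨μ, hμ1, hμ2, hvar, hY⟩ := hμ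
    have hnpos : (0:ℝ) < n := by exact_mod_cast hn
    have hp0 : 0 ≤ c/(n:ℝ) := by positivity
    have han : 0 < a0 * n := by positivity
    have hμ0 : 0 < μ := lt_of_lt_of_le han hμ1
    have m1 := Ew_markov (A := allFaces n d) hp0 hp1 (g := fun F => (Xn d F - μ)^2) (fun F _ => sq_nonneg _)
      (t := (μ/2)^2) (by positivity)
    have m2 := Ew_markov (A := allFaces n d) hp0 hp1 (g := Yn d) (fun F _ => Yn_nonneg d F) (t := μ/4) (by positivity)
    have q1 : Ew (allFaces n d) (c/n) (fun F => (Xn d F - μ)^2) / (μ/2)^2 ≤ 4 * K / a0 / n := by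
      rw [div_div, div_le_div_iff₀ (by positivity) (by positivity)]
      have : Ew (allFaces n d) (c/n) (fun F => (Xn d F - μ)^2) * (a0 * n) ≤ (K * μ) * μ := by gcongr
      nlinarith
    have q2 : Ew (allFaces n d) (c/n) (Yn d) / (μ/4) ≤ 4 * K / a0 / n := by
      rw [div_div, div_le_div_iff₀ (by positivity) (by positivity)]
      have : Ew (allFaces n d) (c/n) (Yn d) * (a0 * n) ≤ K * μ := by gcongr
      nlinarith
    have q3 : 8 * K / a0 / (n:ℝ) = 4 * K / a0 / n + 4 * K / a0 / n := by ring
    rw [probY_eq]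
    have key : Ew (allFaces n d) (c/n) (fun _ => (1:ℝ)) ≤ Ew (allFaces n d) (c/n) (fun F =>
        (if (a0/4 * n ≤ ((shadowR n d F).card : ℝ) ∧ ((shadowR n d F).card : ℝ) ≤ (3/2*b0+1) * n) then (1:ℝ) else 0) +
        ((if (μ/2)^2 ≤ (Xn d F - μ)^2 then (1:ℝ) else 0) + (if μ/4 ≤ Yn d F then (1:ℝ) else 0) +
        (if n ≤ (shOther n d F).card then (1:ℝ) else 0))) := by
      refine Ew_mono hp0 hp1 fun F _ => ?_
      have i1 : (0:ℝ) ≤ (if (a0/4 * n ≤ ((shadowR n d F).card : ℝ) ∧ ((shadowR n d F).card : ℝ) ≤ (3/2*b0+1) * n) then (1:ℝ) else 0) := by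
        split_ifs <;> norm_num
      have i2 : (0:ℝ) ≤ (if (μ/2)^2 ≤ (Xn d F - μ)^2 then (1:ℝ) else 0) := by split_ifs <;> norm_num
      have i3 : (0:ℝ) ≤ (if μ/4 ≤ Yn d F then (1:ℝ) else 0) := by split_ifs <;> norm_num
      have i4 : (0:ℝ) ≤ (if n ≤ (shOther n d F).card then (1:ℝ) else 0) := by split_ifs <;> norm_num
      by_cases c2 : (μ/2)^2 ≤ (Xn d F - μ)^2
      · rw [if_pos c2]; linarith
      by_cases c3 : μ/4 ≤ Yn d F
      · rw [if_pos c3]; linarith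
      by_cases c4 : n ≤ (shOther n d F).card
      · rw [if_pos c4]; linarith
      have hab := abs_lt_of_sq_lt_sq (not_le.1 c2) (by positivity)
      rw [abs_lt] at hab
      have s1 := shadow_le d F
      have s2 := shadow_ge d F
      have c4' : ((shOther n d F).card : ℝ) ≤ n := by exact_mod_cast (not_le.1 c4).le
      rw [not_le] at c3
      rw [if_pos ⟨by linarith, by linarith⟩]
      linarith
    rw [Ew_const, Ew_add, Ew_add, Ew_add] at key
    have k1 : Ew (allFaces n d) (c/n) (fun F => if (μ/2)^2 ≤ (Xn d F - μ)^2 then (1:ℝ) else 0) ≤ 4 * K / a0 / n := by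
      refine le_trans (le_of_eq ?_) (m1.trans q1)
      exact Ew_congr fun F _ => by split_ifs <;> rfl
    have k2 : Ew (allFaces n d) (c/n) (fun F => if μ/4 ≤ Yn d F then (1:ℝ) else 0) ≤ 4 * K / a0 / n := by
      refine le_trans (le_of_eq ?_) (m2.trans q2)
      exact Ew_congr fun F _ => by split_ifs <;> rfl
    refine le_trans ?_ (le_of_eq (Ew_congr (g := fun F => if (a0/4 * n ≤ ((shadowR n d F).card : ℝ) ∧
      ((shadowR n d F).card : ℝ) ≤ (3/2*b0+1) * n) then (1:ℝ) else 0) fun F _ => by split_ifs <;> rfl))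
    linarith
  · filter_upwards [eventually_p_le_one c] with n hp1
    have hp0 : 0 ≤ c/(n:ℝ) := by positivity
    rw [probY_eq]
    refine (Ew_mono hp0 hp1 (g' := fun _ => 1) fun F _ => ?_).trans (Ew_const _ _ _).le
    split_ifs <;> norm_num


end Part19

/-- For `d ≥ 2` and `0 < c < c_d^*`, a.a.s. the real shadow of
`Y_d(n, c/n)` has size `Θ(n)`. -/
theorem statement2 (d : ℕ) (hd : 2 ≤ d) (c td : ℝ) (hc0 : 0 < c)
    (htd : td ∈ Set.Ioo (0 : ℝ) 1)
    (hroot : ((d : ℝ) + 1) * (1 - td) + (1 + (d : ℝ) * td) * Real.log td = 0)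
    (hc : c < -Real.log td / (1 - td) ^ d) :
    ∃ a b : ℝ, 0 < a ∧ 0 < b ∧
      Filter.Tendsto (fun n : ℕ =>
        probY n d (c / n) (fun F =>
          a * n ≤ ((shadowR n d F).card : ℝ) ∧ ((shadowR n d F).card : ℝ) ≤ b * n))
        atTop (nhds 1) := by
  exact statement2' d hd c td hc0 htd hroot hc

end
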